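/- (Thomas) For every n ≥ 1, the isomorphism equivalence relation ≅_n on additive subgroups of ℚ^n is strictly below the isomorphism relation ≅_{n+1} on additive subgroups of ℚ^{n+1} in Borel cardinality: ≅_n is Borel reducible to ≅_{n+1}, but ≅_{n+1} is not Borel reducible to ≅_n. Here subgroups of ℚ^n are identified with points of the Polish space 2^(ℚ^n), on which the set of additive subgroups is Borel, and two subgroups are equivalent if and only if they are isomorphic as additive groups. -/

import Mathlib

/-- The set of points of `2^(ℚ^n)` coding additive subgroups of `ℚ^n`. -/
def ratPowSubgroups (n : ℕ) : Set ((Fin n → ℚ) → Bool) :=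
  {A | ∃ H : AddSubgroup (Fin n → ℚ), ∀ v : Fin n → ℚ, A v = true ↔ v ∈ H}

/-- Two codes are related if they code additive subgroups of `ℚ^n` that are
isomorphic as additive groups. -/
def ratPowIso (n : ℕ) (A B : (Fin n → ℚ) → Bool) : Prop :=
  ∃ H K : AddSubgroup (Fin n → ℚ), (∀ v : Fin n → ℚ, A v = true ↔ v ∈ H) ∧
    (∀ v : Fin n → ℚ, B v = true ↔ v ∈ K) ∧ Nonempty (H ≃+ K)

section
open MeasureTheory Filter Topology Set
open scoped ENNReal NNReal

noncomputable section

namespace Thomas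

/-- the subgroup coded by a point -/
def toSub {n : ℕ} (A : ratPowSubgroups n) : AddSubgroup (Fin n → ℚ) := A.2.choose

lemma mem_toSub {n : ℕ} (A : ratPowSubgroups n) (v) : v ∈ toSub A ↔ A.1 v = true :=
  (A.2.choose_spec v).symm

lemma iso_iff {n : ℕ} (A B : ratPowSubgroups n) :
    ratPowIso n A.1 B.1 ↔ Nonempty (toSub A ≃+ toSub B) := by
  constructor
  · rintro ⟨H, K, h1, h2, h3⟩
    have e1 : toSub A = H := by ext v; rw [mem_toSub, h1]
    have e2 : toSub B = K := by ext v; rw [mem_toSub, h2]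
    rw [e1, e2]; exact h3
  · intro h
    exact ⟨_, _, fun v => (mem_toSub A v).symm, fun v => (mem_toSub B v).symm, h⟩

open Classical in
/-- code of a subgroup -/
def code {n : ℕ} (H : AddSubgroup (Fin n → ℚ)) : ratPowSubgroups n :=
  ⟨fun v => decide (v ∈ H), H, fun v => by simp⟩

lemma toSub_code {n : ℕ} (H : AddSubgroup (Fin n → ℚ)) : toSub (code H) = H := by
  ext v; rw [mem_toSub]; simp [code]

lemma meas_sub (n : ℕ) : MeasurableSet (ratPowSubgroups n) := by
  have : ratPowSubgroups n = {A | A 0 = true} ∩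
      ⋂ (v : Fin n → ℚ) (w : Fin n → ℚ), ({A | A v = true}ᶜ ∪ {A | A w = true}ᶜ ∪ {A | A (v - w) = true}) := by
    ext A
    simp only [mem_inter_iff, mem_ofPred_eq, mem_iInter, mem_union, mem_compl_iff]
    constructor
    · rintro ⟨H, h⟩
      refine ⟨(h 0).2 H.zero_mem, fun v w => ?_⟩
      rw [h, h, h]
      have : v ∈ H → w ∈ H → v - w ∈ H := H.sub_mem
      tauto
    · rintro ⟨h0, h⟩
      have hs : ∀ v w, A v = true → A w = true → A (v - w) = true := fun v w => by
        have := h v w; tauto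
      have hn : ∀ v, A v = true → A (-v) = true := fun v hv => by simpa using hs 0 v h0 hv
      exact ⟨⟨⟨⟨{v | A v = true}, fun {v w} hv hw => by simpa using hs v (-w) hv (hn w hw)⟩, h0⟩,
        fun {v} hv => hn v hv⟩, fun v => Iff.rfl⟩
  rw [this]
  have hm : ∀ v : Fin n → ℚ, MeasurableSet {A : (Fin n → ℚ) → Bool | A v = true} :=
    fun v => measurableSet_eq_fun (measurable_pi_apply v) measurable_const
  exact (hm 0).inter (.iInter fun v => .iInter fun w => (((hm v).compl).union (hm w).compl).union (hm _))

lemma measurable_code {n : ℕ} {X : Type*} [MeasurableSpace X] {f : X → AddSubgroup (Fin n → ℚ)}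
    (h : ∀ v, MeasurableSet {x | v ∈ f x}) : Measurable fun x => code (f x) := by
  refine Measurable.subtype_mk (measurable_pi_lambda _ fun v => ?_)
  refine measurable_to_bool ?_
  convert h v using 1
  ext x; simp

lemma meas_mem_toSub {n : ℕ} (v : Fin n → ℚ) : MeasurableSet {A : ratPowSubgroups n | v ∈ toSub A} := by
  simp only [mem_toSub]
  exact measurableSet_eq_fun ((measurable_pi_apply v).comp measurable_subtype_coe) measurable_const

lemma embed (n : ℕ) : ∃ f : ratPowSubgroups n → ratPowSubgroups (n + 1), Measurable f ∧
      ∀ A B : ratPowSubgroups n, ratPowIso n A.1 B.1 ↔ ratPowIso (n + 1) (f A).1 (f B).1 := by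
  let i : (Fin n → ℚ) →+ (Fin (n + 1) → ℚ) :=
    { toFun := fun v => Fin.cons 0 v
      map_zero' := by ext j; refine Fin.cases ?_ (fun k => ?_) j <;> simp
      map_add' := fun v w => by ext j; refine Fin.cases ?_ (fun k => ?_) j <;> simp }
  have hi : Function.Injective i := fun v w h => Fin.cons_right_injective (α := fun _ => ℚ) 0 h
  refine ⟨fun A => code ((toSub A).map i), measurable_code fun v => ?_, fun A B => ?_⟩
  · by_cases h : ∃ w, i w = v
    · obtain ⟨w, rfl⟩ := h
      convert meas_mem_toSub w using 1
      ext A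
      exact AddSubgroup.mem_map_iff_mem hi
    · convert MeasurableSet.empty
      ext A
      simp only [AddSubgroup.mem_map, mem_ofPred_eq, mem_empty_iff_false, iff_false]
      rintro ⟨w, -, hw⟩
      exact h ⟨w, hw⟩
  · rw [iso_iff, iso_iff, toSub_code, toSub_code]
    have e := fun C : ratPowSubgroups n => (toSub C).equivMapOfInjective i hi
    exact ⟨fun ⟨f⟩ => ⟨((e A).symm.trans f).trans (e B)⟩, fun ⟨f⟩ => ⟨((e A).trans f).trans (e B).symm⟩⟩

end Thomas
end
end

section
open MeasureTheory Filter Topology Set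
open scoped ENNReal NNReal

noncomputable section
namespace Thomas

abbrev Z2 := Fin 2 → ℤ
abbrev Tor := UnitAddTorus (Fin 2)
abbrev ee (v : Z2) : C(Tor, ℂ) := UnitAddTorus.mFourier v

/-- normalized Haar measure on the torus -/
def haarT : Measure Tor := Measure.pi fun _ => AddCircle.haarAddCircle

instance : IsProbabilityMeasure haarT := by unfold haarT; infer_instance

lemma norm_ee (v : Z2) (θ : Tor) : ‖ee v θ‖ = 1 := by
  simp [ee, UnitAddTorus.mFourier, Circle.norm_coe]

lemma integral_ee (v : Z2) : ∫ θ, ee v θ ∂haarT = if v = 0 then 1 else 0 := by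
  have h1 : ∀ n : ℤ, ∫ t : UnitAddCircle, (fourier n t : ℂ) ∂AddCircle.haarAddCircle = if n = 0 then 1 else 0 := by
    intro n
    have h := orthonormal_iff_ite.1 (orthonormal_fourier (T := 1)) 0 n
    rw [ContinuousMap.inner_toLp (@AddCircle.haarAddCircle 1 _) (fourier 0) (fourier n)] at h
    simpa [eq_comm] using h
  have h2 := integral_fintype_prod_eq_prod (ι := Fin 2) (𝕜 := ℂ) (E := fun _ => UnitAddCircle)
    (fun i t => (fourier (v i) t : ℂ)) (μ := fun _ => AddCircle.haarAddCircle)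
  have h3 : (v = 0) ↔ v 0 = 0 ∧ v 1 = 0 := by
    rw [funext_iff, Fin.forall_fin_two]; rfl
  unfold haarT
  simp only [ee, UnitAddTorus.mFourier, ContinuousMap.coe_mk]
  rw [h2]
  simp only [h1, Fin.prod_univ_two, h3]
  by_cases a : v 0 = 0 <;> by_cases b : v 1 = 0 <;> simp [a, b]

lemma integrable_cont {m : Measure Tor} [IsFiniteMeasure m] {E : Type*} [NormedAddCommGroup E]
    {f : Tor → E} (hf : Continuous f) : Integrable f m := by
  exact integrableOn_univ.1 (hf.continuousOn.integrableOn_compact isCompact_univ)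

/-- Fourier uniqueness -/
lemma ext_fourier {m m' : Measure Tor} [IsFiniteMeasure m] [IsFiniteMeasure m']
    (h : ∀ v, ∫ θ, ee v θ ∂m = ∫ θ, ee v θ ∂m') : m = m' := by
  have key : ∀ f : C(Tor, ℂ), ∫ θ, f θ ∂m = ∫ θ, f θ ∂m' := by
    have hc : ∀ (k : Measure Tor) [IsFiniteMeasure k], Continuous fun f : C(Tor, ℂ) => ∫ θ, f θ ∂k :=
      fun k _ => by
        have := (ContinuousMap.toLp (E := ℂ) 1 k ℂ).continuous
        refine (continuous_integral.comp ((ContinuousMap.toLp (E := ℂ) 1 k ℂ).continuous)).congr fun f => ?_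
        exact integral_congr_ae (ContinuousMap.coeFn_toLp k f)
    have hcl : IsClosed {f : C(Tor, ℂ) | ∫ θ, f θ ∂m = ∫ θ, f θ ∂m'} := isClosed_eq (hc m) (hc m')
    have hs : ((Submodule.span ℂ (range (UnitAddTorus.mFourier (d := Fin 2)))) : Set C(Tor, ℂ)) ⊆
        {f : C(Tor, ℂ) | ∫ θ, f θ ∂m = ∫ θ, f θ ∂m'} := by
      intro f hf
      induction hf using Submodule.span_induction with
      | mem x hx => obtain ⟨v, rfl⟩ := hx; exact h v
      | zero => simp
      | add x y _ _ hx hy =>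
        simp only [mem_ofPred_eq, ContinuousMap.add_apply] at hx hy ⊢
        rw [integral_add (integrable_cont x.continuous) (integrable_cont y.continuous),
          integral_add (integrable_cont x.continuous) (integrable_cont y.continuous), hx, hy]
      | smul a x _ hx =>
        simp only [mem_ofPred_eq, ContinuousMap.smul_apply] at hx ⊢
        rw [integral_smul, integral_smul, hx]
    intro f
    have hf : f ∈ (Submodule.span ℂ (range (UnitAddTorus.mFourier (d := Fin 2)))).topologicalClosure := by
      rw [UnitAddTorus.span_mFourier_closure_eq_top]; trivial
    exact hcl.closure_subset_iff.2 hs hf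
  refine ext_of_forall_integral_eq_of_IsFiniteMeasure fun f => ?_
  have := key ⟨fun θ => (f θ : ℂ), by fun_prop⟩
  simp only [ContinuousMap.coe_mk, integral_complex_ofReal] at this
  exact_mod_cast this

/-- the box -/
def box (R : ℕ) : Finset Z2 := Fintype.piFinset fun _ => Finset.Ico (0 : ℤ) R

lemma card_box (R : ℕ) : ((box R).card : ℝ) = R ^ 2 := by simp [box]

/-- real quadratic density attached to a function `C` on pairs -/
def dens (C : Z2 → Z2 → ℝ) (R : ℕ) (θ : Tor) : ℝ :=
  (1 / (R : ℝ) ^ 2) * ∑ a ∈ box R, ∑ b ∈ box R, C a b * (ee (a - b) θ).re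

lemma continuous_dens (C R) : Continuous (dens C R) := by
  unfold dens
  refine continuous_const.mul (continuous_finsetSum _ fun a _ => continuous_finsetSum _ fun b _ =>
    continuous_const.mul (Complex.continuous_re.comp (ee (a - b)).continuous))

lemma re_ee_sub (a b : Z2) (θ : Tor) : (ee (a - b) θ).re = (ee a θ).re * (ee b θ).re + (ee a θ).im * (ee b θ).im := by
  rw [sub_eq_add_neg, ee, UnitAddTorus.mFourier_add, UnitAddTorus.mFourier_neg]
  simp

lemma integral_dens (C : Z2 → Z2 → ℝ) (R : ℕ) :
    ∫ θ, dens C R θ ∂haarT = (1 / (R : ℝ) ^ 2) * ∑ a ∈ box R, C a a := by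
  unfold dens
  rw [integral_const_mul, integral_finsetSum]
  · congr 1
    refine Finset.sum_congr rfl fun a ha => ?_
    rw [integral_finsetSum]
    · have h : ∀ b, ∫ θ, C a b * (ee (a - b) θ).re ∂haarT = if a = b then C a b else 0 := by
        intro b
        have := integral_ee (a - b)
        rw [integral_const_mul]
        have h2 : ∫ θ, (ee (a - b) θ).re ∂haarT = (∫ θ, ee (a - b) θ ∂haarT).re :=
          integral_re (integrable_cont (ee (a - b)).continuous)
        rw [h2, this]
        simp only [sub_eq_zero]
        split_ifs <;> simp
      simp [h, ha]
    · exact fun b _ => integrable_cont (continuous_const.mul (Complex.continuous_re.comp (ee (a - b)).continuous))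
  · exact fun a _ => integrable_cont (continuous_finsetSum _ fun b _ =>
      continuous_const.mul (Complex.continuous_re.comp (ee (a - b)).continuous))

lemma tendsto_boxcount (v : Z2) :
    Tendsto (fun R : ℕ => (1 / (R : ℝ) ^ 2) * ((box R).filter fun a => a + v ∈ box R).card) atTop (𝓝 1) := by
  have h : ∀ R : ℕ, (((box R).filter fun a => a + v ∈ box R).card : ℝ) =
      ∏ i, ((((R:ℤ) - |v i|).toNat : ℕ) : ℝ) := by
    intro R
    have : ((box R).filter fun a => a + v ∈ box R) =
        Fintype.piFinset fun i => Finset.Ico (max 0 (-v i)) (min (R : ℤ) (R - v i)) := by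
      ext a
      simp only [box, Finset.mem_filter, Fintype.mem_piFinset, Finset.mem_Ico, Pi.add_apply, ← forall_and]
      exact forall_congr' fun i => by omega
    rw [this, Fintype.card_piFinset]
    push_cast
    refine Finset.prod_congr rfl fun i _ => ?_
    rw [Int.card_Ico]
    congr 2
    rcases abs_cases (v i) with h | h <;> omega
  have hi : ∀ i, Tendsto (fun R : ℕ => ((((R:ℤ) - |v i|).toNat : ℕ) : ℝ) / R) atTop (𝓝 1) := by
    intro i
    have h1 : Tendsto (fun R : ℕ => 1 - (|v i| : ℝ) / R) atTop (𝓝 1) := by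
      simpa using tendsto_const_nhds.sub (tendsto_const_div_atTop_nhds_zero_nat (|v i| : ℝ))
    refine h1.congr' ?_
    filter_upwards [eventually_ge_atTop (|v i|.toNat + 1)] with R hR
    have hR0 : (R : ℝ) ≠ 0 := by
      have : 0 < R := by omega
      positivity
    have : ((((R:ℤ) - |v i|).toNat : ℕ) : ℤ) = R - |v i| := by omega
    have h2 : ((((R:ℤ) - |v i|).toNat : ℕ) : ℝ) = R - |(v i : ℝ)| := by exact_mod_cast this
    rw [h2]; field_simp
  have := (hi 0).mul (hi 1)
  simp only [h, Fin.prod_univ_two]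
  refine (this.congr fun R => ?_).trans (by simp)
  ring

/-- `Φ` normalized, symmetric, positive definite -/
structure PD (Φ : Z2 → ℝ) : Prop where
  one : Φ 0 = 1
  symm : ∀ v, Φ (-v) = Φ v
  pos : ∀ (s : Finset Z2) (c : Z2 → ℝ), 0 ≤ ∑ a ∈ s, ∑ b ∈ s, c a * c b * Φ (a - b)

lemma dens_eq (C : Z2 → Z2 → ℝ) (R θ) : dens C R θ = (1 / (R : ℝ) ^ 2) *
    (∑ a ∈ box R, ∑ b ∈ box R, (ee a θ).re * (ee b θ).re * C a b +
     ∑ a ∈ box R, ∑ b ∈ box R, (ee a θ).im * (ee b θ).im * C a b) := by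
  unfold dens
  simp only [← Finset.sum_add_distrib, re_ee_sub]
  congr 1
  refine Finset.sum_congr rfl fun a _ => Finset.sum_congr rfl fun b _ => ?_
  ring

lemma dens_nonneg {Φ} (h : PD Φ) (R θ) : 0 ≤ dens (fun a b => Φ (a - b)) R θ := by
  rw [dens_eq]
  have := h.pos (box R) (fun a => (ee a θ).re)
  have := h.pos (box R) (fun a => (ee a θ).im)
  positivity

lemma integral_dens_pd {Φ} (h : PD Φ) {R : ℕ} (hR : 0 < R) : ∫ θ, dens (fun a b => Φ (a - b)) R θ ∂haarT = 1 := by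
  rw [integral_dens]
  simp only [sub_self, h.one, Finset.sum_const, nsmul_eq_mul, card_box, mul_one]
  field_simp

/-- approximating measures -/
def appr (Φ : Z2 → ℝ) (R : ℕ) : Measure Tor :=
  haarT.withDensity fun θ => ENNReal.ofReal (dens (fun a b => Φ (a - b)) R θ)

lemma integral_appr {Φ} (h : PD Φ) (R : ℕ) {E : Type*} [NormedAddCommGroup E] [NormedSpace ℝ E] (g : Tor → E) :
    ∫ θ, g θ ∂(appr Φ R) = ∫ θ, dens (fun a b => Φ (a - b)) R θ • g θ ∂haarT := by
  unfold appr
  rw [integral_withDensity_eq_integral_toReal_smul₀]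
  · exact integral_congr_ae (.of_forall fun θ => by simp [ENNReal.toReal_ofReal (dens_nonneg h R θ)])
  · exact (continuous_dens _ _).measurable.ennreal_ofReal.aemeasurable
  · exact .of_forall fun θ => ENNReal.ofReal_lt_top

lemma isProb_appr {Φ} (h : PD Φ) {R : ℕ} (hR : 0 < R) : IsProbabilityMeasure (appr Φ R) := by
  constructor
  rw [appr, withDensity_apply _ .univ, Measure.restrict_univ, ← ofReal_integral_eq_lintegral_ofReal
    (integrable_cont (continuous_dens _ _)) (.of_forall fun θ => dens_nonneg h R θ), integral_dens_pd h hR]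
  simp

lemma fourier_appr {Φ} (h : PD Φ) (R : ℕ) (v : Z2) : ∫ θ, ee v θ ∂(appr Φ R) =
    ((((1 / (R : ℝ) ^ 2) * ((box R).filter fun a => a + v ∈ box R).card) * Φ v : ℝ) : ℂ) := by
  rw [integral_appr h]
  have hd : ∀ θ, (dens (fun a b => Φ (a - b)) R θ : ℂ) = (1 / (R : ℂ) ^ 2) *
      ∑ a ∈ box R, ∑ b ∈ box R, Φ (a - b) * ee (a - b) θ := by
    intro θ
    apply Complex.ext
    · simp only [dens, Complex.ofReal_re]
      have : (1 / (R : ℂ) ^ 2) = ((1 / (R : ℝ) ^ 2 : ℝ) : ℂ) := by push_cast; rfl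
      rw [this, Complex.re_ofReal_mul]
      simp [Complex.re_sum]
    · have : (1 / (R : ℂ) ^ 2) = ((1 / (R : ℝ) ^ 2 : ℝ) : ℂ) := by push_cast; rfl
      rw [this, Complex.im_ofReal_mul]
      have h0 : ∑ a ∈ box R, ∑ b ∈ box R, (Φ (a - b) * ee (a - b) θ : ℂ).im =
          - ∑ a ∈ box R, ∑ b ∈ box R, (Φ (a - b) * ee (a - b) θ : ℂ).im := by
        conv_lhs => rw [Finset.sum_comm]
        simp only [← Finset.sum_neg_distrib]
        refine Finset.sum_congr rfl fun a _ => Finset.sum_congr rfl fun b _ => ?_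
        rw [← neg_sub a b, h.symm, ee, UnitAddTorus.mFourier_neg]
        simp
      simp only [Complex.ofReal_im, Complex.im_sum]
      rw [self_eq_neg.1 h0]; simp
  simp only [Complex.real_smul, hd]
  have h1 : ∀ θ, (1 / (R : ℂ) ^ 2) * (∑ a ∈ box R, ∑ b ∈ box R, Φ (a - b) * ee (a - b) θ) * ee v θ =
      (1 / (R : ℂ) ^ 2) * (∑ a ∈ box R, ∑ b ∈ box R, Φ (a - b) * ee (a - b + v) θ) := by
    intro θ
    simp only [ee, UnitAddTorus.mFourier_add, mul_assoc, Finset.sum_mul]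
  simp only [h1]
  rw [integral_const_mul, integral_finsetSum]
  · push_cast
    rw [mul_assoc]
    congr 1
    rw [Finset.card_filter]
    push_cast
    rw [Finset.sum_mul]
    refine Finset.sum_congr rfl fun a _ => ?_
    rw [integral_finsetSum]
    · have : ∀ b, ∫ θ, Φ (a - b) * ee (a - b + v) θ ∂haarT = if a + v = b then (Φ v : ℂ) else 0 := by
        intro b
        rw [integral_const_mul, integral_ee]
        have : a - b + v = 0 ↔ a + v = b := by rw [sub_add_eq_add_sub, sub_eq_zero]
        simp only [this]
        split_ifs with hb
        · subst hb; simp [← h.symm v]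
        · simp
      simp [this]
    · exact fun b _ => integrable_cont (continuous_const.mul (ee _).continuous)
  · exact fun a _ => integrable_cont (continuous_finsetSum _ fun b _ => continuous_const.mul (ee _).continuous)

/-- Bochner, with the approximation along an ultrafilter -/
lemma bochner {Φ} (h : PD Φ) : ∃ ν : ProbabilityMeasure Tor, (∀ v, ∫ θ, ee v θ ∂(ν : Measure Tor) = (Φ v : ℂ)) ∧
    ∀ g : C(Tor, ℝ), Tendsto (fun R : ℕ => ∫ θ, g θ ∂(appr Φ (R + 1))) (hyperfilter ℕ : Filter ℕ) (𝓝 (∫ θ, g θ ∂(ν : Measure Tor))) := by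
  let p : ℕ → ProbabilityMeasure Tor := fun R => ⟨appr Φ (R + 1), isProb_appr h R.succ_pos⟩
  obtain ⟨ν, -, hν⟩ := isCompact_univ.ultrafilter_le_nhds ((hyperfilter ℕ).map p) (by simp)
  have hν : Tendsto p (hyperfilter ℕ : Filter ℕ) (𝓝 ν) := hν
  refine ⟨ν, fun v => ?_, fun g => ?_⟩
  · have h1 := (ProbabilityMeasure.tendsto_iff_forall_integral_rclike_tendsto ℂ).1 hν
      (BoundedContinuousFunction.mkOfCompact (ee v))
    refine tendsto_nhds_unique h1 ?_
    have h2 : Tendsto (fun R : ℕ => ((((1 / ((R + 1 : ℕ) : ℝ) ^ 2) * ((box (R + 1)).filter fun a => a + v ∈ box (R + 1)).card) * Φ v : ℝ) : ℂ))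
        (hyperfilter ℕ : Filter ℕ) (𝓝 ((1 * Φ v : ℝ) : ℂ)) :=
      (Complex.continuous_ofReal.tendsto _).comp ((((tendsto_boxcount v).comp (tendsto_add_atTop_nat 1)).mul_const _).mono_left
        Nat.hyperfilter_le_atTop)
    rw [one_mul] at h2
    exact h2.congr fun R => (fourier_appr h (R + 1) v).symm
  · exact ProbabilityMeasure.tendsto_iff_forall_integral_tendsto.1 hν (BoundedContinuousFunction.mkOfCompact g)

end Thomas
end
end

section
open MeasureTheory Filter Topology Set
open scoped ENNReal NNReal

noncomputable section
namespace Thomas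

/-- joint positive definiteness of two stationary kernels with a cross kernel -/
def JPD (Φ Ψ : Z2 → ℝ) (C : Z2 → Z2 → ℝ) : Prop :=
  ∀ (s : Finset Z2) (c d : Z2 → ℝ), 0 ≤ ∑ a ∈ s, ∑ b ∈ s,
    (c a * c b * Φ (a - b) + 2 * (c a * d b * C a b) + d a * d b * Ψ (a - b))

lemma dens_tv {Φ Ψ C} (h : JPD Φ Ψ C) (R θ) (α β : ℝ) :
    0 ≤ α ^ 2 * dens (fun a b => Φ (a - b)) R θ + 2 * (α * β) * dens C R θ + β ^ 2 * dens (fun a b => Ψ (a - b)) R θ := by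
  have key : ∀ w : Z2 → ℝ, 0 ≤ α ^ 2 * (∑ a ∈ box R, ∑ b ∈ box R, w a * w b * Φ (a - b)) +
      2 * (α * β) * (∑ a ∈ box R, ∑ b ∈ box R, w a * w b * C a b) +
      β ^ 2 * (∑ a ∈ box R, ∑ b ∈ box R, w a * w b * Ψ (a - b)) := by
    intro w
    have := h (box R) (fun a => α * w a) (fun a => β * w a)
    convert this using 1
    simp only [Finset.mul_sum, ← Finset.sum_add_distrib]
    refine Finset.sum_congr rfl fun a _ => Finset.sum_congr rfl fun b _ => ?_
    ring
  simp only [dens_eq]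
  have h1 := key fun a => (ee a θ).re
  have h2 := key fun a => (ee a θ).im
  have h3 : 0 ≤ (1 / (R : ℝ) ^ 2) := by positivity
  have := mul_nonneg h3 (add_nonneg h1 h2)
  beta_reduce at this
  refine this.trans_eq ?_
  ring

lemma tv_cont {Φ Ψ C} (hΦ : PD Φ) (hΨ : PD Ψ) (h : JPD Φ Ψ C) {s : ℝ} (hs : 0 < s) (hC : ∀ a, 1 - s ^ 2 ≤ C a a)
    {R : ℕ} (hR : 0 < R) (g : C(Tor, ℝ)) (g0 : ∀ θ, 0 ≤ g θ) (g1 : ∀ θ, g θ ≤ 1) :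
    |∫ θ, g θ ∂(appr Φ R) - ∫ θ, g θ ∂(appr Ψ R)| ≤ 3 * s := by
  rw [integral_appr hΦ, integral_appr hΨ]
  set f := dens (fun a b => Φ (a - b)) R with hf
  set f' := dens (fun a b => Ψ (a - b)) R with hf'
  set x := dens C R with hx
  have cf : Continuous f := continuous_dens _ _
  have cf' : Continuous f' := continuous_dens _ _
  have cx : Continuous x := continuous_dens _ _
  rw [← integral_sub (integrable_cont (by fun_prop)) (integrable_cont (by fun_prop))]
  have hb : ∀ θ, |f θ • g θ - f' θ • g θ| ≤ (1 / (2 * s)) * (f θ + f' θ - 2 * x θ) + s * (f θ + f' θ) := by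
    intro θ
    have e1 := dens_tv h R θ (1 - s) (-(1 + s))
    have e2 := dens_tv h R θ (1 + s) (-(1 - s))
    rw [← hf, ← hf', ← hx] at e1 e2
    rw [smul_eq_mul, smul_eq_mul, ← sub_mul, abs_mul, abs_of_nonneg (g0 θ)]
    have e3 : |f θ - f' θ| ≤ (1 / (2 * s)) * (f θ + f' θ - 2 * x θ) + s * (f θ + f' θ) := by
      have e4 := dens_tv h R θ 1 (-1)
      rw [← hf, ← hf', ← hx] at e4
      have : (1 / (2 * s)) * (f θ + f' θ - 2 * x θ) + s * (f θ + f' θ) =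
        ((f θ + f' θ - 2 * x θ) + 2 * s ^ 2 * (f θ + f' θ)) / (2 * s) := by field_simp
      rw [this, le_div_iff₀ (by positivity), ← abs_of_pos (by positivity : 0 < 2 * s), ← abs_mul, abs_le]
      constructor <;> nlinarith [mul_nonneg (sq_nonneg s) e4]
    calc _ ≤ |f θ - f' θ| * 1 := mul_le_mul_of_nonneg_left (g1 θ) (abs_nonneg _)
      _ ≤ _ := by rwa [mul_one]
  refine (abs_integral_le_integral_abs).trans ((integral_mono (integrable_cont (by fun_prop)) (integrable_cont (by fun_prop)) hb).trans ?_)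
  have i1 : ∫ θ, f θ ∂haarT = 1 := integral_dens_pd hΦ hR
  have i2 : ∫ θ, f' θ ∂haarT = 1 := integral_dens_pd hΨ hR
  have i3 : 1 - s ^ 2 ≤ ∫ θ, x θ ∂haarT := by
    rw [hx, integral_dens]
    have h1 : ∑ a ∈ box R, (1 - s ^ 2) ≤ ∑ a ∈ box R, C a a := Finset.sum_le_sum fun a _ => hC a
    rw [Finset.sum_const, nsmul_eq_mul, card_box] at h1
    rw [one_div, inv_mul_eq_div, le_div_iff₀ (by positivity)]
    linarith
  have i4 : ∫ θ, ((1 / (2 * s)) * (f θ + f' θ - 2 * x θ) + s * (f θ + f' θ)) ∂haarT =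
      (1 / (2 * s)) * (1 + 1 - 2 * ∫ θ, x θ ∂haarT) + s * (1 + 1) := by
    rw [integral_add (integrable_cont (by fun_prop)) (integrable_cont (by fun_prop)), integral_const_mul,
      integral_const_mul, integral_sub (integrable_cont (by fun_prop)) (integrable_cont (by fun_prop)),
      integral_const_mul, integral_add (integrable_cont (by fun_prop)) (integrable_cont (by fun_prop)), i1, i2]
  rw [i4]
  have : (1 / (2 * s)) * (1 + 1 - 2 * ∫ θ, x θ ∂haarT) ≤ s := by
    rw [one_div, inv_mul_eq_div, div_le_iff₀ (by positivity)]
    nlinarith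
  linarith

lemma tv_sets {ν ν' : ProbabilityMeasure Tor} {c : ℝ}
    (h : ∀ g : C(Tor, ℝ), (∀ θ, 0 ≤ g θ) → (∀ θ, g θ ≤ 1) →
      ∫ θ, g θ ∂(ν : Measure Tor) ≤ ∫ θ, g θ ∂(ν' : Measure Tor) + c) {E : Set Tor} (hE : MeasurableSet E) :
    (ν : Measure Tor).real E ≤ (ν' : Measure Tor).real E + c := by
  refine le_of_forall_pos_le_add fun η hη => ?_
  obtain ⟨K, hKE, hK, hK2⟩ := hE.exists_isCompact_lt_add (μ := (ν : Measure Tor)) (measure_ne_top _ _)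
    (ENNReal.ofReal_pos.2 (half_pos hη)).ne'
  obtain ⟨U, hEU, hU, hU2⟩ := E.exists_isOpen_lt_add (μ := (ν' : Measure Tor)) (measure_ne_top _ _)
    (ENNReal.ofReal_pos.2 (half_pos hη)).ne'
  obtain ⟨g, g0, g1, g01⟩ := exists_continuous_zero_one_of_isClosed hU.isClosed_compl hK.isClosed
    (disjoint_compl_left_iff_subset.2 (hKE.trans hEU))
  have hg := h g (fun θ => (g01 θ).1) (fun θ => (g01 θ).2)
  have a1 : (ν : Measure Tor).real K ≤ ∫ θ, g θ ∂(ν : Measure Tor) := by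
    rw [← integral_indicator_one hK.measurableSet]
    refine integral_mono ((integrable_const 1).indicator hK.measurableSet) (integrable_cont g.continuous) fun θ => ?_
    by_cases hθ : θ ∈ K
    · simp [hθ, g1 hθ]
    · simp [hθ, (g01 θ).1]
  have a2 : ∫ θ, g θ ∂(ν' : Measure Tor) ≤ (ν' : Measure Tor).real U := by
    rw [← integral_indicator_one hU.measurableSet]
    refine integral_mono (integrable_cont g.continuous) ((integrable_const 1).indicator hU.measurableSet) fun θ => ?_
    by_cases hθ : θ ∈ U
    · simp [hθ, (g01 θ).2]
    · simp [hθ, g0 hθ]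
  have a3 : (ν : Measure Tor).real E ≤ (ν : Measure Tor).real K + η / 2 := by
    have := ENNReal.toReal_mono (by finiteness) hK2.le
    rwa [ENNReal.toReal_add (by finiteness) (by finiteness), ENNReal.toReal_ofReal (half_pos hη).le] at this
  have a4 : (ν' : Measure Tor).real U ≤ (ν' : Measure Tor).real E + η / 2 := by
    have := ENNReal.toReal_mono (by finiteness) hU2.le
    rwa [ENNReal.toReal_add (by finiteness) (by finiteness), ENNReal.toReal_ofReal (half_pos hη).le] at this
  linarith

/-- near invariance of the spectral measure -/
lemma spectral_tv {Φ} (hΦ : PD Φ) (ν : ProbabilityMeasure Tor) (hν : ∀ v, ∫ θ, ee v θ ∂(ν : Measure Tor) = (Φ v : ℂ))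
    {σ : Z2 → Z2} {φ : Tor → Tor} (hφ : Continuous φ) (hσ : ∀ v θ, ee v (φ θ) = ee (σ v) θ)
    (hΨ : PD fun v => Φ (σ v)) {C} (h : JPD Φ (fun v => Φ (σ v)) C) {s : ℝ} (hs : 0 < s) (hC : ∀ a, 1 - s ^ 2 ≤ C a a)
    {E : Set Tor} (hE : MeasurableSet E) :
    |(ν : Measure Tor).real E - (ν : Measure Tor).real (φ ⁻¹' E)| ≤ 3 * s := by
  obtain ⟨ν₁, e1, t1⟩ := bochner hΦ
  obtain ⟨ν₂, e2, t2⟩ := bochner hΨ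
  have q1 : (ν : Measure Tor) = ν₁ := ext_fourier fun v => by rw [hν, e1]
  have q2 : (ν : Measure Tor).map φ = ν₂ := ext_fourier fun v => by
    rw [integral_map hφ.aemeasurable (ee v).continuous.aestronglyMeasurable, e2]
    simp only [hσ, hν]
  have hlim : ∀ g : C(Tor, ℝ), (∀ θ, 0 ≤ g θ) → (∀ θ, g θ ≤ 1) →
      |∫ θ, g θ ∂(ν₁ : Measure Tor) - ∫ θ, g θ ∂(ν₂ : Measure Tor)| ≤ 3 * s := fun g g0 g1 =>
    le_of_tendsto ((t1 g).sub (t2 g)).abs (.of_forall fun R => tv_cont hΦ hΨ h hs hC R.succ_pos g g0 g1)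
  rw [← map_measureReal_apply hφ.measurable hE, q1] at *
  rw [← q1, q2, q1, abs_le]
  constructor
  · have := tv_sets (ν := ν₂) (ν' := ν₁) (c := 3 * s) (fun g g0 g1 => by have := abs_le.1 (hlim g g0 g1); linarith) hE
    linarith
  · have := tv_sets (ν := ν₁) (ν' := ν₂) (c := 3 * s) (fun g g0 g1 => by have := abs_le.1 (hlim g g0 g1); linarith) hE
    linarith

end Thomas
end
end

section
open MeasureTheory Filter Topology Set
open scoped ENNReal NNReal

noncomputable section
namespace Thomas

lemma circ_lift (t : UnitAddCircle) : ∃ x : ℝ, (x : UnitAddCircle) = t ∧ |x| = ‖t‖ := by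
  obtain ⟨y, rfl⟩ := QuotientAddGroup.mk_surjective t
  refine ⟨y - round y, ?_, (UnitAddCircle.norm_eq (x := y)).symm⟩
  have h : ((round y : ℝ) : UnitAddCircle) = 0 := by
    rw [AddCircle.coe_eq_zero_iff]; exact ⟨round y, by simp⟩
  rw [AddCircle.coe_sub, h, sub_zero]

lemma circ_norm {x : ℝ} (h : |x| ≤ 1 / 2) : ‖(x : UnitAddCircle)‖ = |x| := by
  exact (AddCircle.norm_coe_eq_abs_iff (p := 1) one_ne_zero).2 (by simpa using h)

/-- dual shear -/
def sh (N : ℤ) (j k : Fin 2) (θ : Tor) : Tor := θ + Pi.single j (N • θ k)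

lemma continuous_sh (N j k) : Continuous (sh N j k) := by
  unfold sh
  exact continuous_id.add ((continuous_single (A := fun _ : Fin 2 => UnitAddCircle) j).comp ((continuous_apply k).zsmul N))

lemma sh_k {N j k} (h : j ≠ k) (θ) : sh N j k θ k = θ k := by simp [sh, h.symm]
lemma sh_j {N j k} (θ) : sh N j k θ j = θ j + N • θ k := by simp [sh]

lemma sh_sh {N j k} (h : j ≠ k) (θ) : sh N j k (sh (-N) j k θ) = θ := by
  ext i
  by_cases hi : i = j
  · subst hi; rw [sh_j, sh_j, sh_k h]; simp
  · simp [sh, hi]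

lemma pp_arith {N : ℤ} (hN : 3 ≤ |N|) {x y r : ℝ} (hr : r * (|(N : ℝ)| + 1) ≤ 1 / 4) (hxy : |x| ≤ |y|) (hy : |y| < r) (hy0 : y ≠ 0) :
    |x + N * y| < 1 / 4 ∧ |y| < |x + N * y| ∧ 0 < N * ((x + N * y) * y) ∧ |y| < 1 / 4 := by
  have hN' : (3 : ℝ) ≤ |(N : ℝ)| := by exact_mod_cast hN
  have hy1 : 0 < |y| := abs_pos.2 hy0
  have h1 : |N * y| = |(N : ℝ)| * |y| := abs_mul _ _
  have h2 := abs_add_le x (N * y)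
  have h3 : |(N : ℝ) * y| ≤ |x + N * y| + |x| := by
    have := abs_sub (x + N * y) x; simpa using this
  refine ⟨by nlinarith, by nlinarith, ?_, by nlinarith⟩
  have h4 : -(|(N : ℝ)| * (|x| * |y|)) ≤ N * (x * y) := by
    rw [← abs_mul, ← abs_mul]; exact neg_abs_le _
  have h5 : (N : ℝ) * (N * y * y) = |(N : ℝ)| ^ 2 * |y| ^ 2 := by rw [sq_abs, sq_abs]; ring
  have h6 : |(N : ℝ)| * (|x| * |y|) ≤ |(N : ℝ)| * (|y| * |y|) := by gcongr
  have h7 : 0 < |(N : ℝ)| * |y| ^ 2 := by positivity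
  nlinarith

lemma abs_add_sub {x y : ℝ} (h : 0 < x * y) : |x - y| < |x + y| := by
  rw [← sq_lt_sq]; nlinarith

def Qs (N : ℤ) (j k : Fin 2) : Set Tor :=
  {θ | ‖θ k‖ < ‖θ j‖ ∧ if 0 < N then ‖θ j - θ k‖ < ‖θ j + θ k‖ else ‖θ j + θ k‖ < ‖θ j - θ k‖}

def Ps (r : ℝ) (j k : Fin 2) : Set Tor := {θ | ‖θ j‖ ≤ ‖θ k‖ ∧ ‖θ k‖ < r ∧ θ k ≠ 0}

lemma pp_incl {N : ℤ} (hN : 3 ≤ |N|) {r : ℝ} (hr : r * (|(N : ℝ)| + 1) ≤ 1 / 4) {j k : Fin 2} (hjk : j ≠ k) :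
    Ps r j k ⊆ sh N j k ⁻¹' Qs N j k := by
  rintro θ ⟨h1, h2, h3⟩
  obtain ⟨x, hx, hx'⟩ := circ_lift (θ j)
  obtain ⟨y, hy, hy'⟩ := circ_lift (θ k)
  obtain ⟨a1, a2, a3, a4⟩ := pp_arith hN (x := x) (y := y) hr (by rw [hx', hy']; exact h1) (by rw [hy']; exact h2)
    (by rintro rfl; exact h3 (by rw [← hy]; simp))
  have e1 : sh N j k θ j = ((x + N * y : ℝ) : UnitAddCircle) := by
    rw [sh_j, ← hx, ← hy, AddCircle.coe_add, ← zsmul_eq_mul, AddCircle.coe_zsmul]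
  have n1 := abs_add_le (x + N * y) y
  have n2 := abs_sub (x + N * y) y
  simp only [Qs, mem_preimage, mem_ofPred_eq]
  rw [sh_k hjk, e1, ← hy, ← AddCircle.coe_sub, ← AddCircle.coe_add, circ_norm (by linarith), circ_norm (by linarith),
    circ_norm (by linarith), circ_norm (by linarith)]
  refine ⟨a2, ?_⟩
  split_ifs with hN0
  · have : (0 : ℝ) < N := by exact_mod_cast hN0
    exact abs_add_sub (pos_of_mul_pos_right a3 this.le)
  · have : (N : ℝ) ≤ 0 := by exact_mod_cast not_lt.1 hN0
    have := abs_add_sub (x := x + N * y) (y := -y) (by nlinarith)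
    rwa [sub_neg_eq_add, ← sub_eq_add_neg] at this

lemma pp {ν : Measure Tor} [IsProbabilityMeasure ν] {N : ℤ} (hN : 3 ≤ N) {r c β : ℝ} (hr : r * (N + 1) ≤ 1 / 4)
    (hc : ∀ j k : Fin 2, j ≠ k → ∀ E, MeasurableSet E → |ν.real E - ν.real (sh N j k ⁻¹' E)| ≤ c)
    (hb : ∀ j, ν.real {θ | r ≤ ‖θ j‖} ≤ β) : 1 - 4 * c - 4 * β ≤ ν.real {0} := by
  have hm : ∀ j : Fin 2, Measurable fun θ : Tor => ‖θ j‖ := fun j => by fun_prop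
  have hm' : ∀ j k : Fin 2, Measurable (fun θ : Tor => ‖θ j - θ k‖) ∧ Measurable (fun θ : Tor => ‖θ j + θ k‖) :=
    fun j k => ⟨by fun_prop, by fun_prop⟩
  have m1 : ∀ j k N, MeasurableSet (Qs N j k) := by
    intro j k N
    unfold Qs
    by_cases h : 0 < N
    · simp only [h, if_true]
      exact (measurableSet_lt (hm k) (hm j)).inter (measurableSet_lt (hm' j k).1 (hm' j k).2)
    · simp only [h, if_false]
      exact (measurableSet_lt (hm k) (hm j)).inter (measurableSet_lt (hm' j k).2 (hm' j k).1)
  have mP : ∀ j k, MeasurableSet (Ps r j k) := fun j k => by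
    refine (measurableSet_le (hm j) (hm k)).inter ((measurableSet_lt (hm k) measurable_const).inter ?_)
    exact (measurableSet_eq_fun (measurable_pi_apply k) measurable_const).compl
  have hc' : ∀ j k : Fin 2, j ≠ k → ∀ E, MeasurableSet E → |ν.real E - ν.real (sh (-N) j k ⁻¹' E)| ≤ c := by
    intro j k hjk E hE
    have := hc j k hjk (sh (-N) j k ⁻¹' E) ((continuous_sh _ _ _).measurable hE)
    have e : sh N j k ⁻¹' (sh (-N) j k ⁻¹' E) = E := by
      ext θ
      have := sh_sh (N := -N) hjk θ
      rw [neg_neg] at this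
      simp [this]
    rw [e] at this
    rwa [abs_sub_comm]
  have key : ∀ j k : Fin 2, j ≠ k → 2 * ν.real (Ps r j k) ≤ ν.real (Ps r k j) + β + 2 * c := by
    intro j k hjk
    have aN : |(N : ℝ)| = N := by rw [abs_of_pos]; exact_mod_cast (by omega : 0 < N)
    have i1 := measureReal_mono (μ := ν) (pp_incl (N := N) (r := r) (by rw [abs_of_pos] <;> omega) (by rwa [aN]) hjk)
    have i2 := measureReal_mono (μ := ν) (pp_incl (N := -N) (r := r) (by rw [abs_neg, abs_of_pos] <;> omega)
      (by push_cast; rwa [abs_neg, aN]) hjk)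
    have j1 := abs_le.1 (hc j k hjk _ (m1 j k N))
    have j2 := abs_le.1 (hc' j k hjk _ (m1 j k (-N)))
    have d : Disjoint (Qs N j k) (Qs (-N) j k) := by
      rw [Set.disjoint_left]
      rintro θ ⟨-, h1⟩ ⟨-, h2⟩
      rw [if_pos (by omega)] at h1
      rw [if_neg (by omega)] at h2
      exact lt_asymm h1 h2
    have u := measureReal_union (μ := ν) d (m1 j k (-N))
    have s : Qs N j k ∪ Qs (-N) j k ⊆ Ps r k j ∪ {θ | r ≤ ‖θ j‖} := by
      have : ∀ θ : Tor, ‖θ k‖ < ‖θ j‖ → θ ∈ Ps r k j ∪ {θ | r ≤ ‖θ j‖} := by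
        intro θ h
        by_cases hr : r ≤ ‖θ j‖
        · exact Or.inr hr
        · exact Or.inl ⟨h.le, not_le.1 hr, norm_pos_iff.1 ((norm_nonneg _).trans_lt h)⟩
      rintro θ (h | h)
      exacts [this θ h.1, this θ h.1]
    have v := (measureReal_mono (μ := ν) s).trans (measureReal_union_le _ _)
    linarith [hb j]
  have k1 := key 0 1 (by decide)
  have k2 := key 1 0 (by decide)
  have cov : (univ : Set Tor) ⊆ ((({0} ∪ Ps r 0 1) ∪ Ps r 1 0) ∪ {θ | r ≤ ‖θ 0‖}) ∪ {θ | r ≤ ‖θ 1‖} := by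
    intro θ _
    by_cases h0 : r ≤ ‖θ 0‖
    · exact Or.inl (Or.inr h0)
    by_cases h1 : r ≤ ‖θ 1‖
    · exact Or.inr h1
    refine Or.inl (Or.inl ?_)
    by_cases hz : θ = 0
    · exact Or.inl (Or.inl hz)
    rcases le_total ‖θ 0‖ ‖θ 1‖ with h | h
    · refine Or.inl (Or.inr ⟨h, not_le.1 h1, fun h' => hz ?_⟩)
      have : θ 0 = 0 := norm_le_zero_iff.1 (by simpa [h'] using h)
      ext i; fin_cases i <;> assumption
    · refine Or.inr ⟨h, not_le.1 h0, fun h' => hz ?_⟩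
      have : θ 1 = 0 := norm_le_zero_iff.1 (by simpa [h'] using h)
      ext i; fin_cases i <;> assumption
  have t := measureReal_mono (μ := ν) cov
  rw [probReal_univ] at t
  have t1 := measureReal_union_le (μ := ν) ((({0} ∪ Ps r 0 1) ∪ Ps r 1 0) ∪ {θ | r ≤ ‖θ 0‖}) {θ | r ≤ ‖θ 1‖}
  have t2 := measureReal_union_le (μ := ν) (({0} ∪ Ps r 0 1) ∪ Ps r 1 0) {θ | r ≤ ‖θ 0‖}
  have t3 := measureReal_union_le (μ := ν) ({0} ∪ Ps r 0 1) (Ps r 1 0)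
  have t4 := measureReal_union_le (μ := ν) {0} (Ps r 0 1)
  linarith [hb 0, hb 1]

lemma ee_single (j : Fin 2) (a : ℕ) (θ : Tor) : ee (Pi.single j (a : ℤ)) θ = (fourier 1 (θ j) : ℂ) ^ a := by
  induction a with
  | zero => simp [ee, UnitAddTorus.mFourier_zero]
  | succ a ih =>
    rw [Nat.cast_succ, Pi.single_add, ee, UnitAddTorus.mFourier_add, pow_succ]
    rw [ee] at ih
    rw [ih, UnitAddTorus.mFourier_single]

lemma conc {r : ℝ} (hr : 0 < r) : ∃ R : ℕ, 0 < R ∧ ∀ (ν : Measure Tor) [IsProbabilityMeasure ν] (δ : ℝ) (j : Fin 2),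
    (∀ a : ℕ, a < R → 1 - δ ≤ (∫ θ, ee (Pi.single j (a : ℤ)) θ ∂ν).re) → ν.real {θ | r ≤ ‖θ j‖} ≤ 2 * δ := by
  have hcl : IsCompact {t : UnitAddCircle | r ≤ ‖t‖} := (isClosed_le continuous_const continuous_norm).isCompact
  have hf : Continuous fun t : UnitAddCircle => ‖1 - (fourier 1 t : ℂ)‖ := by fun_prop
  have hη : ∃ η > 0, ∀ t : UnitAddCircle, r ≤ ‖t‖ → η ≤ ‖1 - (fourier 1 t : ℂ)‖ := by
    obtain h | h := {t : UnitAddCircle | r ≤ ‖t‖}.eq_empty_or_nonempty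
    · exact ⟨1, one_pos, fun t ht => absurd (show t ∈ {t : UnitAddCircle | r ≤ ‖t‖} from ht) (h ▸ notMem_empty t)⟩
    · obtain ⟨t, ht, hm⟩ := hcl.exists_isMinOn h hf.continuousOn
      refine ⟨_, norm_pos_iff.2 fun h0 => ?_, fun t' ht' => hm ht'⟩
      have h1 : AddCircle.toCircle t = AddCircle.toCircle (0 : UnitAddCircle) := by
        rw [AddCircle.toCircle_zero]
        rw [sub_eq_zero, fourier_one] at h0
        exact Subtype.ext h0.symm
      have : t = 0 := AddCircle.injective_toCircle one_ne_zero h1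
      subst this
      simp only [mem_ofPred_eq, norm_zero] at ht
      linarith
  obtain ⟨η, hη, hη'⟩ := hη
  obtain ⟨R, hR⟩ := exists_nat_gt (4 / η)
  have hR0 : (0 : ℝ) < R := lt_trans (by positivity) hR
  refine ⟨R, by exact_mod_cast hR0, fun ν _ δ j h => ?_⟩
  set B := {θ : Tor | r ≤ ‖θ j‖}
  have mB : MeasurableSet B := measurableSet_le (by fun_prop) (by fun_prop)
  have hpt : ∀ θ : Tor, ∑ a ∈ Finset.range R, (ee (Pi.single j (a : ℤ)) θ).re ≤ R - B.indicator (fun _ => (R : ℝ) / 2) θ := by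
    intro θ
    have h1 : ∑ a ∈ Finset.range R, (ee (Pi.single j (a : ℤ)) θ).re ≤ R := by
      calc _ ≤ ∑ a ∈ Finset.range R, (1 : ℝ) := Finset.sum_le_sum fun a _ => (Complex.re_le_norm _).trans (norm_ee _ _).le
        _ = R := by simp
    by_cases hθ : θ ∈ B
    · rw [indicator_of_mem hθ, ← Complex.re_sum]
      refine (Complex.re_le_norm _).trans ?_
      simp only [ee_single]
      set z : ℂ := fourier 1 (θ j)
      have hz : ‖z‖ = 1 := by simp [z, Circle.norm_coe]
      have hg := geom_sum_mul_neg z R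
      have hn : ‖∑ a ∈ Finset.range R, z ^ a‖ * ‖1 - z‖ ≤ 2 := by
        rw [← norm_mul, hg]
        refine (norm_sub_le _ _).trans ?_
        rw [norm_pow, hz]; norm_num
      have hz2 := hη' (θ j) hθ
      have hR2 : 4 < R * η := (div_lt_iff₀ hη).1 hR
      by_contra hcon
      push Not at hcon
      nlinarith [norm_nonneg (1 - z)]
    · rw [indicator_of_notMem hθ]; simpa using h1
  have hint : ∀ a : ℕ, ∫ θ, (ee (Pi.single j (a : ℤ)) θ).re ∂ν = (∫ θ, ee (Pi.single j (a : ℤ)) θ ∂ν).re := fun a =>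
    integral_re (integrable_cont (ee _).continuous)
  have I1 : ∫ θ, ∑ a ∈ Finset.range R, (ee (Pi.single j (a : ℤ)) θ).re ∂ν ≤
      ∫ θ, ((fun _ => (R : ℝ)) - B.indicator (fun _ => (R : ℝ) / 2) : Tor → ℝ) θ ∂ν := integral_mono
    (integrable_finsetSum _ fun a _ => integrable_cont (Complex.continuous_re.comp (ee (Pi.single j (a : ℤ))).continuous))
    ((integrable_const (R : ℝ)).sub ((integrable_const ((R : ℝ) / 2)).indicator mB)) hpt
  rw [integral_finsetSum (Finset.range R) (f := fun a θ => (ee (Pi.single j (a : ℤ)) θ).re)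
    fun a _ => integrable_cont (Complex.continuous_re.comp (ee (Pi.single j (a : ℤ))).continuous),
    integral_sub' (integrable_const _) ((integrable_const _).indicator mB), integral_indicator_const _ mB] at I1
  have I2 : ∑ a ∈ Finset.range R, (1 - δ) ≤ ∑ a ∈ Finset.range R, ∫ θ, (ee (Pi.single j (a : ℤ)) θ).re ∂ν :=
    Finset.sum_le_sum fun a ha => by rw [hint]; exact h a (Finset.mem_range.1 ha)
  simp only [Finset.sum_const, Finset.card_range, nsmul_eq_mul, integral_const, probReal_univ, smul_eq_mul, one_mul] at I1 I2
  have I3 : (R : ℝ) * (1 - δ) ≤ R - ν.real B * (R / 2) := I2.trans I1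
  nlinarith

/-- main spectral conclusion -/
lemma spec_final {ν : Measure Tor} [IsProbabilityMeasure ν] (v : Z2) : 2 * ν.real {0} - 1 ≤ (∫ θ, ee v θ ∂ν).re := by
  have h : ∀ θ, (({0} : Set Tor).indicator (fun _ => (2 : ℝ)) θ) - 1 ≤ (ee v θ).re := by
    intro θ
    by_cases hθ : θ = 0
    · subst hθ; simp [ee, UnitAddTorus.mFourier]; norm_num
    · have := (abs_le.1 ((Complex.abs_re_le_norm (ee v θ)).trans (norm_ee v θ).le)).1
      simpa [hθ] using this
  have e : ∫ θ, (ee v θ).re ∂ν = (∫ θ, ee v θ ∂ν).re := integral_re (integrable_cont (ee v).continuous)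
  have I := integral_mono (μ := ν) (((integrable_const (2 : ℝ)).indicator (measurableSet_singleton 0)).sub (integrable_const 1))
    (integrable_cont (Complex.continuous_re.comp (ee v).continuous)) h
  rw [integral_sub' ((integrable_const (2 : ℝ)).indicator (measurableSet_singleton 0)) (integrable_const 1),
    integral_indicator_const _ (measurableSet_singleton 0)] at I
  simp only [integral_const, probReal_univ, smul_eq_mul, one_mul, Function.comp_apply] at I
  rw [e] at I
  linarith

end Thomas
end
end

section
open MeasureTheory Filter Topology Set
open scoped ENNReal NNReal

noncomputable section
namespace Thomas

lemma sh_flip {ν : Measure Tor} {N : ℤ} {c : ℝ} {j k : Fin 2} (hjk : j ≠ k)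
    (hc : ∀ E, MeasurableSet E → |ν.real E - ν.real (sh (-N) j k ⁻¹' E)| ≤ c) (E) (hE : MeasurableSet E) :
    |ν.real E - ν.real (sh N j k ⁻¹' E)| ≤ c := by
  have := hc (sh N j k ⁻¹' E) ((continuous_sh _ _ _).measurable hE)
  have e : sh (-N) j k ⁻¹' (sh N j k ⁻¹' E) = E := by
    ext θ
    simp [sh_sh hjk θ]
  rw [e] at this
  rwa [abs_sub_comm]

lemma ee_sh {N : ℤ} {j k : Fin 2} (hjk : j ≠ k) (v : Z2) (θ : Tor) :
    ee v (sh (-N) k j θ) = ee (v - Pi.single j (N * v k)) θ := by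
  have h : ∀ (w : Z2) (x : Tor), ee w x = AddCircle.toCircle (w j • x j + w k • x k) := by
    intro w x
    rw [AddCircle.toCircle_add]
    simp only [ee, UnitAddTorus.mFourier, ContinuousMap.coe_mk, Fin.prod_univ_two, fourier_apply, Circle.coe_mul]
    fin_cases j <;> fin_cases k <;> simp_all [mul_comm]
  rw [h, h, sh_j, sh_k hjk.symm]
  congr 2
  simp only [Pi.sub_apply, Pi.single_eq_same, Pi.single_eq_of_ne hjk.symm, sub_zero]
  module

open Classical in
lemma setoid_pos {ι : Type*} (r : Setoid ι) (s : Finset ι) (c : ι → ℝ) :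
    0 ≤ ∑ i ∈ s, ∑ j ∈ s, c i * c j * (if r i j then 1 else 0) := by
  have h : ∑ i ∈ s, ∑ j ∈ s, c i * c j * (if r i j then (1 : ℝ) else 0) =
      ∑ q ∈ s.image (Quotient.mk r), (∑ i ∈ s, if Quotient.mk r i = q then c i else 0) ^ 2 := by
    simp only [sq, Finset.sum_mul_sum]
    rw [Finset.sum_comm (s := s.image (Quotient.mk r)) (t := s)]
    refine Finset.sum_congr rfl fun i hi => ?_
    rw [Finset.sum_comm (s := s.image (Quotient.mk r)) (t := s)]
    refine Finset.sum_congr rfl fun j hj => ?_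
    rw [Finset.sum_eq_single (Quotient.mk r i)]
    · by_cases h : r i j
      · have : Quotient.mk r j = Quotient.mk r i := Quotient.sound (r.symm h)
        simp [h, this]
      · have : ¬ Quotient.mk r j = Quotient.mk r i := fun h' => h (r.symm (Quotient.exact h'))
        simp [h, this]
    · intro q _ hq
      simp [hq.symm]
    · intro h
      exact absurd (Finset.mem_image_of_mem _ hi) h
  rw [h]
  exact Finset.sum_nonneg fun _ _ => sq_nonneg _

open Classical in
lemma pd_of_random {Ω ι : Type*} [MeasurableSpace Ω] (P : Measure Ω) [IsProbabilityMeasure P]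
    (r : Ω → Setoid ι) (hm : ∀ i j, MeasurableSet {ω | r ω i j}) (s : Finset ι) (c : ι → ℝ) :
    0 ≤ ∑ i ∈ s, ∑ j ∈ s, c i * c j * P.real {ω | r ω i j} := by
  have h : ∑ i ∈ s, ∑ j ∈ s, c i * c j * P.real {ω | r ω i j} =
      ∫ ω, ∑ i ∈ s, ∑ j ∈ s, c i * c j * (if r ω i j then 1 else 0) ∂P := by
    have hi : ∀ i j, Integrable (fun ω => c i * c j * (if r ω i j then (1 : ℝ) else 0)) P := fun i j =>
      (((integrable_const (1 : ℝ)).indicator (hm i j)).congr (.of_forall fun ω => by simp [indicator])).const_mul _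
    rw [integral_finsetSum _ fun i _ => integrable_finsetSum _ fun j _ => hi i j]
    refine Finset.sum_congr rfl fun i _ => ?_
    rw [integral_finsetSum _ fun j _ => hi i j]
    refine Finset.sum_congr rfl fun j _ => ?_
    rw [integral_const_mul, ← integral_indicator_one (hm i j)]
    congr 2
  rw [h]
  exact integral_nonneg fun ω => setoid_pos (r ω) s c

theorem relT (ε : ℝ) (hε : 0 < ε) : ∃ δ > 0, ∀ N : ℤ, 3 ≤ N → ∃ R : ℕ, ∀ {Ω G : Type} [MeasurableSpace Ω]
    (P : Measure Ω) [IsProbabilityMeasure P] [Group G] [MulAction G Ω] (_ : ∀ g : G, Measurable fun ω : Ω => g • ω)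
    (S : G → Set Ω) (_ : ∀ g, MeasurableSet (S g)) (_ : S 1 = univ)
    (_ : ∀ g k ω, ω ∈ S g → g • ω ∈ S k → ω ∈ S (k * g)) (_ : ∀ g ω, ω ∈ S g → g • ω ∈ S g⁻¹)
    (u : Z2 → G) (_ : ∀ a b, u a * u b = u (a + b)) (h : Fin 2 → G)
    (_ : ∀ j k, j ≠ k → ∀ v, h j * u v = u (v + Pi.single j (N * v k)) * h j)
    (_ : ∀ v, MeasurePreserving (fun ω => u v • ω) P P) (_ : ∀ j, MeasurePreserving (fun ω => h j • ω) P P)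
    (_ : ∀ j, ∀ a : ℕ, a < R → 1 - δ ≤ P.real (S (u (Pi.single j (a : ℤ)))))
    (_ : ∀ j, 1 - δ ≤ P.real (S (h j))), ∀ v, 1 - ε ≤ P.real (S (u v)) := by
  set s := min 1 (ε / 48) with hs
  have s0 : 0 < s := lt_min one_pos (by positivity)
  have s1 : s ≤ 1 := min_le_left _ _
  have s2 : 48 * s ≤ ε := by linarith [min_le_right 1 (ε / 48)]
  refine ⟨s ^ 2, by positivity, fun N hN => ?_⟩
  have hN0 : (0 : ℝ) < N + 1 := by exact_mod_cast (by omega : 0 < N + 1)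
  obtain ⟨R, hR, hconc⟩ := conc (r := 1 / (4 * (N + 1))) (by positivity)
  refine ⟨R, ?_⟩
  intro Ω G _ P _ _ _ hms S hmS S1 Smul Sinv u hu h hh mp mph hδ hδ' v
  have u0 : u 0 = 1 := by have := hu 0 0; rw [add_zero] at this; exact mul_eq_left.1 this
  have uneg : ∀ a, u (-a) = (u a)⁻¹ := fun a => eq_inv_of_mul_eq_one_left (by rw [hu, neg_add_cancel, u0])
  have usub : ∀ a b, (u b)⁻¹ * u a = u (a - b) := fun a b => by rw [← uneg, hu]; congr 1; abel
  have Sinv' : ∀ g, (fun ω : Ω => g • ω) ⁻¹' S g⁻¹ = S g := by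
    intro g; ext ω
    refine ⟨fun hω => ?_, fun hω => Sinv g ω hω⟩
    have := Sinv _ _ (show g • ω ∈ S g⁻¹ from hω)
    rwa [inv_smul_smul, inv_inv] at this
  have mpi : ∀ {g : G}, MeasurePreserving (fun ω : Ω => g • ω) P P → MeasurePreserving (fun ω : Ω => g⁻¹ • ω) P P := by
    intro g hg
    refine ⟨hms _, ?_⟩
    conv_lhs => rw [← hg.map_eq]
    rw [Measure.map_map (hms _) (hms _)]
    convert Measure.map_id
    ext ω; simp
  have pinv : ∀ g : G, MeasurePreserving (fun ω : Ω => g • ω) P P → P.real (S g⁻¹) = P.real (S g) := by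
    intro g hg
    rw [← Sinv' g, measureReal_def, measureReal_def, hg.measure_preimage (hmS _).nullMeasurableSet]
  set Φ : Z2 → ℝ := fun v => P.real (S (u v)) with hΦ
  -- random equivalence relations
  let idx : Fin 2 → Z2 × Bool → G := fun j p => if p.2 then u p.1 * h j else u p.1
  let rr : Fin 2 → Ω → Setoid (Z2 × Bool) := fun j ω =>
    { r := fun p q => (idx j p)⁻¹ • ω ∈ S ((idx j q)⁻¹ * idx j p)
      iseqv := ⟨fun p => by simp [S1], fun {p q} hpq => by
          have := Sinv _ _ hpq
          rw [smul_smul, mul_inv_cancel_right] at this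
          simpa using this, fun {p q t} h1 h2 => by
          have := Smul _ ((idx j t)⁻¹ * idx j q) _ h1 (by rwa [smul_smul, mul_inv_cancel_right])
          convert this using 2; group⟩ }
  have hrm : ∀ j p q, MeasurableSet {ω | rr j ω p q} := fun j p q => hms _ (hmS _)
  have pre : ∀ (g k : G), MeasurePreserving (fun ω : Ω => g • ω) P P → P.real {ω | g⁻¹ • ω ∈ S k} = P.real (S k) := by
    intro g k hg
    rw [measureReal_def, measureReal_def, ← (mpi hg).measure_preimage (hmS k).nullMeasurableSet]; rfl
  have sig : ∀ j k, j ≠ k → ∀ v, (h j)⁻¹ * u v * h j = u (v - Pi.single j (N * v k)) := by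
    intro j k hjk v
    have := hh j k hjk (v - Pi.single j (N * v k))
    rw [mul_assoc, inv_mul_eq_iff_eq_mul, this]
    congr 2
    simp [Pi.single_eq_of_ne hjk.symm]
  have jp : ∀ j k, j ≠ k → JPD Φ (fun v => Φ (v - Pi.single j (N * v k)))
      (fun a b => P.real {ω | rr j ω (a, false) (b, true)}) := by
    intro j k hjk t c d
    have := pd_of_random P (rr j) (hrm j) (t ×ˢ Finset.univ) (fun p => if p.2 then d p.1 else c p.1)
    simp only [Finset.sum_product, Fintype.univ_bool, Finset.sum_insert, Finset.mem_singleton, Bool.true_eq_false, not_false_eq_true,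
      Finset.sum_singleton, if_true, Bool.false_eq_true, if_false, Finset.sum_add_distrib] at this
    have k00 : ∀ a b, P.real {ω | rr j ω (a, false) (b, false)} = Φ (a - b) := by
      intro a b
      have := pre (u a) ((u b)⁻¹ * u a) (mp a)
      rw [usub] at this
      show _ = P.real (S (u (a - b)))
      rw [← this, ← usub]; rfl
    have k11 : ∀ a b, P.real {ω | rr j ω (a, true) (b, true)} = Φ (a - b - Pi.single j (N * (a - b) k)) := by
      intro a b
      have := pre (u a * h j) ((u b * h j)⁻¹ * (u a * h j)) (by
        have := (mp a).comp (mph j)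
        simpa [Function.comp_def, mul_smul] using this)
      have e : (u b * h j)⁻¹ * (u a * h j) = u (a - b - Pi.single j (N * (a - b) k)) := by
        rw [← sig j k hjk, ← usub]; group
      show _ = P.real (S (u (a - b - Pi.single j (N * (a - b) k))))
      rw [← e, ← this]; rfl
    have k10 : ∀ a b, P.real {ω | rr j ω (a, true) (b, false)} = P.real {ω | rr j ω (b, false) (a, true)} := by
      intro a b; congr 1; ext ω; exact ⟨(rr j ω).symm, (rr j ω).symm⟩
    simp only [k00, k11, k10] at this
    simp only [Finset.sum_add_distrib, ← Finset.mul_sum]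
    have sw : ∑ a ∈ t, ∑ b ∈ t, d a * c b * P.real {ω | rr j ω (b, false) (a, true)} =
        ∑ a ∈ t, ∑ b ∈ t, c a * d b * P.real {ω | rr j ω (a, false) (b, true)} := by
      rw [Finset.sum_comm]
      exact Finset.sum_congr rfl fun a _ => Finset.sum_congr rfl fun b _ => by ring
    rw [sw] at this
    linarith
  have φ1 : Φ 0 = 1 := by simp [hΦ, u0, S1]
  have φs : ∀ v, Φ (-v) = Φ v := fun v => by simp only [hΦ, uneg]; exact pinv _ (mp v)
  have pdΦ : PD Φ := ⟨φ1, φs, fun t c => by simpa using jp 0 1 (by decide) t c 0⟩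
  have pdΨ : ∀ j k, j ≠ k → PD (fun v => Φ (v - Pi.single j (N * v k))) := fun j k hjk =>
    ⟨by simpa using φ1, fun v => by
      rw [← φs]; congr 1
      simp only [Pi.neg_apply, mul_neg, Pi.single_neg]; abel, fun t c => by simpa using jp j k hjk t 0 c⟩
  obtain ⟨ν, hν, -⟩ := bochner pdΦ
  have tv : ∀ j k : Fin 2, j ≠ k → ∀ E, MeasurableSet E → |(ν : Measure Tor).real E - (ν : Measure Tor).real (sh N j k ⁻¹' E)| ≤ 3 * s := by
    intro j k hjk
    refine sh_flip hjk fun E hE => ?_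
    refine spectral_tv pdΦ ν hν (continuous_sh (-N) j k) (fun v θ => ee_sh hjk.symm v θ) (pdΨ k j hjk.symm) (jp k j hjk.symm) s0 (fun a => ?_) hE
    refine (hδ' k).trans_eq ?_
    rw [← pinv _ (mph k), ← pre (u a) _ (mp a)]
    have : (u a * h k)⁻¹ * u a = (h k)⁻¹ := by group
    rw [← this]; rfl
  have bad : ∀ j, (ν : Measure Tor).real {θ | 1 / (4 * (N + 1)) ≤ ‖θ j‖} ≤ 2 * s ^ 2 := fun j =>
    hconc ν (s ^ 2) j fun a ha => by rw [hν]; simpa using hδ j a ha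
  have fin := pp hN (c := 3 * s) (r := 1 / (4 * (N + 1))) (by rw [one_div, inv_mul_eq_div, div_le_iff₀ (by positivity)]; linarith) tv bad
  have := spec_final (ν := (ν : Measure Tor)) v
  rw [hν, Complex.ofReal_re] at this
  show 1 - ε ≤ Φ v
  nlinarith

end Thomas
end
end

section
open MeasureTheory Filter Topology Set
open scoped ENNReal NNReal

noncomputable section
namespace Thomas

/-- Lie-theoretic core: all root elements lie in `A`. -/
lemma lie_core {K E : Type*} [Field K] [CharZero K] [LieRing E] [LieAlgebra K E] [FiniteDimensional K E] {m : ℕ} (hm : 3 ≤ m)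
    (hdim : Module.finrank K E < m * (m - 1)) (A : Submodule K E) (x : Fin m → Fin m → E) (q : K) (hq : q ≠ 0)
    (hN : ∀ i j, i ≠ j → ∀ a ∈ A, ⁅x i j, a⁆ ∈ A)
    (h1 : ∀ i j l, i ≠ j → j ≠ l → i ≠ l → ⁅x i j, x j l⁆ - q • x i l ∈ A)
    (h0 : ∀ i j k l, i ≠ j → k ≠ l → j ≠ k → i ≠ l → ⁅x i j, x k l⁆ ∈ A) :
    ∀ i j, i ≠ j → x i j ∈ A := by
  have h1' : ∀ i j l, i ≠ j → j ≠ l → i ≠ l → ⁅x j l, x i j⁆ + q • x i l ∈ A := by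
    intro i j l a b c
    have := A.neg_mem (h1 i j l a b c)
    rwa [neg_sub, ← lie_skew, sub_neg_eq_add, add_comm] at this
  have third : ∀ i j : Fin m, ∃ l, l ≠ i ∧ l ≠ j := by
    intro i j
    by_contra! h
    have : (Finset.univ : Finset (Fin m)) ⊆ {i, j} := fun l _ => by
      by_cases hl : l = i
      · simp [hl]
      · simp [h l hl]
    have := (Finset.card_le_card this).trans Finset.card_le_two
    simp at this; omega
  have hs : ∀ {y : E} {c : K}, c ≠ 0 → c • y ∈ A → y ∈ A := fun hc h => (A.smul_mem_iff hc).1 h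
  -- (ad x_ka)^2 kills everything but x_ak
  have dkill : ∀ k a i j, k ≠ a → i ≠ j → (i, j) ≠ (a, k) → ⁅x k a, ⁅x k a, x i j⁆⁆ ∈ A := by
    intro k a i j hka hij hne
    by_cases hai : a = i
    · subst hai
      have hjk : k ≠ j := fun h => hne (by rw [h])
      have e := hN k a hka _ (h1 k a j hka hij hjk)
      rw [lie_sub, lie_smul] at e
      have f := h0 k a k j hka hjk hka.symm hjk
      simpa using A.add_mem e (A.smul_mem q f)
    · by_cases hjk : j = k
      · subst hjk
        have e := hN j a hka _ (h1' i j a hij hka (fun h => hai h.symm))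
        rw [lie_add, lie_smul] at e
        have f := h0 j a i a hka (fun h => hai h.symm) hai hka
        simpa using A.sub_mem e (A.smul_mem q f)
      · exact hN k a hka _ (h0 k a i j hka hij hai (fun h => hjk h.symm))
  have dmain : ∀ k a, k ≠ a → ⁅x k a, ⁅x k a, x a k⁆⁆ + (2 * q ^ 2) • x k a ∈ A := by
    intro k a hka
    obtain ⟨l, hlk, hla⟩ := third k a
    set D := x k a with hD
    have hDA : ∀ b ∈ A, ⁅D, b⁆ ∈ A := hN k a hka
    -- all computations modulo A
    have e1 : ⁅D, ⁅D, ⁅x a l, x l k⁆⁆⁆ - q • ⁅D, ⁅D, x a k⁆⁆ ∈ A := by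
      have := hDA _ (hDA _ (h1 a l k hla.symm hlk hka.symm))
      simpa only [lie_sub, lie_smul] using this
    have L : ⁅D, ⁅D, ⁅x a l, x l k⁆⁆⁆ = ⁅⁅D, ⁅D, x a l⁆⁆, x l k⁆ + (2 : K) • ⁅⁅D, x a l⁆, ⁅D, x l k⁆⁆ + ⁅x a l, ⁅D, ⁅D, x l k⁆⁆⁆ := by
      rw [two_smul, leibniz_lie D (x a l), lie_add, leibniz_lie D ⁅D, x a l⁆, leibniz_lie D (x a l)]; abel
    have t1 : ⁅⁅D, ⁅D, x a l⁆⁆, x l k⁆ ∈ A := by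
      rw [← lie_skew]
      exact A.neg_mem (hN _ _ hlk _ (dkill k a a l hka hla.symm (by simp [hlk])))
    have t2 : ⁅x a l, ⁅D, ⁅D, x l k⁆⁆⁆ ∈ A := hN _ _ hla.symm _ (dkill k a l k hka hlk (by simp [hla]))
    have u1 := h1 k a l hka hla.symm hlk.symm
    have u2 := h1' l k a hlk hka hla
    have t3 : ⁅⁅D, x a l⁆, ⁅D, x l k⁆⁆ + q ^ 3 • x k a ∈ A := by
      have v1 : ⁅⁅D, x a l⁆ - q • x k l, ⁅D, x l k⁆⁆ ∈ A := by
        have : ⁅⁅D, x a l⁆ - q • x k l, ⁅D, x l k⁆⁆ =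
          ⁅D, ⁅⁅D, x a l⁆ - q • x k l, x l k⁆⁆ - ⁅⁅D, ⁅D, x a l⁆ - q • x k l⁆, x l k⁆ := by
            simp only [leibniz_lie D]; abel
        rw [this]
        refine A.sub_mem (hDA _ ?_) ?_
        · rw [← lie_skew]; exact A.neg_mem (hN _ _ hlk _ u1)
        · rw [← lie_skew]; exact A.neg_mem (hN _ _ hlk _ (hDA _ u1))
      have v2 := A.smul_mem q (hN k l hlk.symm _ u2)
      have v3 := A.smul_mem (q ^ 2) (h1 k l a hlk.symm hla hka)
      have := A.sub_mem (A.add_mem v1 v2) v3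
      convert this using 1
      simp only [sub_lie, smul_lie, lie_add, lie_smul, smul_add, smul_sub, smul_smul]
      rw [show q * q = q ^ 2 by ring, show q ^ 2 * q = q ^ 3 by ring]
      abel
    refine hs hq ?_
    have := A.sub_mem (A.add_mem (A.add_mem t1 (A.smul_mem (2 : K) t3)) t2) e1
    rw [L] at this
    convert this using 1
    simp only [smul_add, smul_smul]
    rw [show q * (2 * q ^ 2) = 2 * q ^ 3 by ring]
    abel
  -- one implies all
  have opp : ∀ k a, k ≠ a → x k a ∈ A → x a k ∈ A := by
    intro k a hka h
    have e := dmain a k hka.symm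
    have f := hN a k hka.symm _ (hN a k hka.symm _ h)
    have := A.sub_mem e f
    rw [add_sub_cancel_left] at this
    exact hs (by simp [hq]) this
  have row : ∀ k a, k ≠ a → x k a ∈ A → ∀ j, k ≠ j → x k j ∈ A := by
    intro k a hka h j hkj
    by_cases haj : a = j
    · rwa [← haj]
    have e := h1 k a j hka haj hkj
    have f : ⁅x k a, x a j⁆ ∈ A := by
      rw [← lie_skew]; exact A.neg_mem (hN _ _ haj _ h)
    have := A.sub_mem f e
    rw [sub_sub_cancel] at this
    exact hs hq this
  have all : ∀ k a, k ≠ a → x k a ∈ A → ∀ i j, i ≠ j → x i j ∈ A := by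
    intro k a hka h i j hij
    by_cases hik : i = k
    · subst hik; exact row _ _ hka h j hij
    · exact row i k hik (opp k i (Ne.symm hik) (row k a hka h i (Ne.symm hik))) j hij
  -- dimension count
  let ι := {p : Fin m × Fin m // p.1 ≠ p.2}
  have hcard : Fintype.card ι = m * (m - 1) := by
    have h2 : Fintype.card {p : Fin m × Fin m // p.1 = p.2} = m := by
      rw [Fintype.card_congr (β := Fin m) ⟨fun p => p.1.1, fun i => ⟨(i, i), rfl⟩, fun ⟨⟨a, b⟩, h⟩ => by
        simp at h; simp [h], fun _ => rfl⟩]; simp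
    have := Fintype.card_subtype_compl (fun p : Fin m × Fin m => p.1 = p.2)
    rw [h2] at this
    simp only [Fintype.card_prod, Fintype.card_fin] at this
    rw [Nat.mul_sub, mul_one, ← this]
  have hdep : ¬ LinearIndependent K (fun p : ι => x p.1.1 p.1.2) := by
    intro h
    have := h.fintype_card_le_finrank
    omega
  rw [Fintype.not_linearIndependent_iff] at hdep
  obtain ⟨c, hc, ⟨⟨⟨a, k⟩, hak⟩, hne⟩⟩ := hdep
  have hka : k ≠ a := fun h => hak h.symm
  refine all k a hka ?_
  have z : ∑ p : ι, c p • ⁅x k a, ⁅x k a, x p.1.1 p.1.2⁆⁆ = 0 := by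
    have := congrArg (fun y => ⁅x k a, ⁅x k a, y⁆⁆) hc
    simpa [lie_sum] using this
  rw [← Finset.add_sum_erase _ _ (Finset.mem_univ (⟨(a, k), hak⟩ : ι))] at z
  have r : ∑ p ∈ Finset.univ.erase (⟨(a, k), hak⟩ : ι), c p • ⁅x k a, ⁅x k a, x p.1.1 p.1.2⁆⁆ ∈ A :=
    A.sum_mem fun p hp => A.smul_mem _ (dkill k a _ _ hka p.2 fun h => (Finset.ne_of_mem_erase hp) (Subtype.ext h))
  have r2 := A.sub_mem (A.zero_mem) r
  rw [← z, add_sub_cancel_right] at r2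
  have r3 := A.sub_mem (dmain k a hka) (hs hne r2)
  rw [add_sub_cancel_left] at r3
  exact hs (by simp [hq]) r3

end Thomas
end
end

section
open MeasureTheory Filter Topology Set
open scoped ENNReal NNReal

noncomputable section
namespace Thomas

section plog
variable {p : ℕ} [hp : Fact p.Prime] {E : Type*} [NormedRing E] [NormedAlgebra ℚ_[p] E]

lemma exp_rad : 0 < (NormedSpace.expSeries ℚ_[p] E).radius := by
  have hp0 : (0 : ℝ) < p := by exact_mod_cast hp.1.pos
  have h := (NormedSpace.expSeries ℚ_[p] E).le_radius_of_bound (r := (p : ℝ≥0)⁻¹) (max 1 ‖(1 : E)‖) fun n => by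
    have h1 : ‖((n.factorial : ℚ_[p]))⁻¹‖ ≤ (p : ℝ) ^ n := by
      rw [norm_inv, ← Rat.cast_natCast, Padic.eq_padicNorm, padicNorm.eq_zpow_of_nonzero (by exact_mod_cast n.factorial_ne_zero)]
      · simp only [padicValRat.of_nat, zpow_neg, zpow_natCast, Rat.cast_inv, Rat.cast_pow, Rat.cast_natCast, inv_inv]
        refine pow_le_pow_right₀ (by exact_mod_cast hp.1.one_le) ?_
        have := sub_one_mul_padicValNat_factorial (p := p) n
        have h2 : 1 ≤ p - 1 := by have := hp.1.two_le; omega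
        nlinarith [Nat.sub_le n (p.digits n).sum, Nat.zero_le (padicValNat p n.factorial)]
    have h2 : ‖NormedSpace.expSeries ℚ_[p] E n‖ ≤ (p : ℝ) ^ n * max 1 ‖(1 : E)‖ := by
      refine (ContinuousMultilinearMap.opNorm_smul_le _ _).trans ?_
      exact mul_le_mul h1 ContinuousMultilinearMap.norm_mkPiAlgebraFin_le (ContinuousMultilinearMap.opNorm_nonneg _) (by positivity)
    calc _ ≤ ((p : ℝ) ^ n * max 1 ‖(1 : E)‖) * ((p : ℝ)⁻¹) ^ n := by
            push_cast; gcongr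
      _ = max 1 ‖(1 : E)‖ := by rw [inv_pow]; field_simp
  refine lt_of_lt_of_le ?_ h
  simp

/-- `x` is a logarithm of `L`. -/
def PLog (p : ℕ) [Fact p.Prime] {E : Type*} [NormedRing E] [NormedAlgebra ℚ_[p] E] (L x : E) : Prop :=
  Tendsto (fun j : ℕ => ((p : ℚ_[p]) ^ j)⁻¹ • (L ^ (p ^ j) - 1)) atTop (𝓝 x) ∧
    ∀ A : Subalgebra ℚ_[p] E, x ∈ A → L ∈ A

lemma p_tendsto : Tendsto (fun j : ℕ => (p : ℚ_[p]) ^ j) atTop (𝓝 0) :=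
  tendsto_pow_atTop_nhds_zero_of_norm_lt_one Padic.norm_p_lt_one

lemma PLog.tendsto_one {L x : E} (h : PLog p L x) : Tendsto (fun j : ℕ => L ^ (p ^ j)) atTop (𝓝 1) := by
  have := ((p_tendsto (p := p)).smul h.1).add_const 1
  rw [zero_smul, zero_add] at this
  refine this.congr fun j => ?_
  have : (p : ℚ_[p]) ^ j ≠ 0 := pow_ne_zero _ (by exact_mod_cast hp.1.ne_zero)
  rw [smul_smul, mul_inv_cancel₀ this, one_smul, sub_add_cancel]

lemma PLog.pow_tendsto {L x : E} (h : PLog p L x) (k : ℕ) :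
    Tendsto (fun j : ℕ => ((p : ℚ_[p]) ^ j)⁻¹ • (L ^ (k * p ^ j) - 1)) atTop (𝓝 ((k : ℚ_[p]) • x)) := by
  have h2 : Tendsto (fun j : ℕ => ∑ i ∈ Finset.range k, (L ^ (p ^ j)) ^ i) atTop (𝓝 (∑ i ∈ Finset.range k, 1 ^ i)) :=
    tendsto_finsetSum _ fun i _ => h.tendsto_one.pow i
  have := h2.mul h.1
  simp only [one_pow, Finset.sum_const, Finset.card_range, nsmul_eq_mul, mul_one] at this
  rw [Nat.cast_smul_eq_nsmul, nsmul_eq_mul]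
  refine this.congr fun j => ?_
  rw [mul_smul_comm, geom_sum_mul, ← pow_mul, mul_comm]

lemma PLog.pow {L x : E} (h : PLog p L x) {k : ℕ} (hk : k ≠ 0) : PLog p (L ^ k) ((k : ℚ_[p]) • x) := by
  refine ⟨by simpa only [← pow_mul] using h.pow_tendsto k, fun A hA => A.pow_mem (h.2 A ?_) k⟩
  have := A.smul_mem hA (k : ℚ_[p])⁻¹
  rwa [smul_smul, inv_mul_cancel₀ (by exact_mod_cast hk), one_smul] at this

lemma plog_nhds [FiniteDimensional ℚ_[p] E] : ∀ᶠ L in 𝓝 (1 : E), ∃ x, PLog p L x := by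
  have : CompleteSpace E := FiniteDimensional.complete ℚ_[p] E
  have r0 := exp_rad (p := p) (E := E)
  have hd := hasStrictFDerivAt_exp_zero_of_radius_pos r0
  have hmap := hd.map_nhds_eq_of_surj (by ext x; exact ⟨fun _ => trivial, fun _ => ⟨x, rfl⟩⟩)
  rw [NormedSpace.exp_zero] at hmap
  rw [← hmap, eventually_map]
  filter_upwards [Metric.eball_mem_nhds (0 : E) r0] with x hx
  have hball : ∀ n : ℕ, (n : ℚ_[p]) • x ∈ Metric.eball (0 : E) (NormedSpace.expSeries ℚ_[p] E).radius := fun n => by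
    rw [mem_eball_zero_iff] at hx ⊢
    refine lt_of_le_of_lt ?_ hx
    rw [enorm_smul]
    refine mul_le_of_le_one_left' ?_
    rw [← ofReal_norm, ENNReal.ofReal_le_one]
    exact_mod_cast Padic.norm_int_le_one (p := p) n
  have hpow : ∀ n : ℕ, NormedSpace.exp ((n : ℚ_[p]) • x) = NormedSpace.exp x ^ n := by
    intro n
    induction n with
    | zero => simp
    | succ n ih =>
      rw [pow_succ, ← ih, Nat.cast_succ, add_smul, one_smul]
      exact NormedSpace.exp_add_of_commute_of_mem_ball ((Commute.refl x).smul_left _) (hball n) hx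
  refine ⟨x, ?_, fun A hA => ?_⟩
  · have hl : HasDerivAt (fun t : ℚ_[p] => NormedSpace.exp (t • x)) x 0 := by
      have e : HasDerivAt (fun t : ℚ_[p] => t • x) x 0 := by simpa using (hasDerivAt_id (0 : ℚ_[p])).smul_const x
      have := HasFDerivAt.comp_hasDerivAt (f := fun t : ℚ_[p] => t • x) (0 : ℚ_[p]) (by simpa using hd.hasFDerivAt) e
      exact this
    have := hl.tendsto_slope.comp (tendsto_nhdsWithin_iff.2 ⟨p_tendsto (p := p), .of_forall fun j => pow_ne_zero j (by exact_mod_cast hp.1.ne_zero : (p : ℚ_[p]) ≠ 0)⟩)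
    refine this.congr fun j => ?_
    have := hpow (p ^ j)
    push_cast at this
    simp [slope_def_module, this]
  · have hs := NormedSpace.expSeries_hasSum_exp_of_mem_ball' (𝕂 := ℚ_[p]) x hx
    have hc : IsClosed (A : Set E) := A.toSubmodule.closed_of_finiteDimensional
    exact hc.mem_of_tendsto hs (.of_forall fun s => A.sum_mem fun n _ => A.smul_mem (A.pow_mem hA n) _)

end plog
end Thomas
end
end

section
open MeasureTheory Filter Topology Set
open scoped ENNReal NNReal

noncomputable section
namespace Thomas

section plog2
variable {p : ℕ} [hp : Fact p.Prime] {E : Type*} [NormedRing E] [NormedAlgebra ℚ_[p] E] [FiniteDimensional ℚ_[p] E]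

attribute [local instance 100] LieRing.ofAssociativeRing

lemma inv_tendsto (p : ℕ) [Fact p.Prime] {E : Type*} [NormedRing E] [NormedAlgebra ℚ_[p] E] [FiniteDimensional ℚ_[p] E] {U : ℕ → Eˣ} (h : Tendsto (fun j => (U j : E)) atTop (𝓝 1)) :
    Tendsto (fun j => ((U j)⁻¹ : Eˣ).1) atTop (𝓝 1) := by
  have : CompleteSpace E := FiniteDimensional.complete ℚ_[p] E
  have := (NormedRing.inverse_continuousAt (1 : Eˣ)).tendsto.comp h
  simpa [Function.comp_def] using this

lemma limC {A : Subalgebra ℚ_[p] E} {U V W : ℕ → Eˣ} {c : ℕ → ℚ_[p]} {x y z : E}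
    (hU : Tendsto (fun j => (U j : E)) atTop (𝓝 1)) (hV : Tendsto (fun j => (V j : E)) atTop (𝓝 1))
    (hW : Tendsto (fun j => (W j : E)) atTop (𝓝 1))
    (hx : Tendsto (fun j => c j • ((U j : E) - 1)) atTop (𝓝 x)) (hy : Tendsto (fun j => c j • ((V j : E) - 1)) atTop (𝓝 y))
    (hz : Tendsto (fun j => (c j * c j) • ((W j : E) - 1)) atTop (𝓝 z))
    (hA : ∀ j, (((W j * V j * U j)⁻¹ * (U j * V j) : Eˣ) : E) ∈ A) : ⁅x, y⁆ - z ∈ A := by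
  have hc : IsClosed (A : Set E) := A.toSubmodule.closed_of_finiteDimensional
  have hi := inv_tendsto p (U := fun j => W j * V j * U j) (by simpa using (hW.mul hV).mul hU)
  have t := hi.mul (((hx.mul hy).sub (hy.mul hx)).sub (hz.mul (hV.mul hU)))
  simp only [mul_one, one_mul] at t
  refine hc.mem_of_tendsto t (.of_forall fun j => SetLike.mem_coe.2 ?_)
  have := A.smul_mem (A.sub_mem (hA j) A.one_mem) (c j * c j)
  convert this using 1
  have e : (((W j * V j * U j)⁻¹ * (U j * V j) : Eˣ) : E) - 1 =
      (((W j * V j * U j)⁻¹ : Eˣ) : E) * ((U j : E) * V j - W j * V j * U j) := by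
    rw [mul_sub, ← Units.val_mul, ← Units.val_mul, ← Units.val_mul, ← Units.val_mul, ← Units.val_mul, inv_mul_cancel, Units.val_one]
  rw [e, ← mul_smul_comm]
  congr 1
  simp only [smul_mul_assoc, mul_smul_comm, smul_smul, ← smul_sub]
  congr 1
  noncomm_ring

lemma limN {A : Subalgebra ℚ_[p] E} {L : Eˣ} {x : E} (h : PLog p (L : E) x) (hA : ∀ a ∈ A, (L : E) * a * (L⁻¹ : Eˣ) ∈ A)
    (a : E) (ha : a ∈ A) : ⁅x, a⁆ ∈ A := by
  have hc : IsClosed (A : Set E) := A.toSubmodule.closed_of_finiteDimensional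
  have hk : ∀ k : ℕ, ((L ^ k : Eˣ) : E) * a * ((L ^ k)⁻¹ : Eˣ) ∈ A := by
    intro k
    induction k with
    | zero => simpa
    | succ k ih =>
      have := hA _ ih
      convert this using 1
      rw [pow_succ', mul_inv_rev]; push_cast; noncomm_ring
  have hi := inv_tendsto p (U := fun j => L ^ (p ^ j)) (by simpa using h.tendsto_one)
  have t := ((h.1.mul_const a).sub (h.1.const_mul a)).mul hi
  rw [mul_one] at t
  refine hc.mem_of_tendsto t (.of_forall fun j => SetLike.mem_coe.2 ?_)
  have := A.smul_mem (A.sub_mem (hk (p ^ j)) ha) ((p : ℚ_[p]) ^ j)⁻¹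
  convert this using 1
  have e : a = a * (L ^ (p ^ j) : Eˣ) * ((L ^ (p ^ j))⁻¹ : Eˣ) := (Units.mul_inv_cancel_right a _).symm
  conv_rhs => enter [2, 2]; rw [e]
  rw [smul_mul_assoc, mul_smul_comm, ← smul_sub, smul_mul_assoc, sub_mul]
  congr 1
  simp only [Units.val_pow_eq_pow_val, sub_mul, mul_sub, mul_one, one_mul, mul_assoc]
  have e1 : (L : E) ^ p ^ j * ((L ^ p ^ j)⁻¹ : Eˣ) = 1 := by rw [← Units.val_pow_eq_pow_val, Units.mul_inv]
  simp only [e1]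
  noncomm_ring

lemma alg_p {m : ℕ} (hm : 3 ≤ m) (hdim : Module.finrank ℚ_[p] E < m * (m - 1)) (A : Subalgebra ℚ_[p] E)
    (L : Fin m → Fin m → Eˣ) (x : Fin m → Fin m → E) (hx : ∀ i j, PLog p (L i j : E) (x i j)) (q : ℕ) (hq : 0 < q)
    (hnorm : ∀ i j, i ≠ j → ∀ a ∈ A, (L i j : E) * a * ((L i j)⁻¹ : Eˣ) ∈ A)
    (hcomm : ∀ i j l, i ≠ j → j ≠ l → i ≠ l → ∀ s : ℕ,
      (((L i l ^ (q * (s * s)) * L j l ^ s * L i j ^ s)⁻¹ * (L i j ^ s * L j l ^ s) : Eˣ) : E) ∈ A)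
    (hcomm0 : ∀ i j k l, i ≠ j → k ≠ l → j ≠ k → i ≠ l → ∀ s : ℕ,
      (((L k l ^ s * L i j ^ s)⁻¹ * (L i j ^ s * L k l ^ s) : Eˣ) : E) ∈ A) :
    ∀ i j, i ≠ j → (L i j : E) ∈ A := by
  intro i j hij
  refine (hx i j).2 A ?_
  have dbl : Tendsto (fun j : ℕ => j + j) atTop atTop := tendsto_atTop_mono (fun j => Nat.le_add_right j j) tendsto_id
  refine lie_core (K := ℚ_[p]) hm hdim (Subalgebra.toSubmodule A) x (q : ℚ_[p]) (by exact_mod_cast hq.ne') (fun i j hij => limN (hx i j) (hnorm i j hij)) ?_ ?_ i j hij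
  · intro i j l hij hjl hil
    have hz := ((hx i l).pow_tendsto q).comp dbl
    refine limC (U := fun k => L i j ^ p ^ k) (V := fun k => L j l ^ p ^ k) (W := fun k => L i l ^ (q * (p ^ k * p ^ k)))
      (c := fun k => ((p : ℚ_[p]) ^ k)⁻¹) (by simpa using (hx i j).tendsto_one) (by simpa using (hx j l).tendsto_one) ?_
      (by simpa using (hx i j).1) (by simpa using (hx j l).1) (by simpa [Function.comp_def, pow_add, mul_comm] using hz)
      (fun k => hcomm i j l hij hjl hil (p ^ k))
    have := ((hx i l).tendsto_one.comp dbl).pow q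
    simpa [Function.comp_def, pow_add, ← pow_mul, mul_comm] using this
  · intro i j k l hij hkl hjk hil
    have := limC (A := A) (U := fun t => L i j ^ p ^ t) (V := fun t => L k l ^ p ^ t) (W := fun t => 1) (z := 0)
      (c := fun k => ((p : ℚ_[p]) ^ k)⁻¹) (by simpa using (hx i j).tendsto_one) (by simpa using (hx k l).tendsto_one) (by simp)
      (by simpa using (hx i j).1) (by simpa using (hx k l).1) (by simp)
      (fun t => by simpa only [one_mul] using hcomm0 i j k l hij hkl hjk hil (p ^ t))
    simpa using this

end plog2
end Thomas
end
end

section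
open MeasureTheory Filter Topology Set
open scoped ENNReal NNReal

noncomputable section
namespace Thomas

section alg
variable {p : ℕ} [hp : Fact p.Prime] {n : ℕ}

attribute [local instance] Matrix.linftyOpNormedRing Matrix.linftyOpNormedAlgebra

lemma int_mul {a b : Matrix (Fin n) (Fin n) ℚ_[p]} (ha : ∀ i j, ‖a i j‖ ≤ 1) (hb : ∀ i j, ‖b i j‖ ≤ 1) (i j) : ‖(a * b) i j‖ ≤ 1 := by
  rw [Matrix.mul_apply]
  refine IsUltrametricDist.norm_sum_le_of_forall_le_of_nonneg zero_le_one fun k _ => ?_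
  rw [norm_mul]
  exact mul_le_one₀ (ha _ _) (norm_nonneg _) (hb _ _)

lemma int_one (i j : Fin n) : ‖(1 : Matrix (Fin n) (Fin n) ℚ_[p]) i j‖ ≤ 1 := by
  rw [Matrix.one_apply]; split <;> simp

lemma unit_return {u : (Matrix (Fin n) (Fin n) ℚ_[p])ˣ} (h : ∀ i j, ‖u.1 i j‖ ≤ 1) (h' : ∀ i j, ‖(u⁻¹).1 i j‖ ≤ 1)
    {V : Set (Matrix (Fin n) (Fin n) ℚ_[p])} (hV : V ∈ 𝓝 1) : ∃ T > 0, u.1 ^ T ∈ V := by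
  let K : Set (Matrix (Fin n) (Fin n) ℚ_[p]) := Set.pi univ fun _ => Set.pi univ fun _ => Metric.closedBall 0 1
  have hK : IsCompact K := isCompact_univ_pi fun _ => isCompact_univ_pi fun _ => isCompact_closedBall _ _
  have mK : ∀ a : Matrix (Fin n) (Fin n) ℚ_[p], (∀ i j, ‖a i j‖ ≤ 1) → a ∈ K := fun a ha i _ j _ => by simpa using ha i j
  have : FirstCountableTopology (Matrix (Fin n) (Fin n) ℚ_[p]) := inferInstanceAs (FirstCountableTopology (Fin n → Fin n → ℚ_[p]))
  have pw : ∀ a : Matrix (Fin n) (Fin n) ℚ_[p], (∀ i j, ‖a i j‖ ≤ 1) → ∀ k : ℕ, ∀ i j, ‖(a ^ k) i j‖ ≤ 1 := by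
    intro a ha k
    induction k with
    | zero => rw [pow_zero]; exact int_one
    | succ k ih => rw [pow_succ]; exact int_mul ih ha
  obtain ⟨⟨a, b⟩, -, φ, hφ, ht⟩ := (hK.prod hK).tendsto_subseq (x := fun k : ℕ => (u.1 ^ k, (u⁻¹).1 ^ k))
    fun k => ⟨mK _ (pw _ h k), mK _ (pw _ h' k)⟩
  rw [nhds_prod_eq, tendsto_prod_iff'] at ht
  obtain ⟨t1, t2⟩ := ht
  have e : a * b = 1 := by
    refine tendsto_nhds_unique (t1.mul t2) (tendsto_const_nhds.congr fun k => ?_)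
    simp [← Units.val_pow_eq_pow_val]
  have t3 := (t1.comp (tendsto_add_atTop_nat 1)).mul t2
  rw [e] at t3
  obtain ⟨k, hk⟩ : ∃ k, _ ∈ V := (t3.eventually_mem hV).exists
  have hlt : φ k < φ (k + 1) := hφ (Nat.lt_succ_self k)
  refine ⟨φ (k + 1) - φ k, by omega, ?_⟩
  convert hk using 1
  simp only [Function.comp_apply, ← Units.val_pow_eq_pow_val, ← Units.val_mul]
  congr 1
  rw [inv_pow, pow_sub _ hlt.le]

lemma descent (A : Submodule ℚ (Matrix (Fin n) (Fin n) ℚ)) (b : Matrix (Fin n) (Fin n) ℚ)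
    (h : b.map (Rat.cast : ℚ → ℚ_[p]) ∈ Submodule.span ℚ_[p] ((fun a : Matrix (Fin n) (Fin n) ℚ => a.map (Rat.cast : ℚ → ℚ_[p])) '' A)) :
    b ∈ A := by
  by_contra hb
  obtain ⟨f, hf, hA⟩ := Submodule.exists_dual_map_eq_bot_of_notMem hb inferInstance
  let g : Matrix (Fin n) (Fin n) ℚ_[p] →ₗ[ℚ_[p]] ℚ_[p] :=
    { toFun := fun a => ∑ i, ∑ j, ((f (Matrix.single i j 1) : ℚ) : ℚ_[p]) * a i j
      map_add' := fun a b => by simp [mul_add, Finset.sum_add_distrib]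
      map_smul' := fun c a => by simp [Finset.mul_sum, mul_left_comm] }
  have hg : ∀ a : Matrix (Fin n) (Fin n) ℚ, g (a.map (Rat.cast : ℚ → ℚ_[p])) = ((f a : ℚ) : ℚ_[p]) := by
    intro a
    conv_rhs => rw [Matrix.matrix_eq_sum_single a]
    simp only [map_sum, g, LinearMap.coe_mk, AddHom.coe_mk]
    push_cast
    refine Finset.sum_congr rfl fun i _ => Finset.sum_congr rfl fun j _ => ?_
    rw [show Matrix.single i j (a i j) = a i j • Matrix.single i j (1 : ℚ) by simp, map_smul, smul_eq_mul]
    push_cast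
    rw [mul_comm, Matrix.map_apply]
  have : ∀ c ∈ Submodule.span ℚ_[p] ((fun a : Matrix (Fin n) (Fin n) ℚ => a.map (Rat.cast : ℚ → ℚ_[p])) '' A), g c = 0 := by
    intro c hc
    refine Submodule.span_le (p := LinearMap.ker g).2 ?_ hc
    rintro _ ⟨a, ha, rfl⟩
    have : f a ∈ A.map f := ⟨a, ha, rfl⟩
    rw [hA, Submodule.mem_bot] at this
    simp [hg, this]
  have := this _ h
  rw [hg] at this
  exact hf (by exact_mod_cast this)

theorem alg {m : ℕ} (hnm : n < m) (hm : 3 ≤ m) (A : Subalgebra ℚ (Matrix (Fin n) (Fin n) ℚ))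
    (lam : Fin m → Fin m → (Matrix (Fin n) (Fin n) ℚ)ˣ) (q : ℕ) (hq : 0 < q)
    (hnorm : ∀ i j, i ≠ j → ∀ a ∈ A, (lam i j).1 * a * ((lam i j)⁻¹).1 ∈ A)
    (hcomm : ∀ i j l, i ≠ j → j ≠ l → i ≠ l → ∀ s : ℕ,
      ((lam i l ^ (q * (s * s)) * lam j l ^ s * lam i j ^ s)⁻¹ * (lam i j ^ s * lam j l ^ s)).1 ∈ A)
    (hcomm0 : ∀ i j k l, i ≠ j → k ≠ l → j ≠ k → i ≠ l → ∀ s : ℕ,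
      ((lam k l ^ s * lam i j ^ s)⁻¹ * (lam i j ^ s * lam k l ^ s)).1 ∈ A) :
    ∃ T : ℕ, 0 < T ∧ ∀ i j, i ≠ j → (lam i j ^ T).1 ∈ A := by
  obtain ⟨p, hple, hp⟩ := Nat.exists_infinite_primes
    ((∏ i, ∏ j, ∏ k, ∏ l, (((lam i j).1 k l).den * (((lam i j)⁻¹).1 k l).den)) + 1)
  have : Fact p.Prime := ⟨hp⟩
  have hden : ∀ i j k l, ¬ p ∣ ((lam i j).1 k l).den * (((lam i j)⁻¹).1 k l).den := by
    intro i j k l hd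
    have h1 : ((lam i j).1 k l).den * (((lam i j)⁻¹).1 k l).den ∣ ∏ i, ∏ j, ∏ k, ∏ l, (((lam i j).1 k l).den * (((lam i j)⁻¹).1 k l).den) :=
      (((Finset.dvd_prod_of_mem (fun l => (((lam i j).1 k l).den * (((lam i j)⁻¹).1 k l).den)) (Finset.mem_univ l)).trans
        (Finset.dvd_prod_of_mem (fun k => ∏ l, (((lam i j).1 k l).den * (((lam i j)⁻¹).1 k l).den)) (Finset.mem_univ k))).trans
        (Finset.dvd_prod_of_mem (fun j => ∏ k, ∏ l, (((lam i j).1 k l).den * (((lam i j)⁻¹).1 k l).den)) (Finset.mem_univ j))).trans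
        (Finset.dvd_prod_of_mem (fun i => ∏ j, ∏ k, ∏ l, (((lam i j).1 k l).den * (((lam i j)⁻¹).1 k l).den)) (Finset.mem_univ i))
    have := Nat.le_of_dvd (Finset.prod_pos fun _ _ => Finset.prod_pos fun _ _ => Finset.prod_pos fun _ _ => Finset.prod_pos fun _ _ =>
      Nat.mul_pos (Rat.den_pos _) (Rat.den_pos _)) (hd.trans h1)
    omega
  let φ : Matrix (Fin n) (Fin n) ℚ →+* Matrix (Fin n) (Fin n) ℚ_[p] := (Rat.castHom ℚ_[p]).mapMatrix
  let M : Fin m → Fin m → (Matrix (Fin n) (Fin n) ℚ_[p])ˣ := fun i j => Units.map φ.toMonoidHom (lam i j)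
  have hM : ∀ i j, ∃ T > 0, ∃ x, PLog p ((M i j).1 ^ T) x := fun i j =>
    unit_return (u := M i j) (fun k l => Padic.norm_rat_le_one fun h => hden i j k l (h.mul_right _))
      (fun k l => Padic.norm_rat_le_one fun h => hden i j k l (h.mul_left _)) plog_nhds
  choose T0 hT0 y hy using hM
  set T := ∏ i, ∏ j, T0 i j with hT
  have Tpos : 0 < T := Finset.prod_pos fun i _ => Finset.prod_pos fun j _ => hT0 i j
  have Tdvd : ∀ i j, ∃ k, k ≠ 0 ∧ T = T0 i j * k := by
    intro i j
    obtain ⟨k, hk⟩ := (Finset.dvd_prod_of_mem (fun j => T0 i j) (Finset.mem_univ j)).trans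
      (Finset.dvd_prod_of_mem (fun i => ∏ j, T0 i j) (Finset.mem_univ i))
    exact ⟨k, fun h => by rw [h, mul_zero] at hk; omega, hk⟩
  choose kk hk0 hkT using Tdvd
  refine ⟨T, Tpos, fun i j hij => ?_⟩
  let A' : Subalgebra ℚ_[p] (Matrix (Fin n) (Fin n) ℚ_[p]) := Algebra.adjoin ℚ_[p] (φ '' A)
  have hA' : ∀ a ∈ A, φ a ∈ A' := fun a ha => Algebra.subset_adjoin ⟨a, ha, rfl⟩
  have hMM : ∀ u : (Matrix (Fin n) (Fin n) ℚ)ˣ, φ u.1 = (Units.map φ.toMonoidHom u).1 := fun _ => rfl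
  have hnT : ∀ i j, i ≠ j → ∀ k : ℕ, ∀ a ∈ A, (lam i j ^ k).1 * a * ((lam i j ^ k)⁻¹).1 ∈ A := by
    intro i j hij k
    induction k with
    | zero => intro a ha; simpa using ha
    | succ k ih =>
      intro a ha
      have := hnorm i j hij _ (ih a ha)
      convert this using 1
      rw [pow_succ', mul_inv_rev]; push_cast; noncomm_ring
  have main := alg_p (p := p) hm (by
      rw [Module.finrank_matrix, Module.finrank_self]; simp
      obtain ⟨k, rfl⟩ : ∃ k, m = n + 1 + k := ⟨m - n - 1, by omega⟩
      rw [show n + 1 + k - 1 = n + k by omega]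
      rcases Nat.eq_zero_or_pos n with h | h
      · subst h; nlinarith
      · nlinarith) A' (fun i j => M i j ^ T) (fun i j => (kk i j : ℚ_[p]) • y i j)
    (fun i j => by
      have := (hy i j).pow (hk0 i j)
      rwa [← pow_mul, ← hkT] at this) (q * T) (by positivity) ?_ ?_ ?_ i j hij
  · have h2 : φ (lam i j ^ T).1 ∈ A' := by rw [hMM, map_pow]; exact main
    have h3 : Algebra.adjoin ℚ_[p] (φ '' A) = A' := rfl
    have h4 := h2
    rw [← Subalgebra.mem_toSubmodule, ← h3, Algebra.adjoin_eq_span] at h4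
    have h5 : (Submonoid.closure (φ '' A) : Set _) = φ '' A := by
      have : φ '' A = ((A.toSubsemiring.toSubmonoid.map φ.toMonoidHom : Submonoid _) : Set _) := rfl
      rw [this, Submonoid.closure_eq]
    rw [h5] at h4
    exact descent (p := p) (Subalgebra.toSubmodule A) _ h4
  · intro i j hij a ha
    induction ha using Algebra.adjoin_induction with
    | mem x hx =>
      obtain ⟨a, ha, rfl⟩ := hx
      have := hA' _ (hnT i j hij T a ha)
      rwa [map_mul, map_mul, hMM, hMM, map_inv, map_pow] at this
    | algebraMap r =>
      rw [mul_assoc, Algebra.commutes, ← mul_assoc, Units.mul_inv, one_mul]; exact A'.algebraMap_mem r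
    | add x y _ _ hx hy => rw [mul_add, add_mul]; exact A'.add_mem hx hy
    | mul x y _ _ hx hy =>
      convert A'.mul_mem hx hy using 1
      simp [mul_assoc]
  · intro i j l h1 h2 h3 s
    have := hA' _ (hcomm i j l h1 h2 h3 (T * s))
    rw [hMM] at this
    convert this using 2
    simp only [map_mul, map_inv, map_pow, M, ← pow_mul]
    rw [show T * (q * T * (s * s)) = q * (T * s * (T * s)) by ring]
  · intro i j k l h1 h2 h3 h4 s
    have := hA' _ (hcomm0 i j k l h1 h2 h3 h4 (T * s))
    rw [hMM] at this
    convert this using 2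
    simp only [map_mul, map_inv, map_pow, M, ← pow_mul]

end alg
end Thomas
end
end

section
open MeasureTheory Filter Topology Set
open scoped ENNReal NNReal

noncomputable section
namespace Thomas

/-- `ℚ^n` as a vector space, its subgroups, and its matrix algebra. -/
abbrev QV (n : ℕ) := Fin n → ℚ
abbrev SG (n : ℕ) := AddSubgroup (QV n)
abbrev MM (n : ℕ) := Matrix (Fin n) (Fin n) ℚ

variable {n : ℕ}

/-- Quasi-homomorphisms. -/
def QH (B C : SG n) : Submodule ℚ (MM n) where
  carrier := {a | ∃ c : ℕ, c ≠ 0 ∧ ∀ v ∈ B, c • a.mulVec v ∈ C}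
  zero_mem' := ⟨1, one_ne_zero, fun v _ => by simp [C.zero_mem]⟩
  add_mem' := by
    rintro a b ⟨c, hc, h⟩ ⟨d, hd, h'⟩
    refine ⟨c * d, mul_ne_zero hc hd, fun v hv => ?_⟩
    rw [Matrix.add_mulVec, nsmul_add]
    refine C.add_mem ?_ ?_
    · rw [mul_comm, mul_nsmul']; exact C.nsmul_mem (h v hv) d
    · rw [mul_nsmul']; exact C.nsmul_mem (h' v hv) c
  smul_mem' := by
    rintro r a ⟨c, hc, h⟩
    refine ⟨c * r.den, mul_ne_zero hc r.den_nz, fun v hv => ?_⟩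
    have : (c * r.den) • (r • a).mulVec v = r.num • (c • a.mulVec v) := by
      rw [Matrix.smul_mulVec]
      simp only [← Nat.cast_smul_eq_nsmul ℚ, ← Int.cast_smul_eq_zsmul ℚ, smul_smul]
      congr 1
      push_cast
      rw [mul_assoc, Rat.den_mul_eq_num, mul_comm]
    rw [this]
    exact C.zsmul_mem (h v hv) _

lemma mem_QH {B C : SG n} {a : MM n} : a ∈ QH B C ↔ ∃ c : ℕ, c ≠ 0 ∧ ∀ v ∈ B, c • a.mulVec v ∈ C := Iff.rfl

lemma QH_mul {B C D : SG n} {a b : MM n} (ha : a ∈ QH C D) (hb : b ∈ QH B C) : a * b ∈ QH B D := by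
  obtain ⟨c, hc, h⟩ := ha
  obtain ⟨d, hd, h'⟩ := hb
  refine ⟨c * d, mul_ne_zero hc hd, fun v hv => ?_⟩
  have := h _ (h' v hv)
  rwa [Matrix.mulVec_smul, Matrix.mulVec_mulVec, smul_smul] at this

lemma QH_one (B : SG n) : 1 ∈ QH B B := ⟨1, one_ne_zero, fun v hv => by simpa using hv⟩

def QA (B : SG n) : Subalgebra ℚ (MM n) :=
  (QH B B).toSubalgebra (QH_one B) fun _ _ ha hb => QH_mul ha hb

lemma mem_QA {B : SG n} {a : MM n} : a ∈ QA B ↔ a ∈ QH B B := Iff.rfl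

/-- quasi-isomorphism -/
def QI (k : (MM n)ˣ) (B C : SG n) : Prop := k.1 ∈ QH B C ∧ (k⁻¹).1 ∈ QH C B

lemma QI.mul {k l : (MM n)ˣ} {B C D : SG n} (h : QI k C D) (h' : QI l B C) : QI (k * l) B D :=
  ⟨QH_mul h.1 h'.1, by rw [mul_inv_rev]; exact QH_mul h'.2 h.2⟩

lemma QI.inv {k : (MM n)ˣ} {B C : SG n} (h : QI k B C) : QI k⁻¹ C B := ⟨h.2, by rw [inv_inv]; exact h.1⟩

lemma QI.right {k : (MM n)ˣ} {B C D : SG n} (h : QI k B C) (a : MM n) : a ∈ QH B D ↔ a * (k⁻¹).1 ∈ QH C D :=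
  ⟨fun ha => QH_mul ha h.2, fun ha => by simpa using QH_mul ha h.1⟩

lemma QI.left {k : (MM n)ˣ} {B C D : SG n} (h : QI k B C) (a : MM n) : a ∈ QH D B ↔ k.1 * a ∈ QH D C :=
  ⟨fun ha => QH_mul h.1 ha, fun ha => by simpa using QH_mul h.2 ha⟩

/-- The pair of quasi-hom spaces. -/
def TT (B C : SG n) : Submodule ℚ (MM n) × Submodule ℚ (MM n) := (QH B C, QH C B)

lemma TT_symm {B C B' C' : SG n} (h : TT B C = TT B' C') : TT C B = TT C' B' := by
  have := congrArg Prod.swap h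
  exact this

lemma QI_of_TT {B C B' C' : SG n} (h : TT B C = TT B' C') {k : (MM n)ˣ} (hk : QI k B C) : QI k B' C' := by
  obtain ⟨h1, h2⟩ := Prod.ext_iff.1 h
  simp only [TT] at h1 h2
  exact ⟨h1 ▸ hk.1, h2 ▸ hk.2⟩

lemma TT_comp {B C D B' C' D' : SG n} (h1 : TT B C = TT B' C') (h2 : TT C D = TT C' D') {k : (MM n)ˣ} (hk : QI k B C) :
    TT B D = TT B' D' := by
  have hk' := QI_of_TT h1 hk
  obtain ⟨e, f⟩ := Prod.ext_iff.1 h2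
  simp only [TT] at e f
  refine Prod.ext ?_ ?_
  · ext a; exact ((hk.right a).trans (by rw [e])).trans (hk'.right a).symm
  · ext a; exact ((hk.left a).trans (by rw [f])).trans (hk'.left a).symm

lemma TT_one {B C B' C' : SG n} (h1 : TT B C = TT B' C') {k : (MM n)ˣ} (hk : QI k B C) : TT B B = TT B' B' :=
  TT_comp h1 (TT_symm h1) hk

instance : Countable (MM n) := inferInstanceAs (Countable (Fin n → Fin n → ℚ))

instance : Countable (Submodule ℚ (MM n)) :=
  Function.Surjective.countable (f := fun s : Finset (MM n) => Submodule.span ℚ (s : Set (MM n)))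
    fun W => IsNoetherian.noetherian W

lemma meas_QH {X : Type*} [MeasurableSpace X] {f g : X → SG n} (hf : ∀ v, MeasurableSet {x | v ∈ f x})
    (hg : ∀ v, MeasurableSet {x | v ∈ g x}) (a : MM n) : MeasurableSet {x | a ∈ QH (f x) (g x)} := by
  have : {x | a ∈ QH (f x) (g x)} = ⋃ c : ℕ, ⋃ _ : c ≠ 0, ⋂ v : QV n, ({x | v ∈ f x}ᶜ ∪ {x | c • a.mulVec v ∈ g x}) := by
    ext x; simp [mem_QH, imp_iff_not_or]
  rw [this]
  exact .iUnion fun c => .iUnion fun _ => .iInter fun v => (hf v).compl.union (hg _)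

lemma meas_QH_eq {X : Type*} [MeasurableSpace X] {f g : X → SG n} (hf : ∀ v, MeasurableSet {x | v ∈ f x})
    (hg : ∀ v, MeasurableSet {x | v ∈ g x}) (W : Submodule ℚ (MM n)) : MeasurableSet {x | QH (f x) (g x) = W} := by
  have : {x | QH (f x) (g x) = W} = ⋂ a : MM n, {x | a ∈ QH (f x) (g x) ↔ a ∈ W} := by
    ext x; simp [SetLike.ext_iff]
  rw [this]
  refine .iInter fun a => ?_
  by_cases h : a ∈ W
  · simpa [h] using meas_QH hf hg a
  · simp only [h, iff_false]; exact (meas_QH hf hg a).compl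

lemma meas_TT_eq {X : Type*} [MeasurableSpace X] {f g : X → SG n} (hf : ∀ v, MeasurableSet {x | v ∈ f x})
    (hg : ∀ v, MeasurableSet {x | v ∈ g x}) (W) : MeasurableSet {x | TT (f x) (g x) = W} := by
  have : {x | TT (f x) (g x) = W} = {x | QH (f x) (g x) = W.1} ∩ {x | QH (g x) (f x) = W.2} := by
    ext x; simp [TT, Prod.ext_iff]
  rw [this]
  exact (meas_QH_eq hf hg _).inter (meas_QH_eq hg hf _)

end Thomas
end
end

section
open MeasureTheory Filter Topology Set
open scoped ENNReal NNReal

noncomputable section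
namespace Thomas

/-- `B = cB + ⟨F⟩` for some finite `F ⊆ B` -/
def FinP {G : Type*} [AddCommGroup G] (B : AddSubgroup G) (c : ℕ) : Prop :=
  ∃ F : Finset G, (F : Set G) ⊆ B ∧ ∀ v ∈ B, ∃ w ∈ B, v - c • w ∈ AddSubgroup.closure (F : Set G)

lemma FinP.mul {G : Type*} [AddCommGroup G] {B : AddSubgroup G} {a b : ℕ} (ha : FinP B a) (hb : FinP B b) :
    FinP B (a * b) := by
  classical
  obtain ⟨F, hF, h⟩ := ha
  obtain ⟨F', hF', h'⟩ := hb
  refine ⟨F ∪ F', by simp [hF, hF'], fun v hv => ?_⟩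
  obtain ⟨w, hw, e⟩ := h v hv
  obtain ⟨w', hw', e'⟩ := h' w hw
  refine ⟨w', hw', ?_⟩
  have : v - (a * b) • w' = (v - a • w) + a • (w - b • w') := by
    rw [smul_sub, smul_smul]; abel
  rw [this]
  exact add_mem (AddSubgroup.closure_mono (by simp) e) (nsmul_mem (AddSubgroup.closure_mono (by simp) e') _)

/-- rank one: `B = pB` or `B = ⟨w⟩ + pB` for any `w ∉ pB`. -/
lemma rank_one_p {B : AddSubgroup ℚ} {p : ℕ} (hp : p.Prime) {w : ℚ} (hw : w ∈ B) (hwp : ∀ b ∈ B, w ≠ p • b)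
    {v : ℚ} (hv : v ∈ B) : ∃ b ∈ B, ∃ k : ℤ, v = k • w + p • b := by
  have hw0 : w ≠ 0 := fun h => hwp 0 B.zero_mem (by simp [h])
  set r := v / w
  have e : (r.den : ℤ) • v = r.num • w := by
    simp only [zsmul_eq_mul, Int.cast_natCast]
    have := Rat.den_mul_eq_num r
    rw [← this, mul_assoc]; congr 1; simp only [r]; field_simp
  by_cases hd : p ∣ r.den
  · exfalso
    have hn : IsCoprime (p : ℤ) r.num := by
      rw [Int.isCoprime_iff_gcd_eq_one]
      have h1 := r.reduced
      have : Nat.Coprime p r.num.natAbs := (Nat.Coprime.coprime_dvd_left hd h1.symm)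
      simpa [Int.gcd] using this
    obtain ⟨x, y, hxy⟩ := hn
    obtain ⟨d, hd⟩ := hd
    refine hwp (x • w + y • (d : ℤ) • v) (add_mem (zsmul_mem hw _) (zsmul_mem (zsmul_mem hv _) _)) ?_
    have h3 : ((x : ℚ) * p + y * r.num) = 1 := by exact_mod_cast hxy
    rw [hd] at e
    simp only [zsmul_eq_mul, nsmul_eq_mul] at e ⊢
    push_cast at e ⊢
    linear_combination (-w) * h3 - y * e
  · have hn : IsCoprime (p : ℤ) r.den := by
      rw [Int.isCoprime_iff_gcd_eq_one]
      simpa [Int.gcd] using (Nat.Prime.coprime_iff_not_dvd hp).2 hd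
    obtain ⟨x, y, hxy⟩ := hn
    refine ⟨x • v, zsmul_mem hv _, y * r.num, ?_⟩
    rw [mul_smul, ← e]
    simp only [zsmul_eq_mul, nsmul_eq_mul]
    have h3 : ((x : ℚ) * p + y * r.den) = 1 := by exact_mod_cast hxy
    push_cast
    linear_combination (-v) * h3

lemma finP_Q (B : AddSubgroup ℚ) (c : ℕ) (hc : c ≠ 0) : FinP B c := by
  induction c using Nat.recOnMul with
  | zero => exact absurd rfl hc
  | one => exact ⟨∅, by simp, fun v hv => ⟨v, hv, by simp⟩⟩
  | prime p hp =>
    by_cases h : ∀ w ∈ B, ∃ b ∈ B, w = p • b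
    · refine ⟨∅, by simp, fun v hv => ?_⟩
      obtain ⟨b, hb, e⟩ := h v hv
      exact ⟨b, hb, by simp [e]⟩
    · push Not at h
      obtain ⟨w, hw, hwp⟩ := h
      refine ⟨{w}, by simpa using hw, fun v hv => ?_⟩
      obtain ⟨b, hb, k, e⟩ := rank_one_p hp hw hwp hv
      refine ⟨b, hb, ?_⟩
      rw [e, add_sub_cancel_right]
      exact zsmul_mem (AddSubgroup.subset_closure (by simp)) _
  | mul a b iha ihb => exact (iha (left_ne_zero_of_mul hc)).mul (ihb (right_ne_zero_of_mul hc))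

lemma finP (n : ℕ) (B : SG n) (c : ℕ) (hc : c ≠ 0) : FinP B c := by
  classical
  induction n with
  | zero => exact ⟨∅, by simp, fun v hv => ⟨v, hv, by rw [Subsingleton.elim (v - c • v) 0]; exact zero_mem _⟩⟩
  | succ n ih =>
    let i : QV n →+ QV (n + 1) :=
      { toFun := fun v => Fin.cons 0 v
        map_zero' := by ext j; refine Fin.cases ?_ (fun k => ?_) j <;> simp
        map_add' := fun v w => by ext j; refine Fin.cases ?_ (fun k => ?_) j <;> simp }
    let q : QV (n + 1) →+ ℚ := Pi.evalAddMonoidHom _ 0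
    obtain ⟨F, hF, h⟩ := ih (B.comap i)
    obtain ⟨F', hF', h'⟩ := finP_Q (B.map q) c hc
    choose! s hs using fun x (hx : x ∈ B.map q) => AddSubgroup.mem_map.1 hx
    refine ⟨F.image i ∪ F'.image s, ?_, fun v hv => ?_⟩
    · intro x hx
      simp only [Finset.coe_union, Finset.coe_image, mem_union, mem_image] at hx
      rcases hx with ⟨y, hy, rfl⟩ | ⟨y, hy, rfl⟩
      · exact hF hy
      · exact (hs y (hF' hy)).1
    · obtain ⟨w, hw, e⟩ := h' (q v) (AddSubgroup.mem_map_of_mem q hv)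
      obtain ⟨w, hwB, rfl⟩ := AddSubgroup.mem_map.1 hw
      have : ∀ z ∈ AddSubgroup.closure (F' : Set ℚ), ∃ y ∈ AddSubgroup.closure ((F'.image s : Finset _) : Set (QV (n+1))), q y = z := by
        intro z hz
        rw [← AddSubgroup.mem_map, AddMonoidHom.map_closure]
        refine AddSubgroup.closure_mono ?_ hz
        intro y hy
        simp only [Finset.coe_image, mem_image, exists_exists_and_eq_and]
        exact ⟨y, hy, (hs y (hF' hy)).2⟩
      obtain ⟨y, hy, hqy⟩ := this _ e
      have hyB : y ∈ B := by
        refine (AddSubgroup.closure_le _).2 ?_ hy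
        intro x hx
        simp only [Finset.coe_image, mem_image] at hx
        obtain ⟨z, hz, rfl⟩ := hx
        exact (hs z (hF' hz)).1
      have hu : v - c • w - y ∈ B := sub_mem (sub_mem hv (nsmul_mem hwB _)) hyB
      have hi : i (Fin.tail (v - c • w - y)) = v - c • w - y := by
        have h0 : (v - c • w - y) 0 = 0 := by
          have : q (v - c • w - y) = 0 := by rw [map_sub, hqy, map_sub, map_nsmul]; simp
          exact this
        conv_rhs => rw [← Fin.cons_self_tail (v - c • w - y), h0]
        rfl
      obtain ⟨b, hb, e2⟩ := h (Fin.tail (v - c • w - y)) (by rw [AddSubgroup.mem_comap, hi]; exact hu)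
      refine ⟨w + i b, add_mem hwB hb, ?_⟩
      have : v - c • (w + i b) = y + i (Fin.tail (v - c • w - y) - c • b) := by
        rw [map_sub, hi, map_nsmul, smul_add]; abel
      rw [this]
      refine add_mem (AddSubgroup.closure_mono (by simp) hy) ?_
      have h3 := AddSubgroup.mem_map_of_mem i e2
      rw [AddMonoidHom.map_closure] at h3
      exact AddSubgroup.closure_mono (by simp) h3

variable {n : ℕ}

def EE (k : ℕ) (B : SG n) : SG n where
  carrier := {v | (∃ z : Fin n → ℤ, ∀ i, (k.factorial : ℚ) * v i = z i) ∧ ∃ c : ℕ, c ≠ 0 ∧ c • v ∈ B}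
  zero_mem' := ⟨⟨0, by simp⟩, 1, one_ne_zero, by simp [B.zero_mem]⟩
  add_mem' := by
    rintro a b ⟨⟨z, hz⟩, c, hc, h⟩ ⟨⟨z', hz'⟩, d, hd, h'⟩
    refine ⟨⟨z + z', fun i => by simp [mul_add, hz, hz']⟩, c * d, mul_ne_zero hc hd, ?_⟩
    rw [smul_add]
    exact add_mem (by rw [mul_comm, mul_smul]; exact nsmul_mem h _) (by rw [mul_smul]; exact nsmul_mem h' _)
  neg_mem' := by
    rintro a ⟨⟨z, hz⟩, c, hc, h⟩
    exact ⟨⟨-z, fun i => by simp [hz]⟩, c, hc, by rw [smul_neg]; exact neg_mem h⟩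

lemma mem_EE {k : ℕ} {B : SG n} {v : QV n} : v ∈ EE k B ↔
    (∃ z : Fin n → ℤ, ∀ i, (k.factorial : ℚ) * v i = z i) ∧ ∃ c : ℕ, c ≠ 0 ∧ c • v ∈ B := Iff.rfl

/-- the hull -/
def hh (k : ℕ) (B : SG n) : SG n := B ⊔ EE k B

lemma EE_bdd (k : ℕ) (B : SG n) : ∃ c : ℕ, c ≠ 0 ∧ ∀ v ∈ EE k B, c • v ∈ B := by
  classical
  let φ : (Fin n → ℤ) →+ QV n :=
    { toFun := fun z i => (z i : ℚ) / k.factorial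
      map_zero' := by ext; simp
      map_add' := fun a b => by ext i; simp [add_div] }
  obtain ⟨s, hs⟩ := IsNoetherian.noetherian (AddSubgroup.toIntSubmodule ((EE k B).comap φ))
  have key : ∀ t : Finset (Fin n → ℤ), (∀ z ∈ t, φ z ∈ EE k B) → ∃ c : ℕ, c ≠ 0 ∧ ∀ z ∈ t, c • φ z ∈ B := by
    intro t
    induction t using Finset.induction_on with
    | empty => intro _; exact ⟨1, one_ne_zero, by simp⟩
    | insert a t _ ih =>
      intro h
      obtain ⟨c, hc, hc'⟩ := ih fun z hz => h z (Finset.mem_insert_of_mem hz)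
      obtain ⟨-, d, hd, hd'⟩ := h a (Finset.mem_insert_self _ _)
      refine ⟨c * d, mul_ne_zero hc hd, fun z hz => ?_⟩
      rcases Finset.mem_insert.1 hz with rfl | hz
      · rw [mul_smul]; exact nsmul_mem hd' _
      · rw [mul_comm, mul_smul]; exact nsmul_mem (hc' z hz) _
  obtain ⟨c, hc, h⟩ := key s fun z hz => by
    have : z ∈ AddSubgroup.toIntSubmodule ((EE k B).comap φ) := hs ▸ Submodule.subset_span hz
    exact this
  refine ⟨c, hc, fun v hv => ?_⟩
  obtain ⟨z, hz⟩ := hv.1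
  have e : φ z = v := by
    ext i; change (z i : ℚ) / k.factorial = v i
    rw [← hz]; field_simp
  have hz2 : z ∈ Submodule.span ℤ (s : Set (Fin n → ℤ)) := by
    rw [hs]; change φ z ∈ EE k B; rw [e]; exact hv
  have hle : Submodule.span ℤ (s : Set (Fin n → ℤ)) ≤ AddSubgroup.toIntSubmodule (B.comap (c • φ)) :=
    Submodule.span_le.2 fun z hz => h z hz
  have := hle hz2
  rw [← e]; exact this

lemma hh_fibre (k : ℕ) (D : SG n) : {B : SG n | hh k B = D}.Countable := by
  refine (Set.countable_range fun q : ℕ × Finset (QV n) =>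
    D.map (nsmulAddMonoidHom q.1) ⊔ AddSubgroup.closure (q.2 : Set (QV n))).mono ?_
  rintro B rfl
  obtain ⟨c, hc, h⟩ := EE_bdd k B
  obtain ⟨F, hF, h'⟩ := finP n B c hc
  refine ⟨(c, F), le_antisymm (sup_le ?_ ((AddSubgroup.closure_le _).2 hF)) fun v hv => ?_⟩
  · rintro _ ⟨v, hv, rfl⟩
    obtain ⟨b, hb, e, he, rfl⟩ := AddSubgroup.mem_sup.1 hv
    change c • (b + e) ∈ B
    rw [smul_add]
    exact add_mem (nsmul_mem hb _) (h e he)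
  · obtain ⟨w, hw, e⟩ := h' v hv
    rw [← add_sub_cancel (c • w) v]
    exact AddSubgroup.add_mem_sup ⟨w, AddSubgroup.mem_sup_left hw, rfl⟩ e

lemma hh_eq {B B' : SG n} (h : QI 1 B B') : ∃ K, ∀ k, K ≤ k → hh k B = hh k B' := by
  suffices H : ∀ {B B' : SG n}, QI 1 B B' → ∃ K, ∀ k, K ≤ k → hh k B ≤ hh k B' by
    obtain ⟨K, hK⟩ := H h
    obtain ⟨K', hK'⟩ := H (B := B') (B' := B) (by simpa using h.inv)
    exact ⟨max K K', fun k hk => le_antisymm (hK k (le_of_max_le_left hk)) (hK' k (le_of_max_le_right hk))⟩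
  intro B B' h
  obtain ⟨c, hc, h1⟩ := h.1
  simp only [Units.val_one, Matrix.one_mulVec] at h1
  obtain ⟨F, hF, h'⟩ := finP n B c hc
  have hE : ∀ k, EE k B ≤ EE k B' := fun k v ⟨hz, d, hd, hdv⟩ =>
    ⟨hz, c * d, mul_ne_zero hc hd, by rw [mul_smul]; exact h1 _ hdv⟩
  have hden : ∃ K, ∀ v ∈ F, ∀ i, (v i).den ≤ K :=
    ⟨∑ v ∈ F, ∑ i, (v i).den, fun v hv i => (Finset.single_le_sum (f := fun i => (v i).den) (fun _ _ => Nat.zero_le _)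
      (Finset.mem_univ i)).trans (Finset.single_le_sum (f := fun v : QV n => ∑ i, (v i).den) (fun _ _ => Nat.zero_le _) hv)⟩
  obtain ⟨K, hK⟩ := hden
  refine ⟨K, fun k hk => sup_le (fun v hv => ?_) ((hE k).trans le_sup_right)⟩
  obtain ⟨w, hw, e⟩ := h' v hv
  rw [← add_sub_cancel (c • w) v]
  refine AddSubgroup.add_mem_sup (h1 w hw) ?_
  refine (AddSubgroup.closure_le _).2 (fun f hf => hE k ⟨?_, 1, one_ne_zero, by simpa using hF hf⟩) e
  have : ∀ i, ∃ z : ℤ, (k.factorial : ℚ) * f i = z := fun i => by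
    obtain ⟨d, hd⟩ := Nat.dvd_factorial (f i).den_pos ((hK f hf i).trans hk)
    refine ⟨d * (f i).num, ?_⟩
    rw [hd]; push_cast
    rw [← Rat.den_mul_eq_num]; ring
  choose z hz using this
  exact ⟨z, hz⟩

lemma meas_hh {X : Type*} [MeasurableSpace X] {f : X → SG n} (hf : ∀ v, MeasurableSet {x | v ∈ f x}) (k : ℕ) (v) :
    MeasurableSet {x | v ∈ hh k (f x)} := by
  have hE : ∀ w, MeasurableSet {x | w ∈ EE k (f x)} := fun w => by
    by_cases hz : ∃ z : Fin n → ℤ, ∀ i, (k.factorial : ℚ) * w i = z i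
    · have : {x | w ∈ EE k (f x)} = ⋃ c : ℕ, ⋃ _ : c ≠ 0, {x | c • w ∈ f x} := by
        ext x; simp only [mem_ofPred_eq, mem_EE, hz, true_and, mem_iUnion]; simp
      rw [this]
      exact .iUnion fun c => .iUnion fun _ => hf _
    · have : {x | w ∈ EE k (f x)} = ∅ := by ext x; simp only [mem_ofPred_eq, mem_EE, hz, false_and]; simp
      rw [this]; exact .empty
  have : {x | v ∈ hh k (f x)} = ⋃ w : QV n, {x | w ∈ f x} ∩ {x | v - w ∈ EE k (f x)} := by
    ext x
    simp only [mem_ofPred_eq, hh, AddSubgroup.mem_sup, mem_iUnion, mem_inter_iff]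
    exact ⟨fun ⟨y, hy, z, hz, e⟩ => ⟨y, hy, by rw [← e, add_sub_cancel_left]; exact hz⟩,
      fun ⟨w, hw, h⟩ => ⟨w, hw, _, h, by simp⟩⟩
  rw [this]
  exact .iUnion fun w => (hf w).inter (hE _)

lemma meas_SG_eq {X : Type*} [MeasurableSpace X] {f g : X → SG n} (hf : ∀ v, MeasurableSet {x | v ∈ f x})
    (hg : ∀ v, MeasurableSet {x | v ∈ g x}) : MeasurableSet {x | f x = g x} := by
  have : {x | f x = g x} = ⋂ v : QV n, ({x | v ∈ f x} ∩ {x | v ∈ g x}) ∪ ({x | v ∈ f x}ᶜ ∩ {x | v ∈ g x}ᶜ) := by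
    ext x; simp only [mem_ofPred_eq, SetLike.ext_iff, mem_iInter, mem_union, mem_inter_iff, mem_compl_iff]
    exact forall_congr' fun v => by tauto
  rw [this]
  exact .iInter fun v => ((hf v).inter (hg v)).union ((hf v).compl.inter (hg v).compl)

end Thomas
end
end

section
open MeasureTheory Filter Topology Set
open scoped ENNReal NNReal

noncomputable section
namespace Thomas
variable {n : ℕ}

lemma exists_equiv_of_indep {ι : Type*} (b b' : ι → QV n) (hb : LinearIndependent ℚ b)
    (hb' : LinearIndependent ℚ b') : ∃ E : QV n ≃ₗ[ℚ] QV n, ∀ i, E (b i) = b' i := by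
  let e := (Module.Basis.span hb).equiv (Module.Basis.span hb') (Equiv.refl ι)
  obtain ⟨C, hC⟩ := Submodule.exists_isCompl (Submodule.span ℚ (range b))
  obtain ⟨C', hC'⟩ := Submodule.exists_isCompl (Submodule.span ℚ (range b'))
  have h1 := Submodule.finrank_add_eq_of_isCompl hC
  have h2 := Submodule.finrank_add_eq_of_isCompl hC'
  have h3 := e.finrank_eq
  let e' : C ≃ₗ[ℚ] C' := LinearEquiv.ofFinrankEq _ _ (by omega)
  refine ⟨((Submodule.prodEquivOfIsCompl _ _ hC).symm.trans (e.prodCongr e')).trans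
    (Submodule.prodEquivOfIsCompl _ _ hC'), fun i => ?_⟩
  have hi : b i = ((Module.Basis.span hb i : Submodule.span ℚ (range b)) : QV n) := (congrArg Subtype.val (Module.Basis.span_apply hb i)).symm
  have hi2 : e (Module.Basis.span hb i) = Module.Basis.span hb' i := Module.Basis.equiv_apply _ _ _ _
  rw [hi]
  simp only [LinearEquiv.trans_apply, Submodule.prodEquivOfIsCompl_symm_apply_left, LinearEquiv.prodCongr_apply, hi2]
  simp

lemma iso_matrix {H K : SG n} (f : H ≃+ K) : ∃ k : (MM n)ˣ, ∀ v, v ∈ H ↔ k.1.mulVec v ∈ K := by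
  obtain ⟨s, hsH, hspan, hs⟩ := exists_linearIndependent ℚ (H : Set (QV n))
  have hb : LinearIndependent ℤ (fun i : s => (⟨i.1, hsH i.2⟩ : H)) := by
    refine LinearIndependent.of_comp (H.subtype.toIntLinearMap) ?_
    exact (LinearIndependent.iff_fractionRing ℤ ℚ).2 hs
  have hb' : LinearIndependent ℚ (fun i : s => ((f ⟨i.1, hsH i.2⟩ : K) : QV n)) := by
    rw [← LinearIndependent.iff_fractionRing ℤ ℚ]
    refine hb.map' ((K.subtype.comp f.toAddMonoidHom).toIntLinearMap) ?_
    rw [LinearMap.ker_eq_bot]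
    exact Subtype.val_injective.comp f.injective
  obtain ⟨E, hE⟩ := exists_equiv_of_indep _ _ hs hb'
  have key1 : ∀ w ∈ AddSubgroup.closure s, ∃ h : w ∈ H, (f ⟨w, h⟩ : QV n) = E w := by
    intro w hw
    induction hw using AddSubgroup.closure_induction with
    | mem x hx => exact ⟨hsH hx, (hE ⟨x, hx⟩).symm⟩
    | zero => exact ⟨H.zero_mem, by
        have : (⟨0, H.zero_mem⟩ : H) = 0 := rfl
        rw [this, map_zero, map_zero]; rfl⟩
    | add x y _ _ hx hy =>
      obtain ⟨h, e⟩ := hx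
      obtain ⟨h', e'⟩ := hy
      refine ⟨add_mem h h', ?_⟩
      have : (⟨x + y, add_mem h h'⟩ : H) = ⟨x, h⟩ + ⟨y, h'⟩ := rfl
      rw [this, map_add, map_add, ← e, ← e']; rfl
    | neg x _ hx =>
      obtain ⟨h, e⟩ := hx
      refine ⟨neg_mem h, ?_⟩
      have : (⟨-x, neg_mem h⟩ : H) = -⟨x, h⟩ := rfl
      rw [this, map_neg, map_neg, ← e]; rfl
  have key2 : ∀ v ∈ Submodule.span ℚ s, ∃ c : ℕ, c ≠ 0 ∧ c • v ∈ AddSubgroup.closure s := by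
    intro v hv
    induction hv using Submodule.span_induction with
    | mem x hx => exact ⟨1, one_ne_zero, by simpa using AddSubgroup.subset_closure hx⟩
    | zero => exact ⟨1, one_ne_zero, by simp⟩
    | add x y _ _ hx hy =>
      obtain ⟨c, hc, h⟩ := hx
      obtain ⟨d, hd, h'⟩ := hy
      refine ⟨c * d, mul_ne_zero hc hd, ?_⟩
      rw [smul_add]
      exact add_mem (by rw [mul_comm, mul_smul]; exact nsmul_mem h _) (by rw [mul_smul]; exact nsmul_mem h' _)
    | smul r x _ hx =>
      obtain ⟨c, hc, h⟩ := hx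
      refine ⟨c * r.den, mul_ne_zero hc r.den_nz, ?_⟩
      have : (c * r.den) • (r • x) = r.num • (c • x) := by
        simp only [← Nat.cast_smul_eq_nsmul ℚ, ← Int.cast_smul_eq_zsmul ℚ, smul_smul]
        congr 1
        push_cast
        rw [mul_assoc, Rat.den_mul_eq_num, mul_comm]
      rw [this]
      exact zsmul_mem h _
  have key3 : ∀ v (h : v ∈ H), (f ⟨v, h⟩ : QV n) = E v := by
    intro v h
    obtain ⟨c, hc, hcv⟩ := key2 v (hspan ▸ Submodule.subset_span h)
    obtain ⟨h', e⟩ := key1 _ hcv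
    have : (⟨c • v, h'⟩ : H) = c • ⟨v, h⟩ := rfl
    rw [this, map_nsmul, map_nsmul] at e
    have e2 : c • ((f ⟨v, h⟩ : QV n) - E v) = 0 := by rw [smul_sub, sub_eq_zero, ← e]; rfl
    exact sub_eq_zero.1 ((smul_eq_zero.1 e2).resolve_left hc)
  have hdet : IsUnit (LinearMap.toMatrix' (E : QV n →ₗ[ℚ] QV n)) := by
    refine IsUnit.of_mul_eq_one (LinearMap.toMatrix' (E.symm : QV n →ₗ[ℚ] QV n)) ?_
    rw [← LinearMap.toMatrix'_comp]; simp
  refine ⟨hdet.unit, fun v => ?_⟩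
  have hv : (hdet.unit.1).mulVec v = E v := by
    rw [IsUnit.unit_spec, LinearMap.toMatrix'_mulVec]; rfl
  rw [hv]
  constructor
  · intro h; rw [← key3 v h]; exact (f ⟨v, h⟩).2
  · intro h
    obtain ⟨⟨w, hw⟩, e⟩ := f.surjective ⟨_, h⟩
    have := key3 w hw
    rw [e] at this
    rw [E.injective this]; exact hw

lemma iso_QI {H K : SG n} (h : Nonempty (H ≃+ K)) : ∃ k : (MM n)ˣ, QI k H K := by
  obtain ⟨f⟩ := h
  obtain ⟨k, hk⟩ := iso_matrix f
  refine ⟨k, ⟨1, one_ne_zero, fun v hv => ?_⟩, ⟨1, one_ne_zero, fun v hv => ?_⟩⟩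
  · rw [one_smul]; exact (hk v).1 hv
  · rw [one_smul, hk]; simpa using hv

/-- rank one: quasi-equal subgroups are isomorphic -/
lemma rank_one_iso : ∀ (c : ℕ), c ≠ 0 → ∀ B B' : AddSubgroup ℚ, B' ≤ B → (∀ v ∈ B, c • v ∈ B') → Nonempty (B' ≃+ B) := by
  intro c hc
  induction c using Nat.recOnMul with
  | zero => exact absurd rfl hc
  | one => intro B B' h h'; rw [le_antisymm h fun v hv => by simpa using h' v hv]; exact ⟨AddEquiv.refl _⟩
  | prime p hp =>
    intro B B' h h'
    by_cases hw : ∃ w ∈ B', ∀ b ∈ B, w ≠ p • b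
    · obtain ⟨w, hw, hwp⟩ := hw
      have : B' = B := le_antisymm h fun v hv => by
        obtain ⟨b, hb, k, e⟩ := rank_one_p hp (h hw) hwp hv
        rw [e]; exact add_mem (zsmul_mem hw _) (h' b hb)
      rw [this]; exact ⟨AddEquiv.refl _⟩
    · push Not at hw
      have hinj : Function.Injective (nsmulAddMonoidHom p : ℚ →+ ℚ) := fun x y hxy => by
        have h0 : (p : ℚ) ≠ 0 := by exact_mod_cast hp.ne_zero
        simpa [h0, nsmul_eq_mul, hp.ne_zero] using hxy
      have : B' = B.map (nsmulAddMonoidHom p) := by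
        ext v
        constructor
        · intro hv; obtain ⟨b, hb, e⟩ := hw v hv; exact ⟨b, hb, e.symm⟩
        · rintro ⟨b, hb, rfl⟩; exact h' b hb
      rw [this]; exact ⟨(B.equivMapOfInjective _ hinj).symm⟩
  | mul a b iha ihb =>
    intro B B' h h'
    have hle : B' ≤ B' ⊔ B.map (nsmulAddMonoidHom a) := le_sup_left
    obtain ⟨e1⟩ := ihb (right_ne_zero_of_mul hc) (B' ⊔ B.map (nsmulAddMonoidHom a)) B' hle (by
      intro v hv
      obtain ⟨x, hx, _, ⟨y, hy, rfl⟩, rfl⟩ := AddSubgroup.mem_sup.1 hv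
      rw [smul_add]
      refine add_mem (nsmul_mem hx _) ?_
      have := h' y hy
      rw [mul_comm, mul_smul] at this
      exact this)
    obtain ⟨e2⟩ := iha (left_ne_zero_of_mul hc) B (B' ⊔ B.map (nsmulAddMonoidHom a))
      (sup_le h (by rintro _ ⟨y, hy, rfl⟩; exact nsmul_mem hy _))
      (fun v hv => AddSubgroup.mem_sup_right ⟨v, hv, rfl⟩)
    exact ⟨e1.trans e2⟩

/-- `n = 1`: equal hulls imply isomorphic -/
lemma hh_one_iso {B B' : SG 1} {k : ℕ} (h : hh k B = hh k B') : Nonempty (B ≃+ B') := by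
  have key : ∀ B : SG 1, Nonempty (B ≃+ hh k B) := fun B => by
    obtain ⟨c, hc, hE⟩ := EE_bdd k B
    let q : QV 1 ≃+ ℚ := (LinearEquiv.funUnique (Fin 1) ℚ ℚ).toAddEquiv
    obtain ⟨e⟩ := rank_one_iso c hc ((hh k B).map q.toAddMonoidHom) (B.map q.toAddMonoidHom)
      (AddSubgroup.map_mono le_sup_left) (by
        rintro _ ⟨v, hv, rfl⟩
        obtain ⟨b, hb, e, he, rfl⟩ := AddSubgroup.mem_sup.1 hv
        refine ⟨c • (b + e), ?_, map_nsmul _ _ _⟩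
        rw [smul_add]
        exact add_mem (nsmul_mem hb _) (hE e he))
    exact ⟨((B.equivMapOfInjective _ q.injective).trans e).trans ((hh k B).equivMapOfInjective _ q.injective).symm⟩
  obtain ⟨e⟩ := key B
  obtain ⟨e'⟩ := key B'
  rw [← h] at e'
  exact ⟨e.trans e'.symm⟩

end Thomas
end
end

section
open MeasureTheory Filter Topology Set
open scoped ENNReal NNReal

noncomputable section
namespace Thomas

instance : MeasurableSpace ℤ_[2] := borel _
instance : BorelSpace ℤ_[2] := ⟨rfl⟩

abbrev XX (m : ℕ) := Fin m → ℤ_[2]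

/-- Haar probability measure of a compact group -/
def hp (G : Type*) [TopologicalSpace G] [AddGroup G] [IsTopologicalAddGroup G] [CompactSpace G] [MeasurableSpace G]
    [BorelSpace G] : Measure G := Measure.addHaarMeasure ⊤

section
variable (G : Type*) [TopologicalSpace G] [AddGroup G] [IsTopologicalAddGroup G] [CompactSpace G] [MeasurableSpace G]
    [BorelSpace G]

instance : (hp G).IsAddHaarMeasure := by unfold hp; infer_instance

instance : IsProbabilityMeasure (hp G) := ⟨by
  have := Measure.addHaarMeasure_self (K₀ := (⊤ : TopologicalSpace.PositiveCompacts G))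
  simpa [hp] using this⟩

variable {G}
variable {H : Type*} [TopologicalSpace H] [AddGroup H] [IsTopologicalAddGroup H] [CompactSpace H] [MeasurableSpace H]
    [BorelSpace H]

lemma hp_map (f : G →+ H) (hf : Continuous f) (hs : Function.Surjective f) : MeasurePreserving f (hp G) (hp H) := by
  refine ⟨hf.measurable, ?_⟩
  have := Measure.isAddHaarMeasure_map_of_isFiniteMeasure (μ := hp G) f hf hs
  have : IsProbabilityMeasure ((hp G).map f) := Measure.isProbabilityMeasure_map hf.measurable.aemeasurable
  exact Measure.isAddHaarMeasure_eq_of_isProbabilityMeasure _ _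

end

section
variable (G : Type*) [TopologicalSpace G] [AddCommGroup G] [IsTopologicalAddGroup G] [CompactSpace G] [MeasurableSpace G]
    [BorelSpace G] [SecondCountableTopology G]
variable {H : Type*} [TopologicalSpace H] [AddCommGroup H] [IsTopologicalAddGroup H] [CompactSpace H] [MeasurableSpace H]
    [BorelSpace H] [SecondCountableTopology H]

lemma hp_prod : hp (G × H) = (hp G).prod (hp H) := Measure.isAddHaarMeasure_eq_of_isProbabilityMeasure _ _
end

lemma hp_add {m : ℕ} (c : XX m) : MeasurePreserving (fun x => x + c) (hp (XX m)) (hp (XX m)) :=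
  measurePreserving_add_right _ c

lemma hp_coord {m : ℕ} (j : Fin m) : hp (XX m) {x | x j = 0} = 0 := by
  have h := hp_map (G := XX m) (H := ℤ_[2]) (Pi.evalAddMonoidHom _ j) (continuous_apply j)
    (Function.surjective_eval j)
  have h0 : hp ℤ_[2] {0} = 0 := by
    have : (𝓝[≠] (0 : ℤ_[2])).NeBot := by
      rw [← mem_closure_iff_nhdsWithin_neBot]
      refine mem_closure_of_tendsto (f := fun k : ℕ => (2 : ℤ_[2]) ^ k) (b := atTop) ?_ (Eventually.of_forall fun k => ?_)
      · refine tendsto_pow_atTop_nhds_zero_of_norm_lt_one ?_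
        have := PadicInt.norm_p (p := 2)
        push_cast at this
        rw [this]; norm_num
      · exact pow_ne_zero _ two_ne_zero
    exact measure_singleton 0
  rw [← h.measure_preimage (measurableSet_singleton 0).nullMeasurableSet] at h0
  exact h0

/-- continuity in measure -/
lemma cont_set {X : Type} [MetricSpace X] [CompactSpace X] [MeasurableSpace X] [BorelSpace X] (μ : Measure X)
    [IsFiniteMeasure μ] (A : Set X) (hA : MeasurableSet A) (ε : ℝ≥0∞) (hε : ε ≠ 0) : ∃ δ > 0, ∀ {Ω : Type} [MeasurableSpace Ω] (P : Measure Ω)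
    (u v : Ω → X), MeasurePreserving u P μ → MeasurePreserving v P μ → (∀ ω, dist (u ω) (v ω) < δ) →
    P {ω | u ω ∈ A ∧ v ω ∉ A} ≤ ε := by
  have hε2 : ε / 2 ≠ 0 := by simpa using hε
  obtain ⟨K, hKA, hK, hK2⟩ := hA.exists_isCompact_sdiff_lt (measure_ne_top μ A) hε2
  obtain ⟨U, hAU, hU, -, hU2⟩ := hA.exists_isOpen_sdiff_lt (measure_ne_top μ A) hε2
  obtain ⟨δ, hδ, h⟩ := hK.exists_thickening_subset_open hU (hKA.trans hAU)
  refine ⟨δ, hδ, fun P u v hu hv hd => ?_⟩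
  have hsub : {ω | u ω ∈ A ∧ v ω ∉ A} ⊆ u ⁻¹' (A \ K) ∪ v ⁻¹' (U \ A) := by
    rintro ω ⟨h1, h2⟩
    by_cases hk : u ω ∈ K
    · right
      refine ⟨h ?_, h2⟩
      rw [Metric.mem_thickening_iff]
      exact ⟨u ω, hk, by rw [dist_comm]; exact hd ω⟩
    · left; exact ⟨h1, hk⟩
  refine (measure_mono hsub).trans ((measure_union_le _ _).trans ?_)
  rw [hu.measure_preimage (hA.diff hK.measurableSet).nullMeasurableSet,
    hv.measure_preimage (hU.measurableSet.diff hA).nullMeasurableSet]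
  calc _ ≤ ε / 2 + ε / 2 := add_le_add hK2.le hU2.le
    _ = ε := ENNReal.add_halves ε

lemma cont_fun {X : Type} [MetricSpace X] [CompactSpace X] [MeasurableSpace X] [BorelSpace X] (μ : Measure X)
    [IsFiniteMeasure μ] {C : Type*} [Countable C] (F : X → C) (hF : ∀ c, MeasurableSet {x | F x = c}) (ε : ℝ≥0∞) (hε : ε ≠ 0) :
    ∃ δ > 0, ∀ {Ω : Type} [MeasurableSpace Ω] (P : Measure Ω)
    (u v : Ω → X), MeasurePreserving u P μ → MeasurePreserving v P μ → (∀ ω, dist (u ω) (v ω) < δ) →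
    P {ω | F (u ω) ≠ F (v ω)} ≤ ε := by
  obtain ⟨ε', hε', hsum⟩ := ENNReal.exists_pos_sum_of_countable' (ENNReal.half_pos hε).ne' C
  have hfin : ∃ s : Finset C, μ (⋂ c ∈ s, {x | F x = c}ᶜ) < ε / 2 := by
    have h1 : Tendsto (fun s : Finset C => μ (⋂ c ∈ s, {x | F x = c}ᶜ)) atTop (𝓝 (μ (⋂ s : Finset C, ⋂ c ∈ s, {x | F x = c}ᶜ))) := by
      refine tendsto_measure_iInter_atTop (fun s => ?_) ?_ ⟨∅, measure_ne_top _ _⟩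
      · exact (Finset.measurableSet_biInter _ fun c _ => (hF c).compl).nullMeasurableSet
      · intro s t hst
        exact biInter_subset_biInter_left hst
    have h2 : (⋂ s : Finset C, ⋂ c ∈ s, {x | F x = c}ᶜ) = ∅ := by
      ext x
      simp only [mem_iInter, mem_empty_iff_false, iff_false]
      intro h
      exact h {F x} (F x) (by simp) rfl
    rw [h2, measure_empty] at h1
    exact ((tendsto_order.1 h1).2 _ (ENNReal.half_pos hε)).exists
  obtain ⟨s, hs⟩ := hfin
  choose δ hδ h using fun c => cont_set μ _ (hF c) (ε' c) (hε' c).ne'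
  have : ∃ d > 0, ∀ c ∈ s, d ≤ δ c := by
    rcases s.eq_empty_or_nonempty with rfl | hne
    · exact ⟨1, one_pos, by simp⟩
    · exact ⟨s.inf' hne δ, (Finset.lt_inf'_iff hne).2 fun c _ => hδ c, fun c hc => Finset.inf'_le _ hc⟩
  obtain ⟨d, hd, hds⟩ := this
  refine ⟨d, hd, fun P u v hu hv huv => ?_⟩
  have hsub : {ω | F (u ω) ≠ F (v ω)} ⊆ u ⁻¹' (⋂ c ∈ s, {x | F x = c}ᶜ) ∪ ⋃ c ∈ s, {ω | u ω ∈ {x | F x = c} ∧ v ω ∉ {x | F x = c}} := by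
    intro ω hω
    by_cases hc : F (u ω) ∈ s
    · right
      simp only [mem_iUnion]
      exact ⟨F (u ω), hc, rfl, fun h => hω h.symm⟩
    · left
      simp only [mem_preimage, mem_iInter]
      intro c hcs hc'
      have hc' : F (u ω) = c := hc'
      exact hc (hc' ▸ hcs)
  refine (measure_mono hsub).trans ((measure_union_le _ _).trans ?_)
  rw [hu.measure_preimage (Finset.measurableSet_biInter _ fun c _ => (hF c).compl).nullMeasurableSet]
  calc _ ≤ ε / 2 + ∑ c ∈ s, ε' c := by
        refine add_le_add hs.le ((measure_biUnion_finset_le _ _).trans (Finset.sum_le_sum fun c hc => ?_))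
        exact h c P u v hu hv fun ω => (huv ω).trans_le (hds c hc)
    _ ≤ ε / 2 + ε / 2 := by gcongr; exact (ENNReal.sum_le_tsum s).trans hsum.le
    _ = ε := ENNReal.add_halves ε

/-- measure of eventual sets -/
lemma eventual_meas {Ω : Type*} [MeasurableSpace Ω] (P : Measure Ω) [IsProbabilityMeasure P] (S : ℕ → Set Ω)
    (E : Set Ω) (hE : ∀ ω ∈ E, ∃ K, ∀ k, K ≤ k → ω ∈ S k) (r : ℝ) (hr : r < P.real E) :
    ∀ᶠ k in atTop, r < P.real (S k) := by
  have hU : E ⊆ ⋃ K, ⋂ k, ⋂ _ : K ≤ k, S k := fun ω hω => by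
    simpa using hE ω hω
  have ht : Tendsto (fun K => P.real (⋂ k, ⋂ _ : K ≤ k, S k)) atTop (𝓝 (P.real (⋃ K, ⋂ k, ⋂ _ : K ≤ k, S k))) := by
    refine (ENNReal.tendsto_toReal (measure_ne_top _ _)).comp (tendsto_measure_iUnion_atTop ?_)
    intro a b hab
    exact iInter_mono fun k => iInter_mono' fun h => ⟨hab.trans h, subset_rfl⟩
  filter_upwards [(tendsto_order.1 ht).1 r (hr.trans_le (measureReal_mono hU))] with k hk
  exact hk.trans_le (measureReal_mono (iInter₂_subset k le_rfl))

end Thomas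
end
end

section
open MeasureTheory Filter Topology Set
open scoped ENNReal NNReal

noncomputable section
namespace Thomas
variable {m : ℕ}

/-- the pairing -/
def dp (v : QV m) (x : Fin m → ℚ_[2]) : ℚ_[2] := ∑ i, (v i : ℚ_[2]) * x i

lemma dp_add (v w : QV m) (x) : dp (v + w) x = dp v x + dp w x := by simp [dp, add_mul, Finset.sum_add_distrib]
lemma dp_neg (v : QV m) (x) : dp (-v) x = -dp v x := by simp [dp]

def AA (x : XX m) : SG m where
  carrier := {v | ‖dp v fun i => (x i : ℚ_[2])‖ ≤ 1}
  zero_mem' := by simp [dp]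
  add_mem' := fun {v w} hv hw => by
    simp only [mem_ofPred_eq, dp_add] at *
    exact (Padic.nonarchimedean _ _).trans (max_le hv hw)
  neg_mem' := fun {v} hv => by simpa only [mem_ofPred_eq, dp_neg, norm_neg] using hv

lemma mem_AA {x : XX m} {v : QV m} : v ∈ AA x ↔ ‖dp v fun i => (x i : ℚ_[2])‖ ≤ 1 := Iff.rfl

lemma meas_AA (v : QV m) : MeasurableSet {x : XX m | v ∈ AA x} := by
  have : IsClosed {x : XX m | ‖dp v fun i => (x i : ℚ_[2])‖ ≤ 1} := isClosed_le ?_ continuous_const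
  · exact this.measurableSet
  refine continuous_norm.comp (continuous_finsetSum _ fun i _ => ?_)
  exact Continuous.mul (M := ℚ_[2]) continuous_const (continuous_subtype_val.comp (continuous_apply i))

/-- key rigidity: inclusion of the groups forces proportionality -/
lemma dp_prop (x x' : Fin m → ℚ_[2]) (h : ∀ v : QV m, ‖dp v x‖ ≤ 1 → ‖dp v x'‖ ≤ 1) (i j : Fin m) :
    x i * x' j = x j * x' i := by
  by_cases hij : i = j
  · subst hij; ring
  by_contra hne
  have hD : x i * x' j - x j * x' i ≠ 0 := sub_ne_zero.2 hne
  obtain ⟨r, hr⟩ : ∃ r : ℕ, 1 < ‖((2 : ℚ_[2]) ^ r)⁻¹ * (x i * x' j - x j * x' i)‖ := by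
    have h2 : ‖(2 : ℚ_[2])‖ = 2⁻¹ := by have := Padic.norm_p (p := 2); push_cast at this; exact this
    obtain ⟨r, hr⟩ := pow_unbounded_of_one_lt (‖x i * x' j - x j * x' i‖⁻¹) (by norm_num : (1 : ℝ) < 2)
    refine ⟨r, ?_⟩
    rw [norm_mul, norm_inv, norm_pow, h2, inv_pow, inv_inv]
    have := norm_pos_iff.2 hD
    rwa [inv_lt_iff_one_lt_mul₀ this] at hr
  set s := ((2 : ℚ_[2]) ^ r)⁻¹
  obtain ⟨C, hC0, hC⟩ : ∃ C : ℝ, 0 < C ∧ ∀ l ∈ ({i, j} : Set (Fin m)), ‖x l‖ ≤ C ∧ ‖x' l‖ ≤ C := by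
    refine ⟨‖x i‖ + ‖x j‖ + ‖x' i‖ + ‖x' j‖ + 1, by positivity, ?_⟩
    have := norm_nonneg (x i); have := norm_nonneg (x j); have := norm_nonneg (x' i); have := norm_nonneg (x' j)
    rintro l (rfl | rfl) <;> constructor <;> linarith
  obtain ⟨a, ha⟩ := Padic.rat_dense 2 (-(s * x j)) (ε := C⁻¹) (by positivity)
  obtain ⟨b, hb⟩ := Padic.rat_dense 2 (s * x i) (ε := C⁻¹) (by positivity)
  have hdp : ∀ y : Fin m → ℚ_[2], dp (Pi.single i a + Pi.single j b) y = a * y i + b * y j := fun y => by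
    have hs : ∀ (l : Fin m) (q : ℚ), dp (Pi.single l q) y = q * y l := fun l q => by
      rw [dp, Finset.sum_eq_single l]
      · simp
      · intro l' _ hl; simp [hl]
      · simp
    rw [dp_add, hs, hs]
  have hsmall : ∀ (q y z : ℚ_[2]), ‖z - q‖ < C⁻¹ → ‖y‖ ≤ C → ‖(q - z) * y‖ ≤ 1 := fun q y z h1 h2 => by
    rw [norm_mul, norm_sub_rev]
    calc _ ≤ C⁻¹ * C := mul_le_mul h1.le h2 (norm_nonneg _) (by positivity)
      _ = 1 := inv_mul_cancel₀ hC0.ne'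
  have h1 : ‖dp (Pi.single i a + Pi.single j b) x‖ ≤ 1 := by
    have e : dp (Pi.single i a + Pi.single j b) x = ((a : ℚ_[2]) - -(s * x j)) * x i + ((b : ℚ_[2]) - s * x i) * x j := by
      rw [hdp]; ring
    rw [e]
    exact (Padic.nonarchimedean _ _).trans (max_le (hsmall _ _ _ ha (hC i (by simp)).1) (hsmall _ _ _ hb (hC j (by simp)).1))
  have h2 := h _ h1
  have e : s * (x i * x' j - x j * x' i) = dp (Pi.single i a + Pi.single j b) x' +
      -(((a : ℚ_[2]) - -(s * x j)) * x' i + ((b : ℚ_[2]) - s * x i) * x' j) := by rw [hdp]; ring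
  rw [e] at hr
  refine absurd hr (not_lt.2 ((Padic.nonarchimedean _ _).trans (max_le h2 ?_)))
  rw [norm_neg]
  exact (Padic.nonarchimedean _ _).trans (max_le (hsmall _ _ _ ha (hC i (by simp)).2) (hsmall _ _ _ hb (hC j (by simp)).2))

lemma AA_coord {x y : XX m} {i j : Fin m} (h : AA x = AA y) (hj : x j = y j) (hj0 : x j ≠ 0) : x i = y i := by
  have := dp_prop (fun i => (x i : ℚ_[2])) (fun i => (y i : ℚ_[2])) (fun v hv => by
    have : v ∈ AA x := hv
    rw [h] at this; exact this) i j
  have h2 : x i * y j = x j * y i := Subtype.ext (by push_cast; exact this)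
  rw [← hj, mul_comm] at h2
  exact mul_left_cancel₀ hj0 h2

abbrev SLm (m : ℕ) := Matrix.SpecialLinearGroup (Fin m) ℤ

instance actX : MulAction (SLm m) (XX m) where
  smul g x := (g.1.map (Int.castRingHom ℤ_[2])).mulVec x
  one_smul x := by
    change ((1 : SLm m).1.map (Int.castRingHom ℤ_[2])).mulVec x = x
    simp
  mul_smul g h x := by
    change ((g * h).1.map (Int.castRingHom ℤ_[2])).mulVec x =
      (g.1.map (Int.castRingHom ℤ_[2])).mulVec ((h.1.map (Int.castRingHom ℤ_[2])).mulVec x)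
    rw [Matrix.mulVec_mulVec, ← Matrix.map_mul]; rfl

lemma smul_def (g : SLm m) (x : XX m) : g • x = (g.1.map (Int.castRingHom ℤ_[2])).mulVec x := rfl

lemma smul_apply (g : SLm m) (x : XX m) (i : Fin m) : (g • x) i = ∑ j, (g.1 i j : ℤ_[2]) * x j := by
  simp [smul_def, Matrix.mulVec, dotProduct]

lemma smul_cont (g : SLm m) : Continuous fun x : XX m => g • x := by
  refine continuous_pi fun i => ?_
  simp only [smul_apply]
  exact continuous_finsetSum _ fun j _ => continuous_const.mul (continuous_apply j)

lemma smul_mp (g : SLm m) : MeasurePreserving (fun x : XX m => g • x) (hp (XX m)) (hp (XX m)) := by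
  refine hp_map (AddMonoidHom.mk' (fun x : XX m => g • x) fun x y => ?_) (smul_cont g) (MulAction.surjective g)
  simp [smul_def, Matrix.mulVec_add]

lemma AA_smul (g : SLm m) (x : XX m) (v : QV m) : v ∈ AA (g • x) ↔ (g.1.map (Int.castRingHom ℚ)).transpose.mulVec v ∈ AA x := by
  rw [mem_AA, mem_AA]
  have : dp v (fun i => ((g • x) i : ℚ_[2])) = dp ((g.1.map (Int.castRingHom ℚ)).transpose.mulVec v) (fun i => (x i : ℚ_[2])) := by
    have e : ∀ i, (((g • x) i : ℤ_[2]) : ℚ_[2]) = ∑ j, (g.1 i j : ℚ_[2]) * x j := fun i => by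
      rw [smul_apply, PadicInt.coe_sum]; simp
    simp only [dp, e, Matrix.mulVec, dotProduct, Matrix.transpose_apply, Matrix.map_apply]
    push_cast
    simp only [Finset.mul_sum, Finset.sum_mul]
    rw [Finset.sum_comm]
    refine Finset.sum_congr rfl fun i _ => Finset.sum_congr rfl fun j _ => ?_
    simp; ring
  rw [this]

/-- rational transpose of `g` as a unit -/
def trU (g : SLm m) : (MM m)ˣ :=
  ⟨(g.1.map (Int.castRingHom ℚ)).transpose, (g⁻¹.1.map (Int.castRingHom ℚ)).transpose, by
    rw [← Matrix.transpose_mul, ← Matrix.map_mul, ← Matrix.SpecialLinearGroup.coe_mul, inv_mul_cancel]; simp, by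
    rw [← Matrix.transpose_mul, ← Matrix.map_mul, ← Matrix.SpecialLinearGroup.coe_mul, mul_inv_cancel]; simp⟩

lemma matrix_iso {n : ℕ} {H K : SG n} (k : (MM n)ˣ) (h : ∀ v, v ∈ H ↔ k.1.mulVec v ∈ K) : Nonempty (H ≃+ K) := by
  refine ⟨AddEquiv.mk' ⟨fun v => ⟨k.1.mulVec v.1, (h _).1 v.2⟩, fun v => ⟨(k⁻¹).1.mulVec v.1, (h _).2 ?_⟩, fun v => ?_, fun v => ?_⟩ ?_⟩
  · simp
  · ext1; simp
  · ext1; simp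
  · intro v w; ext1; simp [Matrix.mulVec_add]

lemma AA_smul_iso (g : SLm m) (x : XX m) : Nonempty (AA (g • x) ≃+ AA x) := matrix_iso (trU g) (AA_smul g x)

end Thomas
end
end

section
open MeasureTheory Filter Topology Set
open scoped ENNReal NNReal

noncomputable section
namespace Thomas
variable {m : ℕ}

open Classical in
/-- elementary matrices -/
def el (i j : Fin m) (a : ℤ) : SLm m :=
  if h : i ≠ j then Matrix.SpecialLinearGroup.transvection h a else 1

lemma el_val {i j : Fin m} (h : i ≠ j) (a : ℤ) : (el i j a).1 = 1 + Matrix.single i j a := by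
  rw [el, dif_pos h]; rfl

lemma el_zero (i j : Fin m) : el i j 0 = 1 := by
  by_cases h : i ≠ j
  · apply Subtype.ext; rw [el_val h]; simp
  · rw [el, dif_neg h]

lemma el_add {i j : Fin m} (h : i ≠ j) (a b : ℤ) : el i j a * el i j b = el i j (a + b) := by
  apply Subtype.ext
  rw [Matrix.SpecialLinearGroup.coe_mul, el_val h, el_val h, el_val h, add_mul, mul_add, mul_add,
    Matrix.single_mul_single_of_ne _ _ _ _ h.symm, Matrix.single_add]
  simp only [one_mul, mul_one, add_zero]; abel

lemma el_pow {i j : Fin m} (h : i ≠ j) (a : ℤ) (s : ℕ) : el i j (a * (s + 1 : ℕ)) = el i j a * el i j (a * s) := by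
  rw [el_add h]; congr 1; push_cast; ring

lemma el_comm {i j k l : Fin m} (h : i ≠ j) (h' : k ≠ l) (hjk : j ≠ k) (hil : i ≠ l) (a b : ℤ) :
    el i j a * el k l b = el k l b * el i j a := by
  apply Subtype.ext
  rw [Matrix.SpecialLinearGroup.coe_mul, Matrix.SpecialLinearGroup.coe_mul, el_val h, el_val h', add_mul, mul_add, mul_add,
    Matrix.single_mul_single_of_ne _ _ _ _ hjk, add_mul, mul_add, mul_add, Matrix.single_mul_single_of_ne _ _ _ _ hil.symm]
  simp only [one_mul, mul_one, add_zero]; abel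

lemma el_st {i j l : Fin m} (h : i ≠ j) (h' : j ≠ l) (hil : i ≠ l) (a b : ℤ) :
    el i j a * el j l b = el i l (a * b) * el j l b * el i j a := by
  apply Subtype.ext
  simp only [Matrix.SpecialLinearGroup.coe_mul, el_val h, el_val h', el_val hil, add_mul, mul_add,
    Matrix.single_mul_single_same, Matrix.single_mul_single_of_ne _ _ _ _ hil.symm,
    Matrix.single_mul_single_of_ne _ _ _ _ h'.symm, one_mul, mul_one, add_zero]
  abel

lemma el_smul {i j : Fin m} (h : i ≠ j) (a : ℤ) (x : XX m) : el i j a • x = x + Pi.single i ((a : ℤ_[2]) * x j) := by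
  ext1 k
  rw [smul_apply, el_val h]
  simp only [Matrix.add_apply, Int.cast_add, add_mul, Finset.sum_add_distrib, Pi.add_apply]
  congr 1
  · simp [Matrix.one_apply]
  · by_cases hk : k = i
    · subst hk; simp [Matrix.single_apply]
    · simp [hk, Ne.symm hk]

lemma exists_third (hm : 3 ≤ m) (i j : Fin m) : ∃ l, l ≠ i ∧ l ≠ j := by
  by_contra! h
  have : (Finset.univ : Finset (Fin m)) ⊆ {i, j} := fun l _ => by
    simp only [Finset.mem_insert, Finset.mem_singleton]
    by_cases hl : l = i
    · exact Or.inl hl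
    · exact Or.inr (h l hl)
  have h2 := Finset.card_le_card this
  have h3 := Finset.card_le_two (a := i) (b := j)
  simp at h2; omega

theorem relT_el (hm : 3 ≤ m) (ε : ℝ) (hε : 0 < ε) : ∃ δ > 0, ∀ N : ℤ, 3 ≤ N → ∃ R : ℕ, ∀ {Ω : Type} [MeasurableSpace Ω]
    (P : Measure Ω) [IsProbabilityMeasure P] [MulAction (SLm m) Ω] (_ : ∀ g : SLm m, Measurable fun ω : Ω => g • ω)
    (S : SLm m → Set Ω) (_ : ∀ g, MeasurableSet (S g)) (_ : S 1 = univ)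
    (_ : ∀ g k ω, ω ∈ S g → g • ω ∈ S k → ω ∈ S (k * g)) (_ : ∀ g ω, ω ∈ S g → g • ω ∈ S g⁻¹) (M : ℤ)
    (_ : ∀ i j : Fin m, i ≠ j → ∀ a : ℤ, MeasurePreserving (fun ω : Ω => el i j (M * a) • ω) P P)
    (_ : ∀ i j : Fin m, i ≠ j → MeasurePreserving (fun ω : Ω => el i j N • ω) P P)
    (_ : ∀ i j : Fin m, i ≠ j → ∀ a : ℕ, a < R → 1 - δ ≤ P.real (S (el i j (M * a))))
    (_ : ∀ i j : Fin m, i ≠ j → 1 - δ ≤ P.real (S (el i j N))), ∀ i j : Fin m, i ≠ j → ∀ a : ℤ, 1 - ε ≤ P.real (S (el i j (M * a))) := by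
  obtain ⟨δ, hδ, H⟩ := relT ε hε
  refine ⟨δ, hδ, fun N hN => ?_⟩
  obtain ⟨R, H⟩ := H N hN
  refine ⟨R, ?_⟩
  intro Ω _ P _ _ hms S hmS S1 Smul Sinv M mp mpN hR hN i j hij a
  obtain ⟨l, hli, hlj⟩ := exists_third hm i j
  let u : Z2 → SLm m := fun v => el i j (M * v 0) * el l j (M * v 1)
  let h : Fin 2 → SLm m := ![el i l N, el l i N]
  have hu0 : ∀ b : ℤ, u (Pi.single 0 b) = el i j (M * b) := fun b => by simp [u, el_zero]
  have hu1 : ∀ b : ℤ, u (Pi.single 1 b) = el l j (M * b) := fun b => by simp [u, el_zero]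
  have c1 : ∀ a b, el l j a * el i j b = el i j b * el l j a := fun a b => el_comm hlj hij hij.symm hlj a b
  have := H (Ω := Ω) (G := SLm m) P hms S hmS S1 Smul Sinv u (fun a b => by
      simp only [u, Pi.add_apply, mul_add]
      rw [← el_add hij, ← el_add hlj]
      simp only [mul_assoc]; congr 1; simp only [← mul_assoc]; rw [c1]) h (by
      intro p q hpq v
      fin_cases p <;> fin_cases q
      · exact absurd rfl hpq
      · have e1 : el i l N * el i j (M * v 0) = el i j (M * v 0) * el i l N := el_comm hli.symm hij hli hij _ _
        have e2 := el_st hli.symm hlj hij N (M * v 1)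
        simp only [u, h, Fin.zero_eta, Fin.mk_one, Matrix.cons_val_zero, Pi.add_apply, Pi.single_eq_same]
        rw [← mul_assoc, e1, mul_assoc, e2, mul_add, ← el_add hij]
        simp only [Pi.single_eq_of_ne (one_ne_zero : (1 : Fin 2) ≠ 0), add_zero, mul_assoc]
        rw [mul_left_comm N M]
      · have e1 : el l i N * el l j (M * v 1) = el l j (M * v 1) * el l i N := el_comm hli hlj hli.symm hlj _ _
        have e2 := el_st hli hij hlj N (M * v 0)
        simp only [u, h, Fin.zero_eta, Fin.mk_one, Matrix.cons_val_one, Matrix.cons_val_zero, Pi.add_apply, Pi.single_eq_same]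
        rw [← mul_assoc, e2, mul_assoc, e1]
        simp only [Pi.single_eq_of_ne (zero_ne_one : (0 : Fin 2) ≠ 1), add_zero]
        have e3 : M * (v 1 + N * v 0) = N * (M * v 0) + M * v 1 := by ring
        rw [e3, ← el_add hlj, c1]
        simp only [mul_assoc]
      · exact absurd rfl hpq) (fun v => by
      have := (mp i j hij (v 0)).comp (mp l j hlj (v 1))
      simp only [u, mul_smul]
      exact this) (fun p => by
      fin_cases p
      · exact mpN i l hli.symm
      · exact mpN l i hli) (fun p b hb => by
      fin_cases p
      · change 1 - δ ≤ P.real (S (u (Pi.single 0 _)))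
        rw [hu0]; exact hR i j hij b hb
      · change 1 - δ ≤ P.real (S (u (Pi.single 1 _)))
        rw [hu1]; exact hR l j hlj b hb) (fun p => by
      fin_cases p
      · exact hN i l hli.symm
      · exact hN l i hli) (Pi.single 0 a)
  rwa [hu0] at this

end Thomas
end
end

section
open MeasureTheory Filter Topology Set
open scoped ENNReal NNReal

noncomputable section
namespace Thomas
variable {m : ℕ}

/-- shear -/
def shx (i j : Fin m) (t : ℤ_[2]) : XX m →+ XX m where
  toFun x := x + Pi.single i (t * x j)
  map_zero' := by simp
  map_add' x y := by simp only [Pi.add_apply, mul_add, Pi.single_add]; abel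

lemma shx_apply (i j : Fin m) (t : ℤ_[2]) (x : XX m) : shx i j t x = x + Pi.single i (t * x j) := rfl

lemma shx_cont (i j : Fin m) (t : ℤ_[2]) : Continuous (shx i j t) := by
  change Continuous fun x : XX m => x + Pi.single i (t * x j)
  exact continuous_id.add ((continuous_single i).comp (continuous_const.mul (continuous_apply j)))

lemma shx_mp {i j : Fin m} (h : i ≠ j) (t : ℤ_[2]) : MeasurePreserving (shx i j t) (hp (XX m)) (hp (XX m)) := by
  refine hp_map _ (shx_cont i j t) fun y => ⟨shx i j (-t) y, ?_⟩
  rw [shx_apply, shx_apply]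
  simp only [Pi.add_apply, Pi.single_eq_of_ne h.symm, add_zero]
  rw [add_assoc, ← Pi.single_add]; simp

/-- dilation -/
def sc (k : ℕ) (c z : XX m) : XX m := c + (2 : ℤ_[2]) ^ k • z

lemma sc_cont (k : ℕ) : Continuous fun p : XX m × XX m => sc k p.1 p.2 := by
  unfold sc; fun_prop

lemma sc_cont' (k : ℕ) (c : XX m) : Continuous (sc k c) :=
  (sc_cont k).comp (Continuous.prodMk_right c)

/-- uniform measure on a coset -/
def muc (k : ℕ) (c : XX m) : Measure (XX m) := (hp (XX m)).map (sc k c)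

lemma sc_mp (k : ℕ) (c : XX m) : MeasurePreserving (sc k c) (hp (XX m)) (muc k c) :=
  ⟨(sc_cont' k c).measurable, rfl⟩

instance (k : ℕ) (c : XX m) : IsProbabilityMeasure (muc k c) :=
  Measure.isProbabilityMeasure_map (sc_cont' k c).measurable.aemeasurable

lemma muc_sh (k : ℕ) (c : XX m) {i j : Fin m} (h : i ≠ j) (t : ℤ_[2]) :
    MeasurePreserving (shx i j (2 ^ k * t)) (muc k c) (muc k c) := by
  have e : ∀ z, shx i j (2 ^ k * t) (sc k c z) = sc k c (shx i j (2 ^ k * t) z + Pi.single i (t * c j)) := by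
    intro z
    simp only [shx_apply, sc, Pi.add_apply, Pi.smul_apply, smul_eq_mul, smul_add, mul_add, Pi.single_add]
    rw [← Pi.single_smul, ← Pi.single_smul]
    simp only [smul_eq_mul, mul_assoc]
    rw [mul_left_comm t]; abel
  have hψ := (hp_add (Pi.single i (t * c j))).comp (shx_mp h (2 ^ k * t))
  refine ⟨(shx_cont _ _ _).measurable, ?_⟩
  have h1 := ((sc_mp k c).comp hψ).map_eq
  rw [muc, Measure.map_map (shx_cont _ _ _).measurable (sc_cont' k c).measurable]
  rw [show ⇑(shx i j (2 ^ k * t)) ∘ sc k c = sc k c ∘ ((fun x => x + Pi.single i (t * c j)) ∘ (shx i j (2 ^ k * t))) from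
    funext e, h1]; rfl

lemma muc_el (k : ℕ) (c : XX m) {i j : Fin m} (h : i ≠ j) (a : ℤ) :
    MeasurePreserving (fun x => el i j (2 ^ k * a) • x) (muc k c) (muc k c) := by
  have := muc_sh k c h a
  convert this using 2 with x
  rw [el_smul h, shx_apply]; push_cast; rfl

lemma smul_sc (g : SLm m) (k : ℕ) (x z : XX m) : g • sc k x z = sc k (g • x) (g • z) := by
  ext1 i
  simp only [smul_apply, sc, Pi.add_apply, Pi.smul_apply, smul_eq_mul, mul_add, Finset.sum_add_distrib, Finset.mul_sum]
  congr 1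
  exact Finset.sum_congr rfl fun l _ => mul_left_comm _ _ _

lemma sc_mp2 (k : ℕ) : MeasurePreserving (fun p : XX m × XX m => sc k p.1 p.2) ((hp (XX m)).prod (hp (XX m))) (hp (XX m)) := by
  rw [← hp_prod]
  refine hp_map (G := XX m × XX m) ⟨⟨fun p => sc k p.1 p.2, by simp [sc]⟩, fun p q => by
    simp only [sc, Prod.fst_add, Prod.snd_add, smul_add]; abel⟩ (sc_cont k) fun y => ⟨(y, 0), by simp [sc]⟩

lemma sc_mp3 (k : ℕ) : MeasurePreserving (fun p : XX m × (XX m × XX m) => (sc k p.1 p.2.1, p.2.2 - p.2.1))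
    ((hp (XX m)).prod ((hp (XX m)).prod (hp (XX m)))) ((hp (XX m)).prod (hp (XX m))) := by
  rw [← hp_prod, ← hp_prod]
  refine hp_map (G := XX m × (XX m × XX m)) ⟨⟨fun p => (sc k p.1 p.2.1, p.2.2 - p.2.1), by simp [sc]⟩, fun p q => by
    simp only [sc, Prod.fst_add, Prod.snd_add, smul_add, Prod.mk_add_mk, Prod.mk.injEq]; constructor <;> abel⟩
    (((sc_cont k).comp (by fun_prop : Continuous fun p : XX m × (XX m × XX m) => (p.1, p.2.1))).prodMk (by fun_prop))
    fun y => ⟨(y.1, 0, y.2), by simp [sc]⟩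

lemma sc_dist (k : ℕ) (x z : XX m) : dist x (sc k x z) ≤ (2 : ℝ)⁻¹ ^ k := by
  rw [dist_pi_le_iff (by positivity)]
  intro i
  rw [sc, Pi.add_apply, dist_eq_norm, sub_add_cancel_left, norm_neg, Pi.smul_apply, smul_eq_mul, norm_mul, norm_pow]
  have h2 : ‖(2 : ℤ_[2])‖ = 2⁻¹ := by simpa using PadicInt.norm_p (p := 2)
  rw [h2]
  exact mul_le_of_le_one_right (by positivity) (PadicInt.norm_le_one _)

end Thomas
end
end

section
open MeasureTheory Filter Topology Set
open scoped ENNReal NNReal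

noncomputable section
namespace Thomas
variable {m : ℕ}

lemma meas_agree {Y C : Type*} [MeasurableSpace Y] [Countable C] {T T' : Y → C} (hT : ∀ c, MeasurableSet {x | T x = c})
    (hT' : ∀ c, MeasurableSet {x | T' x = c}) : MeasurableSet {x | T x = T' x} := by
  have : {x | T x = T' x} = ⋃ c, {x | T x = c} ∩ {x | T' x = c} := by
    ext x; simp [eq_comm]
  rw [this]
  exact MeasurableSet.iUnion fun c => (hT c).inter (hT' c)

/-- disagreement measure -/
def dis {C : Type} (T : SLm m → XX m → C) (ν : Measure (XX m)) (g : SLm m) : ℝ≥0∞ :=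
  (ν.prod ν) {p | T g p.1 = T g p.2}ᶜ

section
variable {C : Type} [Countable C] (T : SLm m → XX m → C) (hT : ∀ g c, MeasurableSet {x | T g x = c})

lemma phase_ev (hT : ∀ g c, MeasurableSet {x | T g x = c}) (δ : ℝ) (hδ : 0 < δ) (g : SLm m) :
    ∀ᶠ k in atTop, 1 - δ ≤ ((hp (XX m)).prod (hp (XX m))).real {p | T g p.1 = T g (sc k p.1 p.2)} := by
  obtain ⟨r, hr, H⟩ := cont_fun (hp (XX m)) (T g) (hT g) (ENNReal.ofReal δ) (by simpa using hδ)
  have h0 : ∀ᶠ k : ℕ in atTop, (2 : ℝ)⁻¹ ^ k < r :=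
    (tendsto_pow_atTop_nhds_zero_of_lt_one (by norm_num) (by norm_num)).eventually_lt_const hr
  filter_upwards [h0] with k hk
  have := H ((hp (XX m)).prod (hp (XX m))) Prod.fst (fun p => sc k p.1 p.2) measurePreserving_fst (sc_mp2 k)
    (fun p => (sc_dist k p.1 p.2).trans_lt hk)
  have hms : MeasurableSet {p : XX m × XX m | T g p.1 = T g (sc k p.1 p.2)} :=
    meas_agree (fun c => measurable_fst (hT g c)) (fun c => (sc_cont k).measurable (hT g c))
  have h2 := prob_compl_eq_one_sub (μ := (hp (XX m)).prod (hp (XX m))) hms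
  have h3 : ((hp (XX m)).prod (hp (XX m))).real {p | T g p.1 = T g (sc k p.1 p.2)}ᶜ ≤ δ :=
    ENNReal.toReal_le_of_le_ofReal hδ.le this
  rw [probReal_compl_eq_one_sub hms] at h3
  linarith

lemma phase_a (hm : 3 ≤ m) (hT : ∀ g c, MeasurableSet {x | T g x = c}) (h1 : ∀ x y, T 1 x = T 1 y)
    (hmul : ∀ g k x y, T g x = T g y → T k (g • x) = T k (g • y) → T (k * g) x = T (k * g) y)
    (hinv : ∀ g x y, T g x = T g y → T g⁻¹ (g • x) = T g⁻¹ (g • y)) (ε : ℝ) (hε : 0 < ε) :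
    ∃ k ≥ 2, ∀ i j : Fin m, i ≠ j → ∀ a : ℤ,
      1 - ε ≤ ((hp (XX m)).prod (hp (XX m))).real {p | T (el i j a) p.1 = T (el i j a) (sc k p.1 p.2)} := by
  obtain ⟨δ, hδ, H⟩ := relT_el hm ε hε
  obtain ⟨R, H⟩ := H 3 le_rfl
  have ev1 : ∀ᶠ k in atTop, ∀ (i j : Fin m) (a : Fin R), 1 - δ ≤ ((hp (XX m)).prod (hp (XX m))).real
      {p | T (el i j (a.1 : ℤ)) p.1 = T (el i j (a.1 : ℤ)) (sc k p.1 p.2)} :=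
    eventually_all.2 fun i => eventually_all.2 fun j => eventually_all.2 fun a => phase_ev T hT δ hδ _
  have ev2 : ∀ᶠ k in atTop, ∀ (i j : Fin m), 1 - δ ≤ ((hp (XX m)).prod (hp (XX m))).real
      {p | T (el i j 3) p.1 = T (el i j 3) (sc k p.1 p.2)} :=
    eventually_all.2 fun i => eventually_all.2 fun j => phase_ev T hT δ hδ _
  obtain ⟨k, hk1, hk2, hk⟩ := (ev1.and (ev2.and (eventually_ge_atTop 2))).exists
  refine ⟨k, hk, fun i j hij a => ?_⟩
  have mp : ∀ g : SLm m, MeasurePreserving (fun p : XX m × XX m => g • p) ((hp (XX m)).prod (hp (XX m)))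
    ((hp (XX m)).prod (hp (XX m))) := fun g => (smul_mp g).prod (smul_mp g)
  have := H ((hp (XX m)).prod (hp (XX m))) (fun g => (mp g).measurable) (fun g => {p | T g p.1 = T g (sc k p.1 p.2)})
    (fun g => meas_agree (fun c => measurable_fst (hT g c)) (fun c => (sc_cont k).measurable (hT g c)))
    (eq_univ_of_forall fun p => h1 _ _)
    (fun g l p hp hp' => hmul _ _ _ _ hp (by
      have : T l (g • p.1) = T l (sc k (g • p.1) (g • p.2)) := hp'
      rwa [← smul_sc] at this))
    (fun g p hp => by
      have := hinv _ _ _ hp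
      rwa [smul_sc] at this) 1 (fun i j _ a => mp _) (fun i j _ => mp _)
    (fun i j _ a ha => by simpa using hk1 i j ⟨a, ha⟩) (fun i j _ => hk2 i j) i j hij a
  simpa using this

lemma dis_lint (hT : ∀ g c, MeasurableSet {x | T g x = c}) (k : ℕ) (g : SLm m) :
    (Measurable fun c => dis T (muc k c) g) ∧ ∫⁻ c, dis T (muc k c) g ∂(hp (XX m)) =
      ((hp (XX m)).prod (hp (XX m))) {p | T g p.1 = T g (sc k p.1 p.2)}ᶜ := by
  have hm1 : Measurable fun p : XX m × (XX m × XX m) => sc k p.1 p.2.1 :=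
    (sc_cont k).measurable.comp (by fun_prop : Measurable fun p : XX m × (XX m × XX m) => (p.1, p.2.1))
  have hm2 : Measurable fun p : XX m × (XX m × XX m) => sc k p.1 p.2.2 :=
    (sc_cont k).measurable.comp (by fun_prop : Measurable fun p : XX m × (XX m × XX m) => (p.1, p.2.2))
  have hms : MeasurableSet {p : XX m × (XX m × XX m) | T g (sc k p.1 p.2.1) = T g (sc k p.1 p.2.2)}ᶜ :=
    (meas_agree (fun c => hm1 (hT g c)) (fun c => hm2 (hT g c))).compl
  have hdg : MeasurableSet {p : XX m × XX m | T g p.1 = T g p.2}ᶜ :=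
    (meas_agree (fun c => measurable_fst (hT g c)) (fun c => measurable_snd (hT g c))).compl
  have hms' : MeasurableSet {p : XX m × XX m | T g p.1 = T g (sc k p.1 p.2)}ᶜ :=
    (meas_agree (fun c => measurable_fst (hT g c)) (fun c => (sc_cont k).measurable (hT g c))).compl
  have e : ∀ c, dis T (muc k c) g = ((hp (XX m)).prod (hp (XX m)))
      (Prod.mk c ⁻¹' {p : XX m × (XX m × XX m) | T g (sc k p.1 p.2.1) = T g (sc k p.1 p.2.2)}ᶜ) := fun c => by
    rw [dis, ← ((sc_mp k c).prod (sc_mp k c)).measure_preimage hdg.nullMeasurableSet]; rfl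
  simp only [e]
  refine ⟨measurable_measure_prodMk_left hms, ?_⟩
  rw [← Measure.prod_apply hms, ← (sc_mp3 k).measure_preimage hms'.nullMeasurableSet]
  congr 1
  ext p
  simp only [mem_compl_iff, mem_ofPred_eq, mem_preimage]
  rw [show sc k (sc k p.1 p.2.1) (p.2.2 - p.2.1) = sc k p.1 p.2.2 by simp only [sc, smul_sub]; abel]

end
end Thomas
end
end

section
open MeasureTheory Filter Topology Set
open scoped ENNReal NNReal

noncomputable section
namespace Thomas
variable {m : ℕ}

lemma avg_bound (d : ℕ → ℝ) (h0 : ∀ b, 0 ≤ d b) (htri : ∀ t s, d t ≤ d (t + s) + d s) (η : ℝ) (hη : 0 < η)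
    (hf : ∃ᶠ r : ℕ in atTop, ∑ b ∈ Finset.range (r + 1), d b ≤ (r + 1) * η) (t : ℕ) : d t ≤ 4 * η := by
  obtain ⟨r, hr, hrt⟩ := (hf.and_eventually (eventually_ge_atTop (2 * t))).exists
  obtain ⟨q, hq⟩ : ∃ q, r + 1 = t + q := ⟨r + 1 - t, by omega⟩
  have hqt : t ≤ q := by omega
  have h1 : (q : ℝ) * d t ≤ ∑ s ∈ Finset.range q, d (t + s) + ∑ s ∈ Finset.range q, d s := by
    rw [← Finset.sum_add_distrib]
    calc (q : ℝ) * d t = ∑ s ∈ Finset.range q, d t := by simp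
      _ ≤ _ := Finset.sum_le_sum fun s _ => htri t s
  have h2 : ∑ s ∈ Finset.range q, d (t + s) ≤ ∑ b ∈ Finset.range (r + 1), d b := by
    rw [hq, Finset.sum_range_add]
    linarith [Finset.sum_nonneg (s := Finset.range t) (fun i _ => h0 i)]
  have h3 : ∑ s ∈ Finset.range q, d s ≤ ∑ b ∈ Finset.range (r + 1), d b :=
    Finset.sum_le_sum_of_subset_of_nonneg (Finset.range_mono (by omega)) fun i _ _ => h0 i
  have hq' : (r : ℝ) + 1 = t + q := by exact_mod_cast hq
  have hqt' : (t : ℝ) ≤ q := by exact_mod_cast hqt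
  have hq0 : (0 : ℝ) < q := by
    have : 0 < q := by omega
    exact_mod_cast this
  rw [hq'] at hr
  have : (q : ℝ) * d t ≤ q * (4 * η) := by nlinarith
  exact le_of_mul_le_mul_left this hq0

variable {C : Type} [Countable C] (T : SLm m → XX m → C)

lemma dis_tri (hT : ∀ g c, MeasurableSet {x | T g x = c})
    (hmul : ∀ g k x y, T g x = T g y → T k (g • x) = T k (g • y) → T (k * g) x = T (k * g) y)
    (hinv : ∀ g x y, T g x = T g y → T g⁻¹ (g • x) = T g⁻¹ (g • y)) (ν : Measure (XX m)) [IsProbabilityMeasure ν]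
    (g h : SLm m) (hg : MeasurePreserving (fun x => h • x) ν ν) : dis T ν g ≤ dis T ν (g * h) + dis T ν h := by
  have hdg : ∀ g, MeasurableSet {p : XX m × XX m | T g p.1 = T g p.2}ᶜ := fun g =>
    (meas_agree (fun c => measurable_fst (hT g c)) (fun c => measurable_snd (hT g c))).compl
  have hs : Prod.map (fun x : XX m => h • x) (fun x : XX m => h • x) ⁻¹' {p : XX m × XX m | T g p.1 = T g p.2}ᶜ ⊆
      {p : XX m × XX m | T (g * h) p.1 = T (g * h) p.2}ᶜ ∪ {p : XX m × XX m | T h p.1 = T h p.2}ᶜ := by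
    intro p hp
    by_contra hc
    simp only [mem_union, mem_compl_iff, mem_ofPred_eq, not_or, not_not] at hc
    apply hp
    have h3 := hmul h⁻¹ (g * h) (h • p.1) (h • p.2) (hinv _ _ _ hc.2) (by simpa using hc.1)
    simpa using h3
  unfold dis
  rw [← (hg.prod hg).measure_preimage (hdg g).nullMeasurableSet]
  exact (measure_mono hs).trans (measure_union_le _ _)

theorem phase1 (hm : 3 ≤ m) (hT : ∀ g c, MeasurableSet {x | T g x = c}) (h1 : ∀ x y, T 1 x = T 1 y)
    (hmul : ∀ g k x y, T g x = T g y → T k (g • x) = T k (g • y) → T (k * g) x = T (k * g) y)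
    (hinv : ∀ g x y, T g x = T g y → T g⁻¹ (g • x) = T g⁻¹ (g • y)) (η : ℝ) (hη : 0 < η) :
    ∃ k ≥ 2, ∃ c : XX m, ∃ E : Fin m → Fin m → ℕ → Set (XX m), (∀ i j s, MeasurableSet (E i j s)) ∧
      (∀ i j s, i ≠ j → 1 - η ≤ (muc k c).real (E i j s)) ∧ ∀ i j s, ∀ x ∈ E i j s, ∀ y ∈ E i j s,
        T (el i j (2 ^ k * (s : ℕ))) x = T (el i j (2 ^ k * (s : ℕ))) y := by
  set ε : ℝ := η / (4 * (m * m + 1)) with hε_def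
  have hε : 0 < ε := by positivity
  obtain ⟨k, hk, H⟩ := phase_a T hm hT h1 hmul hinv ε hε
  have hI : ∀ i j (a : ℤ), ∫⁻ c, dis T (muc k c) (el i j a) ∂(hp (XX m)) ≤ ENNReal.ofReal ε := by
    intro i j a
    rw [(dis_lint T hT k _).2]
    by_cases hij : i = j
    · have : el i j a = 1 := by rw [el, dif_neg (by simpa using hij)]
      rw [this]
      have : {p : XX m × XX m | T 1 p.1 = T 1 (sc k p.1 p.2)} = univ := eq_univ_of_forall fun p => h1 _ _
      rw [this]; simp
    · have h2 := H i j hij a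
      have hms : MeasurableSet {p : XX m × XX m | T (el i j a) p.1 = T (el i j a) (sc k p.1 p.2)} :=
        meas_agree (fun c => measurable_fst (hT _ c)) (fun c => (sc_cont k).measurable (hT _ c))
      rw [← ENNReal.ofReal_toReal (measure_ne_top _ (_ᶜ))]
      apply ENNReal.ofReal_le_ofReal
      change Measure.real _ _ ≤ _
      rw [probReal_compl_eq_one_sub hms]; linarith
  let h : ℕ → XX m → ℝ≥0∞ := fun r c => ((r : ℝ≥0∞) + 1)⁻¹ * ∑ i, ∑ j, ∑ t ∈ Finset.range (r + 1), dis T (muc k c) (el i j (2 ^ k * (t : ℕ)))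
  have hmd : ∀ g, Measurable fun c => dis T (muc k c) g := fun g => (dis_lint T hT k g).1
  have hhm : ∀ r, Measurable (h r) := fun r => Measurable.const_mul (Finset.measurable_fun_sum _ fun i _ =>
    Finset.measurable_fun_sum _ fun j _ => Finset.measurable_fun_sum _ fun t _ => hmd _) _
  have hhI : ∀ r, ∫⁻ c, h r c ∂(hp (XX m)) ≤ m * m * ENNReal.ofReal ε := by
    intro r
    simp only [h]
    rw [lintegral_const_mul _ (Finset.measurable_fun_sum _ fun i _ =>
      Finset.measurable_fun_sum _ fun j _ => Finset.measurable_fun_sum _ fun t _ => hmd _)]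
    rw [lintegral_finsetSum _ (fun i _ => Finset.measurable_fun_sum _ fun j _ => Finset.measurable_fun_sum _ fun t _ => hmd _)]
    have : ∀ i : Fin m, ∫⁻ c, ∑ j, ∑ t ∈ Finset.range (r + 1), dis T (muc k c) (el i j (2 ^ k * (t : ℕ))) ∂(hp (XX m)) ≤
        m * ((r + 1) * ENNReal.ofReal ε) := by
      intro i
      rw [lintegral_finsetSum _ (fun j _ => Finset.measurable_fun_sum _ fun t _ => hmd _)]
      calc _ ≤ ∑ j : Fin m, (((r : ℝ≥0∞) + 1) * ENNReal.ofReal ε) := Finset.sum_le_sum fun j _ => by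
            rw [lintegral_finsetSum _ (fun t _ => hmd _)]
            calc _ ≤ ∑ t ∈ Finset.range (r + 1), ENNReal.ofReal ε := Finset.sum_le_sum fun t _ => hI _ _ _
              _ = _ := by simp
        _ = _ := by simp
    calc _ ≤ ((r : ℝ≥0∞) + 1)⁻¹ * ∑ i : Fin m, m * ((r + 1) * ENNReal.ofReal ε) := by gcongr with i _; exact this i
      _ = ((r : ℝ≥0∞) + 1)⁻¹ * (r + 1) * (m * m * ENNReal.ofReal ε) := by simp; ring
      _ = _ := by rw [ENNReal.inv_mul_cancel (by simp) (by simp), one_mul]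
  have hlim : ∫⁻ c, liminf (fun r => h r c) atTop ∂(hp (XX m)) ≤ m * m * ENNReal.ofReal ε :=
    (lintegral_liminf_le hhm).trans (liminf_le_of_frequently_le' (Frequently.of_forall hhI))
  obtain ⟨c, hc⟩ := exists_le_lintegral (μ := hp (XX m)) (f := fun c => liminf (fun r => h r c) atTop)
    (Measurable.liminf hhm).aemeasurable
  have hlt : (m * m * ENNReal.ofReal ε : ℝ≥0∞) < ENNReal.ofReal (η / 4) := by
    rw [← ENNReal.ofReal_natCast, ← ENNReal.ofReal_mul (by positivity), ← ENNReal.ofReal_mul (by positivity)]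
    apply (ENNReal.ofReal_lt_ofReal_iff (by positivity)).2
    rw [hε_def, mul_div_assoc', div_lt_div_iff₀ (by positivity) (by norm_num)]
    nlinarith
  have hfr : ∃ᶠ r in atTop, h r c < ENNReal.ofReal (η / 4) :=
    frequently_lt_of_liminf_lt (by isBoundedDefault) ((hc.trans hlim).trans_lt hlt)
  have hne : ∀ g, dis T (muc k c) g ≠ ∞ := fun g => measure_ne_top _ _
  have hd : ∀ i j, i ≠ j → ∀ t : ℕ, dis T (muc k c) (el i j (2 ^ k * (t : ℕ))) ≤ ENNReal.ofReal η := by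
    intro i j hij t
    have := avg_bound (fun t => (dis T (muc k c) (el i j (2 ^ k * (t : ℕ)))).toReal) (fun _ => ENNReal.toReal_nonneg)
      (fun t s => by
        rw [← ENNReal.toReal_add (hne _) (hne _)]
        apply ENNReal.toReal_mono (ENNReal.add_ne_top.2 ⟨hne _, hne _⟩)
        have := dis_tri T hT hmul hinv (muc k c) (el i j (2 ^ k * (t : ℕ))) (el i j (2 ^ k * (s : ℕ))) (muc_el k c hij _)
        rwa [el_add hij, ← mul_add, ← Nat.cast_add] at this) (η / 4) (by positivity)
      (hfr.mono fun r hr => by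
        rw [← ENNReal.toReal_sum (fun _ _ => hne _)]
        apply ENNReal.toReal_le_of_le_ofReal (by positivity)
        rw [ENNReal.ofReal_mul (by positivity), show ENNReal.ofReal ((r : ℝ) + 1) = (r : ℝ≥0∞) + 1 by
          rw [ENNReal.ofReal_add (by positivity) (by positivity)]; simp]
        have h5 : ∑ t ∈ Finset.range (r + 1), dis T (muc k c) (el i j (2 ^ k * (t : ℕ))) ≤
          ∑ i, ∑ j, ∑ t ∈ Finset.range (r + 1), dis T (muc k c) (el i j (2 ^ k * (t : ℕ))) :=
          (Finset.single_le_sum (f := fun j => ∑ t ∈ Finset.range (r + 1), dis T (muc k c) (el i j (2 ^ k * (t : ℕ))))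
            (fun _ _ => zero_le) (Finset.mem_univ j)).trans
          (Finset.single_le_sum (f := fun i => ∑ j, ∑ t ∈ Finset.range (r + 1), dis T (muc k c) (el i j (2 ^ k * (t : ℕ))))
            (fun _ _ => zero_le) (Finset.mem_univ i))
        refine h5.trans ?_
        have h6 := mul_le_mul_right hr.le ((r : ℝ≥0∞) + 1)
        simp only [h] at h6
        rwa [← mul_assoc, ENNReal.mul_inv_cancel (by simp) (by simp), one_mul] at h6) t
    rw [← ENNReal.ofReal_toReal (hne _)]
    apply ENNReal.ofReal_le_ofReal
    linarith
  have hE : ∀ i j (s : ℕ), ∃ a, i ≠ j → 1 - η ≤ (muc k c).real {y | T (el i j (2 ^ k * (s : ℕ))) a = T (el i j (2 ^ k * (s : ℕ))) y} := by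
    intro i j s
    by_cases hij : i = j
    · exact ⟨0, fun h => absurd hij h⟩
    have hms : ∀ g a, MeasurableSet {y | T g a = T g y} := fun g a => by
      simpa only [eq_comm] using hT g (T g a)
    have hdg : MeasurableSet {p : XX m × XX m | T (el i j (2 ^ k * (s : ℕ))) p.1 = T (el i j (2 ^ k * (s : ℕ))) p.2}ᶜ :=
      (meas_agree (fun c => measurable_fst (hT _ c)) (fun c => measurable_snd (hT _ c))).compl
    have h2 := hd i j hij s
    rw [dis, Measure.prod_apply hdg] at h2
    obtain ⟨a, ha⟩ := exists_le_lintegral (μ := muc k c) (measurable_measure_prodMk_left (ν := muc k c) hdg).aemeasurable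
    refine ⟨a, fun _ => ?_⟩
    have h3 := ENNReal.toReal_le_of_le_ofReal hη.le (ha.trans h2)
    change (muc k c).real {y | T (el i j (2 ^ k * (s : ℕ))) a = T (el i j (2 ^ k * (s : ℕ))) y}ᶜ ≤ η at h3
    rw [probReal_compl_eq_one_sub (hms _ _)] at h3
    linarith
  choose a ha using hE
  exact ⟨k, hk, c, fun i j s => {y | T (el i j (2 ^ k * (s : ℕ))) (a i j s) = T (el i j (2 ^ k * (s : ℕ))) y},
    fun i j s => by simpa only [eq_comm] using hT (el i j (2 ^ k * (s : ℕ))) (T (el i j (2 ^ k * (s : ℕ))) (a i j s)), ha, fun i j s x hx y hy => hx.symm.trans hy⟩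

end Thomas
end
end

section
open MeasureTheory Filter Topology Set
open scoped ENNReal NNReal

noncomputable section
namespace Thomas
variable {m n : ℕ}

/-- large sets -/
def Big {Y : Type*} [MeasurableSpace Y] (ν : Measure Y) (η : ℝ) (E : Set Y) : Prop := MeasurableSet E ∧ 1 - η ≤ ν.real E

section
variable {Y : Type*} [MeasurableSpace Y] {ν : Measure Y} [IsProbabilityMeasure ν]

lemma Big.inter {η η' : ℝ} {E E' : Set Y} (h : Big ν η E) (h' : Big ν η' E') : Big ν (η + η') (E ∩ E') := by
  refine ⟨h.1.inter h'.1, ?_⟩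
  have h1 := measureReal_union_add_inter (μ := ν) (s := E) h'.1
  have h2 : ν.real (E ∪ E') ≤ 1 := measureReal_le_one
  have := h.2; have := h'.2
  linarith

lemma Big.pre {η : ℝ} {E : Set Y} (h : Big ν η E) {ψ : Y → Y} (hψ : MeasurePreserving ψ ν ν) : Big ν η (ψ ⁻¹' E) :=
  ⟨hψ.measurable h.1, by rw [hψ.measureReal_preimage h.1.nullMeasurableSet]; exact h.2⟩

lemma Big.ne {η : ℝ} {E : Set Y} (h : Big ν η E) (hη : η < 1) : E.Nonempty := by
  by_contra hE
  rw [not_nonempty_iff_eq_empty] at hE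
  have := h.2
  rw [hE] at this
  simp at this; linarith
end

lemma inv_mem_sub (A : Subalgebra ℚ (MM n)) (u : (MM n)ˣ) (hu : u.1 ∈ A) : (u⁻¹).1 ∈ A := by
  let f : A →ₗ[ℚ] A := LinearMap.mulLeft ℚ ⟨u.1, hu⟩
  have hf : Function.Injective f := fun a b hab => by
    have h : u.1 * a.1 = u.1 * b.1 := congrArg Subtype.val hab
    exact Subtype.ext (u.isUnit.mul_left_cancel h)
  obtain ⟨b, hb⟩ := LinearMap.injective_iff_surjective.1 hf 1
  have h : u.1 * b.1 = 1 := congrArg Subtype.val hb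
  have : (u⁻¹).1 = b.1 := by
    rw [← mul_one (u⁻¹).1, ← h, ← mul_assoc, Units.inv_mul, one_mul]
  rw [this]; exact b.2

lemma el_ne_one {i j : Fin m} (h : i ≠ j) {a : ℤ} (ha : a ≠ 0) : el i j a ≠ 1 := fun e => by
  have := congrFun (congrFun (congrArg Subtype.val e) i) j
  rw [el_val h] at this
  simp [h] at this
  exact ha this

open Classical in
/-- groupoid types -/
def TF (F : XX m → SG n) (g : SLm m) (x : XX m) : Option (Submodule ℚ (MM n) × Submodule ℚ (MM n)) :=
  if g = 1 then none else some (TT (F x) (F (g • x)))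

lemma TF_eq_iff (F : XX m → SG n) {g : SLm m} (x y : XX m) :
    TF F g x = TF F g y ↔ (g = 1 ∨ TT (F x) (F (g • x)) = TT (F y) (F (g • y))) := by
  unfold TF; by_cases h : g = 1 <;> simp [h]

theorem phase1' (hm : 3 ≤ m) (F : XX m → SG n) (hF : ∀ v, MeasurableSet {x | v ∈ F x})
    (hq : ∀ (g : SLm m) x, ∃ k, QI k (F x) (F (g • x))) (η : ℝ) (hη : 0 < η) :
    ∃ k ≥ 2, ∃ c : XX m, ∃ E : Fin m → Fin m → ℕ → Set (XX m), (∀ i j s, i ≠ j → Big (muc k c) η (E i j s)) ∧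
      ∀ i j s, i ≠ j → 0 < s → ∀ x ∈ E i j s, ∀ y ∈ E i j s,
        TT (F x) (F (el i j (2 ^ k * (s : ℕ)) • x)) = TT (F y) (F (el i j (2 ^ k * (s : ℕ)) • y)) := by
  obtain ⟨k, hk, c, E, h1, h2, h3⟩ := phase1 (TF F) hm (by
    intro g o
    by_cases h : g = 1
    · subst h
      simp [TF]
    · simp only [TF, if_neg h]
      cases o with
      | none => simp
      | some w =>
        simp only [Option.some.injEq]
        exact meas_TT_eq hF (fun v => (smul_cont g).measurable (hF v)) w) (by simp [TF])
    (by
      intro g l x y h h'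
      rw [TF_eq_iff] at h h' ⊢
      rcases h with rfl | h
      · simpa using h'
      rcases h' with rfl | h'
      · right; simpa using h
      · right
        obtain ⟨k, hk⟩ := hq g x
        rw [mul_smul, mul_smul]
        exact TT_comp h h' hk)
    (by
      intro g x y h
      rw [TF_eq_iff] at h ⊢
      rcases h with rfl | h
      · simp
      · right; simpa using TT_symm h) η hη
  refine ⟨k, hk, c, E, fun i j s hij => ⟨h1 i j s, h2 i j s hij⟩, fun i j s hij hs x hx y hy => ?_⟩
  have := (TF_eq_iff F x y).1 (h3 i j s x hx y hy)
  refine this.resolve_left (el_ne_one hij ?_)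
  positivity

theorem phaseA (hnm : n < m) (hm : 3 ≤ m) (F : XX m → SG n) (hF : ∀ v, MeasurableSet {x | v ∈ F x})
    (hq : ∀ (g : SLm m) x, ∃ k, QI k (F x) (F (g • x))) (η : ℝ) (hη : 0 < η) (hη6 : 6 * η < 1) :
    ∃ k ≥ 2, ∃ c : XX m, ∃ T : ℕ, 0 < T ∧ ∀ i j : Fin m, i ≠ j → ∀ s : ℕ, ∃ E, Big (muc k c) (η + η) E ∧
      ∀ x ∈ E, QI 1 (F x) (F (el i j (2 ^ k * (T * s : ℕ)) • x)) := by
  obtain ⟨k, hk, c, E, hE, hT⟩ := phase1' hm F hF hq η hη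
  refine ⟨k, hk, c, ?_⟩
  have mp : ∀ i j : Fin m, i ≠ j → ∀ s : ℕ, MeasurePreserving (fun x => el i j (2 ^ k * (s : ℕ)) • x) (muc k c) (muc k c) :=
    fun i j h s => muc_el k c h s
  have hlam : ∀ i j : Fin m, ∃ l : (MM n)ˣ, i ≠ j → ∀ x ∈ E i j 1, QI l (F x) (F (el i j (2 ^ k * (1 : ℕ)) • x)) := by
    intro i j
    by_cases hij : i = j
    · exact ⟨1, fun h => absurd hij h⟩
    obtain ⟨x0, hx0⟩ := (hE i j 1 hij).ne (by linarith)
    obtain ⟨l, hl⟩ := hq (el i j (2 ^ k * (1 : ℕ))) x0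
    exact ⟨l, fun _ x hx => QI_of_TT (hT i j 1 hij one_pos x0 hx0 x hx) hl⟩
  choose lam hlam using hlam
  let o : Fin m := ⟨0, by omega⟩
  let o' : Fin m := ⟨1, by omega⟩
  have hoo : o ≠ o' := by simp [o, o']
  obtain ⟨x0, hx0⟩ := (hE o o' 1 hoo).ne (by linarith)
  have hQA : ∀ i j, i ≠ j → ∀ x ∈ E i j 1, QH (F x) (F x) = QH (F x0) (F x0) := by
    intro i j hij x hx
    obtain ⟨y, hy1, hy2⟩ := ((hE i j 1 hij).inter (hE o o' 1 hoo)).ne (by linarith)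
    have e1 := TT_one (hT i j 1 hij one_pos x hx y hy1) (hlam i j hij x hx)
    have e2 := TT_one (hT o o' 1 hoo one_pos y hy2 x0 hx0) (hlam o o' hoo y hy2)
    exact congrArg Prod.fst (e1.trans e2)
  have hpow : ∀ i j, i ≠ j → ∀ s : ℕ, ∀ x ∈ E i j s, QI (lam i j ^ s) (F x) (F (el i j (2 ^ k * (s : ℕ)) • x)) := by
    intro i j hij s
    induction s with
    | zero =>
      intro x _
      simp only [Nat.cast_zero, mul_zero, el_zero, one_smul, pow_zero]
      exact ⟨QH_one _, by simpa using QH_one _⟩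
    | succ s ih =>
      intro x hx
      obtain ⟨y, ⟨hy1, hy2⟩, hy3⟩ := (((hE i j s hij).inter ((hE i j 1 hij).pre (mp i j hij s))).inter (hE i j (s + 1) hij)).ne
        (by linarith)
      refine QI_of_TT (hT i j (s + 1) hij (Nat.succ_pos s) y hy3 x hx) ?_
      have := (hlam i j hij _ hy2).mul (ih y hy1)
      rw [smul_smul, el_add hij, ← mul_add, ← Nat.cast_add, add_comm 1 s, ← pow_succ'] at this
      exact this
  obtain ⟨T, hT0, hTA⟩ := alg hnm hm (QA (F x0)) lam (2 ^ k) (by positivity) (by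
      intro i j hij a ha
      obtain ⟨y, hy1, hy2⟩ := ((hE i j 1 hij).inter ((hE i j 1 hij).pre (mp i j hij 1))).ne (by linarith)
      have hl := hlam i j hij y hy1
      rw [mem_QA, ← hQA i j hij _ hy1] at ha
      rw [mem_QA, ← hQA i j hij _ hy2]
      exact QH_mul (QH_mul hl.1 ha) hl.2) (by
      intro i j l hij hjl hil s
      obtain ⟨y, ⟨⟨h1, h2⟩, ⟨h3, h4⟩⟩, h5, h6⟩ :=
        ((((hE j l s hjl).inter ((hE i j s hij).pre (mp j l hjl s))).inter ((hE i j s hij).inter ((hE j l s hjl).pre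
          (mp i j hij s)))).inter (((hE i l (2 ^ k * (s * s)) hil).pre ((mp j l hjl s).comp (mp i j hij s))).inter
            (hE o o' 1 hoo))).ne (by linarith)
      rw [mem_QA, ← hQA o o' hoo _ h6]
      have q1 := (hpow i j hij s _ h2).mul (hpow j l hjl s _ h1)
      have q2 := ((hpow i l hil _ _ h5).mul (hpow j l hjl s _ h4)).mul (hpow i j hij s _ h3)
      refine (q2.inv.mul ?_).1
      convert q1 using 2
      simp only [Function.comp, smul_smul]
      rw [el_st hij hjl hil, mul_assoc]
      congr 3; push_cast; ring) (by
      intro i j a b hij hab hja hib s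
      obtain ⟨y, ⟨⟨h1, h2⟩, ⟨h3, h4⟩⟩, h6⟩ :=
        ((((hE a b s hab).inter ((hE i j s hij).pre (mp a b hab s))).inter ((hE i j s hij).inter ((hE a b s hab).pre
          (mp i j hij s)))).inter (hE o o' 1 hoo)).ne (by linarith)
      rw [mem_QA, ← hQA o o' hoo _ h6]
      have q1 := (hpow i j hij s _ h2).mul (hpow a b hab s _ h1)
      have q2 := (hpow a b hab s _ h4).mul (hpow i j hij s _ h3)
      refine (q2.inv.mul ?_).1
      convert q1 using 2
      simp only [smul_smul]
      rw [el_comm hij hab hja hib])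
  refine ⟨T, hT0, fun i j hij s => ⟨E i j (T * s) ∩ E o o' 1, (hE _ _ _ hij).inter (hE _ _ _ hoo), fun x hx => ?_⟩⟩
  have hQ := hpow i j hij (T * s) x hx.1
  have hA : (lam i j ^ (T * s)).1 ∈ QA (F x0) := by
    rw [pow_mul, Units.val_pow_eq_pow_val]; exact Subalgebra.pow_mem _ (hTA i j hij) s
  have hA' := inv_mem_sub _ _ hA
  rw [mem_QA, ← hQA o o' hoo x hx.2] at hA hA'
  refine ⟨?_, ?_⟩
  · have := QH_mul hQ.1 hA'
    rwa [← Units.val_mul, mul_inv_cancel] at this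
  · have := QH_mul hA hQ.2
    rw [← Units.val_mul, mul_inv_cancel] at this
    simpa using this

end Thomas
end
end

section
open MeasureTheory Filter Topology Set
open scoped ENNReal NNReal

noncomputable section
namespace Thomas
variable {m n : ℕ}

instance : NullSingletonClass (hp ℤ_[2]) := ⟨fun t => by
  have h := hp_map (G := XX 1) (H := ℤ_[2]) (Pi.evalAddMonoidHom _ 0) (continuous_apply 0)
    (Function.surjective_eval 0)
  have h0 : hp ℤ_[2] {0} = 0 := by
    rw [← h.measure_preimage (measurableSet_singleton 0).nullMeasurableSet]
    exact hp_coord (m := 1) 0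
  have h1 := (measurePreserving_add_right (hp ℤ_[2]) (-t)).measure_preimage (measurableSet_singleton 0).nullMeasurableSet
  rw [h0] at h1
  rw [← h1]; congr 1; ext s
  simp⟩

lemma muc_coord (k : ℕ) (c : XX m) (j : Fin m) : ∀ᵐ x ∂(muc k c), x j ≠ 0 := by
  have h2 : MeasurableSet {x : XX m | x j = 0} := (isClosed_eq (continuous_apply j) continuous_const).measurableSet
  rw [ae_iff]
  simp only [ne_eq, not_not]
  rw [← (sc_mp k c).measure_preimage h2.nullMeasurableSet]
  by_cases hz : ∃ z0 : XX m, (sc k c z0) j = 0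
  · obtain ⟨z0, hz0⟩ := hz
    have h3 := (hp_add (-z0)).measure_preimage h2.nullMeasurableSet
    rw [hp_coord] at h3
    refine measure_mono_null (fun z hz => ?_) h3
    have hz : (sc k c z) j = 0 := hz
    change z j + (- z0) j = 0
    simp only [sc, Pi.add_apply, Pi.smul_apply, smul_eq_mul] at hz hz0
    have h4 : (2 : ℤ_[2]) ^ k * (z j - z0 j) = 0 := by linear_combination hz - hz0
    have := (mul_eq_zero.1 h4).resolve_left (pow_ne_zero _ two_ne_zero)
    simpa [sub_eq_add_neg] using this
  · push Not at hz
    rw [show sc k c ⁻¹' {x : XX m | x j = 0} = ∅ from eq_empty_of_forall_notMem fun z h => hz z h]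
    simp

instance : Countable (MM m)ˣ := (Units.val_injective (α := MM m)).countable

/-- trace on a finite set -/
def trc (V : Finset (QV n)) (B : SG n) : Finset (QV n) := by
  classical exact V.filter (· ∈ B)

lemma mem_trc {V : Finset (QV n)} {B : SG n} {v : QV n} : v ∈ trc V B ↔ v ∈ V ∧ v ∈ B := by simp [trc]

lemma meas_trc {Y : Type*} [MeasurableSpace Y] {G : Y → SG n} (hG : ∀ v, MeasurableSet {x | v ∈ G x})
    (V W : Finset (QV n)) : MeasurableSet {x | trc V (G x) = W} := by
  have : {x | trc V (G x) = W} = ⋂ v : QV n, {x | (v ∈ V ∧ v ∈ G x) ↔ v ∈ W} := by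
    ext x; simp [Finset.ext_iff, mem_trc]
  rw [this]
  refine MeasurableSet.iInter fun v => ?_
  by_cases h1 : v ∈ V <;> by_cases h2 : v ∈ W
  · simpa [h1, h2] using hG v
  · simp only [h1, h2, true_and, iff_false]; exact (hG v).compl
  · simp [h1, h2]
  · simp [h1, h2]

lemma ext_Z2 (ν : Measure (XX m)) [IsProbabilityMeasure ν] (G : XX m → SG n) (hG : ∀ v, MeasurableSet {x | v ∈ G x})
    (i j : Fin m) (N : ℤ_[2]) (mp : ∀ t : ℤ_[2], MeasurePreserving (shx i j (N * t)) ν ν) (r : ℝ)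
    (h : ∀ a : ℤ, r ≤ ν.real {x | G (shx i j (N * a) x) = G x}) (t : ℤ_[2]) :
    r ≤ ν.real {x | G (shx i j (N * t) x) = G x} := by
  obtain ⟨e, he⟩ := exists_surjective_nat (QV n)
  let D : ℕ → Set (XX m) := fun q => {x | trc ((Finset.range q).image e) (G (shx i j (N * t) x)) =
    trc ((Finset.range q).image e) (G x)}
  have hGs : ∀ s : ℤ_[2], ∀ v, MeasurableSet {x | v ∈ G (shx i j (N * s) x)} := fun s v => (shx_cont i j _).measurable (hG v)
  have hD : ∀ q, MeasurableSet (D q) := fun q => meas_agree (meas_trc (hGs t) _) (meas_trc hG _)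
  have hanti : Antitone D := fun p q hpq x hx => by
    have hx : trc _ _ = trc _ _ := hx
    ext v
    have := Finset.ext_iff.1 hx v
    simp only [mem_trc] at this ⊢
    by_cases hv : v ∈ (Finset.range p).image e
    · have hv' : v ∈ (Finset.range q).image e := Finset.image_mono _ (Finset.range_mono hpq) hv
      simpa [hv, hv'] using this
    · simp [hv]
  have hinter : {x | G (shx i j (N * t) x) = G x} = ⋂ q, D q := by
    ext x
    simp only [mem_ofPred_eq, mem_iInter, D]
    refine ⟨fun h q => by rw [h], fun h => ?_⟩
    ext v
    obtain ⟨q, rfl⟩ := he v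
    have := Finset.ext_iff.1 (h (q + 1)) (e q)
    simp only [mem_trc] at this
    have hv : e q ∈ (Finset.range (q + 1)).image e := Finset.mem_image_of_mem _ (by simp)
    simpa [hv] using this
  have hlim : Tendsto (fun q => ν.real (D q)) atTop (𝓝 (ν.real (⋂ q, D q))) :=
    (ENNReal.tendsto_toReal (measure_ne_top _ _)).comp
      (tendsto_measure_iInter_atTop (fun q => (hD q).nullMeasurableSet) hanti ⟨0, measure_ne_top _ _⟩)
  rw [hinter]
  refine ge_of_tendsto' hlim fun q => le_of_forall_pos_sub_le fun ε hε => ?_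
  obtain ⟨δ, hδ, H⟩ := cont_fun ν (fun x => trc ((Finset.range q).image e) (G x)) (meas_trc hG _)
    (ENNReal.ofReal ε) (by simpa using hε)
  obtain ⟨a, ha⟩ := Metric.denseRange_iff.1 (PadicInt.denseRange_intCast (p := 2)) t δ hδ
  have h1 := H ν _ _ (mp t) (mp a) (fun x => by
    refine lt_of_le_of_lt ?_ ha
    rw [dist_pi_le_iff dist_nonneg]
    intro l
    simp only [shx_apply, Pi.add_apply]
    rw [dist_add_left]
    by_cases hl : l = i
    · subst hl
      simp only [Pi.single_eq_same]
      rw [dist_eq_norm, ← sub_mul, ← mul_sub, norm_mul, norm_mul, dist_eq_norm]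
      have n1 := PadicInt.norm_le_one N
      have n2 := PadicInt.norm_le_one (x j)
      calc ‖N‖ * ‖t - a‖ * ‖x j‖ ≤ 1 * ‖t - a‖ * 1 := by gcongr
        _ = _ := by ring
    · simp [hl])
  have h2 := ENNReal.toReal_le_of_le_ofReal hε.le h1
  have h3 : {x | G (shx i j (N * a) x) = G x} ⊆ D q ∪ {ω | trc ((Finset.range q).image e) (G (shx i j (N * t) ω)) ≠
      trc ((Finset.range q).image e) (G (shx i j (N * a) ω))} := by
    intro x hx
    by_cases hc : x ∈ D q
    · exact Or.inl hc
    · right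
      intro h
      apply hc
      have hx : G (shx i j (N * a) x) = G x := hx
      change trc _ _ = trc _ _
      rw [h, hx]
  have h4 := (measureReal_mono (μ := ν) h3).trans (measureReal_union_le _ _)
  have h5 := h a
  have h2 : ν.real {ω | trc ((Finset.range q).image e) (G (shx i j (N * t) ω)) ≠
      trc ((Finset.range q).image e) (G (shx i j (N * a) ω))} ≤ ε := h2
  linarith

lemma fib_count (F : XX m → SG n) (hiso : ∀ x y, Nonempty (F x ≃+ F y) ↔ Nonempty (AA x ≃+ AA y)) (K : ℕ) (D : SG n)
    {i j : Fin m} (hij : i ≠ j) (N : ℤ_[2]) (hN : N ≠ 0) (x : XX m) (hx : x j ≠ 0) :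
    {t : ℤ_[2] | hh K (F (shx i j (N * t) x)) = D}.Countable := by
  have hj : ∀ t, shx i j (N * t) x j = x j := fun t => by simp [shx_apply, Pi.single_eq_of_ne hij.symm]
  have : {t : ℤ_[2] | hh K (F (shx i j (N * t) x)) = D} ⊆ ⋃ B ∈ {B : SG n | hh K B = D}, {t | F (shx i j (N * t) x) = B} := by
    intro t ht; simpa using ht
  refine Countable.mono this (Countable.biUnion (hh_fibre K D) fun B _ => ?_)
  by_cases hne : ∃ t0, F (shx i j (N * t0) x) = B
  · obtain ⟨t0, ht0⟩ := hne
    have : {t | F (shx i j (N * t) x) = B} ⊆ ⋃ k : (MM m)ˣ, {t | ∀ v, v ∈ AA (shx i j (N * t) x) ↔ k.1.mulVec v ∈ AA (shx i j (N * t0) x)} := by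
      intro t ht
      have ht : F (shx i j (N * t) x) = B := ht
      have h1 : F (shx i j (N * t) x) = F (shx i j (N * t0) x) := ht.trans ht0.symm
      obtain ⟨f⟩ := (hiso (shx i j (N * t) x) (shx i j (N * t0) x)).1 (by rw [h1]; exact ⟨AddEquiv.refl _⟩)
      obtain ⟨k, hk⟩ := iso_matrix f
      exact mem_iUnion.2 ⟨k, hk⟩
    refine Countable.mono this (countable_iUnion fun k => Set.Subsingleton.countable fun t ht t' ht' => ?_)
    have e : AA (shx i j (N * t) x) = AA (shx i j (N * t') x) := by
      ext v; exact (ht v).trans (ht' v).symm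
    have := AA_coord (i := i) e ((hj t).trans (hj t').symm) (by rw [hj]; exact hx)
    simp only [shx_apply, Pi.add_apply, Pi.single_eq_same, add_right_inj] at this
    exact mul_left_cancel₀ hN (mul_right_cancel₀ hx this)
  · rw [show {t | F (shx i j (N * t) x) = B} = ∅ from eq_empty_of_forall_notMem fun t h => hne ⟨t, h⟩]
    exact countable_empty

theorem phase2 (hnm : n < m) (hm : 3 ≤ m) (F : XX m → SG n) (hF : ∀ v, MeasurableSet {x | v ∈ F x})
    (hiso : ∀ x y, Nonempty (F x ≃+ F y) ↔ Nonempty (AA x ≃+ AA y)) : False := by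
  have hq : ∀ (g : SLm m) x, ∃ k, QI k (F x) (F (g • x)) := fun g x =>
    iso_QI ((hiso _ _).2 ((AA_smul_iso g x).map AddEquiv.symm))
  obtain ⟨δ, hδ, H⟩ := relT_el hm (1 / 2) (by norm_num)
  obtain ⟨k, hk, c, T, hT, hQ⟩ := phaseA hnm hm F hF hq (min (δ / 4) (1 / 12)) (by positivity) (by
    have := min_le_right (δ / 4) (1 / 12); linarith)
  have hNk : (4 : ℤ) ≤ 2 ^ k := by
    calc (4 : ℤ) = 2 ^ 2 := by norm_num
      _ ≤ 2 ^ k := pow_le_pow_right₀ (by norm_num) hk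
  have hT1 : (1 : ℤ) ≤ T := by exact_mod_cast hT
  obtain ⟨R, H⟩ := H (2 ^ k * T) (by nlinarith)
  have hev : ∀ i j : Fin m, i ≠ j → ∀ s : ℕ, ∀ᶠ K in atTop,
      1 - δ < (muc k c).real {x | hh K (F (el i j (2 ^ k * T * (s : ℕ)) • x)) = hh K (F x)} := by
    intro i j hij s
    obtain ⟨E, hE, hE'⟩ := hQ i j hij s
    refine eventual_meas (muc k c) _ E (fun x hx => ?_) _ ?_
    · obtain ⟨K, hK⟩ := hh_eq (hE' x hx)
      refine ⟨K, fun k' hk' => ?_⟩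
      have := (hK k' hk').symm
      rw [Nat.cast_mul, ← mul_assoc] at this
      exact this
    · have := hE.2
      have := min_le_left (δ / 4) (1 / 12)
      linarith
  have ev1 : ∀ᶠ K in atTop, ∀ (i j : Fin m), ∀ (s : Fin R), i ≠ j →
      1 - δ < (muc k c).real {x | hh K (F (el i j (2 ^ k * T * (s.1 : ℕ)) • x)) = hh K (F x)} :=
    eventually_all.2 fun i => eventually_all.2 fun j => eventually_all.2 fun s => by
      by_cases hij : i = j
      · exact Eventually.of_forall fun _ h => absurd hij h
      · exact (hev i j hij s).mono fun _ h _ => h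
  have ev2 : ∀ᶠ K in atTop, ∀ (i j : Fin m), i ≠ j →
      1 - δ < (muc k c).real {x | hh K (F (el i j (2 ^ k * T * (1 : ℕ)) • x)) = hh K (F x)} :=
    eventually_all.2 fun i => eventually_all.2 fun j => by
      by_cases hij : i = j
      · exact Eventually.of_forall fun _ h => absurd hij h
      · exact (hev i j hij 1).mono fun _ h _ => h
  obtain ⟨K, hK1, hK2⟩ := (ev1.and ev2).exists
  have mp : ∀ i j : Fin m, i ≠ j → ∀ a : ℤ, MeasurePreserving (fun x : XX m => el i j (2 ^ k * T * a) • x) (muc k c) (muc k c) :=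
    fun i j hij a => by rw [mul_assoc]; exact muc_el k c hij _
  have hmh : ∀ v, MeasurableSet {x | v ∈ hh K (F x)} := meas_hh hF K
  have hS := H (muc k c) (fun g => (smul_cont g).measurable) (fun g => {x | hh K (F (g • x)) = hh K (F x)})
    (fun g => meas_SG_eq (fun v => (smul_cont g).measurable (hmh v)) hmh)
    (eq_univ_of_forall fun x => by simp) (fun g l x h h' => by
      have h : hh K (F (g • x)) = hh K (F x) := h
      have h' : hh K (F (l • g • x)) = hh K (F (g • x)) := h'
      change hh K (F ((l * g) • x)) = hh K (F x)
      rw [mul_smul, h', h]) (fun g x h => by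
      have h : hh K (F (g • x)) = hh K (F x) := h
      change hh K (F (g⁻¹ • g • x)) = hh K (F (g • x))
      rw [inv_smul_smul, h]) (2 ^ k * T) mp (fun i j hij => by simpa using mp i j hij 1)
    (fun i j hij a ha => (hK1 i j ⟨a, ha⟩ hij).le) (fun i j hij => by simpa using (hK2 i j hij).le)
  let i : Fin m := ⟨0, by omega⟩
  let j : Fin m := ⟨1, by omega⟩
  have hij : i ≠ j := by simp [i, j]
  let N : ℤ_[2] := 2 ^ k * T
  have hN : N ≠ 0 := mul_ne_zero (pow_ne_zero _ two_ne_zero) (by exact_mod_cast hT.ne')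
  have hz := ext_Z2 (muc k c) (fun x => hh K (F x)) hmh i j N (fun t => by
    simp only [N, mul_assoc]; exact muc_sh k c hij _) (1 / 2) (fun a => by
      have := hS i j hij a
      simp only [el_smul hij] at this
      push_cast at this
      simp only [shx_apply, N]
      linarith)
  have hcont : Continuous fun p : ℤ_[2] × XX m => shx i j (N * p.1) p.2 := by
    simp only [shx_apply]
    exact continuous_snd.add ((continuous_single i).comp ((continuous_const.mul continuous_fst).mul
      ((continuous_apply j).comp continuous_snd)))
  have hZ : MeasurableSet {p : ℤ_[2] × XX m | hh K (F (shx i j (N * p.1) p.2)) = hh K (F p.2)} :=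
    meas_SG_eq (fun v => hcont.measurable (hmh v)) (fun v => measurable_snd (hmh v))
  have z1 : ((hp ℤ_[2]).prod (muc k c)) {p : ℤ_[2] × XX m | hh K (F (shx i j (N * p.1) p.2)) = hh K (F p.2)} = 0 := by
    rw [Measure.prod_apply_symm hZ, lintegral_eq_zero_iff (measurable_measure_prodMk_right hZ)]
    filter_upwards [muc_coord k c j] with x hx
    exact (fib_count F hiso K (hh K (F x)) hij N hN x hx).measure_zero _
  rw [Measure.prod_apply hZ, lintegral_eq_zero_iff (measurable_measure_prodMk_left hZ)] at z1
  obtain ⟨t, ht⟩ := z1.exists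
  have h0 : (muc k c) {x | hh K (F (shx i j (N * t) x)) = hh K (F x)} = 0 := ht
  have h1 := hz t
  simp only [Measure.real, h0, ENNReal.toReal_zero] at h1
  norm_num at h1

end Thomas
end
end

section
open MeasureTheory Filter Topology Set
open scoped ENNReal NNReal

noncomputable section
namespace Thomas

lemma shear_null (Z : Set (XX 2)) (hZ : MeasurableSet Z) (h : ∀ x : XX 2, x 1 ≠ 0 → {t | shx 0 1 t x ∈ Z}.Countable) :
    hp (XX 2) Z = 0 := by
  have hcont : Continuous fun p : ℤ_[2] × XX 2 => shx 0 1 p.1 p.2 := by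
    simp only [shx_apply]
    exact continuous_snd.add ((continuous_single 0).comp (continuous_fst.mul ((continuous_apply 1).comp continuous_snd)))
  have hm : MeasurableSet {p : ℤ_[2] × XX 2 | shx 0 1 p.1 p.2 ∈ Z} := hcont.measurable hZ
  have z1 : ((hp ℤ_[2]).prod (hp (XX 2))) {p : ℤ_[2] × XX 2 | shx 0 1 p.1 p.2 ∈ Z} = 0 := by
    rw [Measure.prod_apply_symm hm, lintegral_eq_zero_iff (measurable_measure_prodMk_right hm)]
    have h0 : ∀ᵐ x ∂(hp (XX 2)), x 1 ≠ 0 := by rw [ae_iff]; simpa using hp_coord (m := 2) 1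
    filter_upwards [h0] with x hx
    exact (h x hx).measure_zero _
  rw [Measure.prod_apply hm, lintegral_eq_zero_iff (measurable_measure_prodMk_left hm)] at z1
  obtain ⟨t, ht⟩ := z1.exists
  rw [← (shx_mp (i := (0 : Fin 2)) (j := 1) (by simp) t).measure_preimage hZ.nullMeasurableSet]
  exact ht

lemma form_null (a b c : ℚ) (habc : ¬ (a = 0 ∧ b = 0 ∧ c = 0)) :
    hp (XX 2) {x | (a : ℚ_[2]) * x 0 ^ 2 + b * (x 0 * x 1) + c * x 1 ^ 2 = 0} = 0 := by
  have hc : ∀ i : Fin 2, Continuous fun x : XX 2 => (x i : ℚ_[2]) := fun i =>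
    continuous_subtype_val.comp (continuous_apply i)
  refine shear_null _ (isClosed_eq ?_ continuous_const).measurableSet fun x hx => ?_
  · exact ((continuous_const.mul ((hc 0).pow 2)).add (continuous_const.mul ((hc 0).mul (hc 1)))).add
      (continuous_const.mul ((hc 1).pow 2))
  have hx' : (x 1 : ℚ_[2]) ≠ 0 := fun h => hx (Subtype.ext h)
  obtain ⟨b', hb'⟩ : ∃ b' : ℚ_[2], b' = b * x 1 := ⟨_, rfl⟩
  obtain ⟨c', hc'⟩ : ∃ c' : ℚ_[2], c' = c * x 1 ^ 2 := ⟨_, rfl⟩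
  let p : Polynomial ℚ_[2] := .C (a : ℚ_[2]) * .X ^ 2 + .C b' * .X + .C c'
  have hp0 : p ≠ 0 := by
    intro h
    have c0 := congrArg (fun q => Polynomial.coeff q 0) h
    have c1 := congrArg (fun q => Polynomial.coeff q 1) h
    have c2 := congrArg (fun q => Polynomial.coeff q 2) h
    simp [p, Polynomial.coeff_X, Polynomial.coeff_C] at c0 c1 c2
    apply habc
    rw [c1] at hb'
    rw [c0] at hc'
    exact ⟨c2, by simpa [hx'] using hb'.symm, by simpa [hx'] using hc'.symm⟩
  have hfin := Polynomial.finite_setOfPred_isRoot hp0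
  have : {t | shx 0 1 t x ∈ {x : XX 2 | (a : ℚ_[2]) * x 0 ^ 2 + b * (x 0 * x 1) + c * x 1 ^ 2 = 0}} ⊆
      (fun t : ℤ_[2] => ((x 0 + t * x 1 : ℤ_[2]) : ℚ_[2])) ⁻¹' {y | p.IsRoot y} := by
    intro t ht
    have ht : (a : ℚ_[2]) * (shx 0 1 t x) 0 ^ 2 + b * ((shx 0 1 t x) 0 * (shx 0 1 t x) 1) + c * (shx 0 1 t x) 1 ^ 2 = 0 := ht
    simp only [shx_apply, Pi.add_apply, Pi.single_eq_same, Pi.single_eq_of_ne (one_ne_zero : (1 : Fin 2) ≠ 0), add_zero] at ht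
    simp only [mem_preimage, mem_ofPred_eq, Polynomial.IsRoot, p, Polynomial.eval_add, Polynomial.eval_mul, Polynomial.eval_C,
      Polynomial.eval_pow, Polynomial.eval_X]
    rw [hb', hc']
    linear_combination ht
  refine (hfin.countable.preimage_of_injOn ?_).mono this
  intro t _ t' _ h
  have h : x 0 + t * x 1 = x 0 + t' * x 1 := Subtype.ext h
  exact mul_right_cancel₀ hx (add_left_cancel h)

lemma aut_null : ∀ᵐ x ∂(hp (XX 2)), ∀ q : (MM 2)ˣ, (∀ v, v ∈ AA x ↔ q.1.mulVec v ∈ AA x) → ∃ r : ℚ, q.1 = r • 1 := by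
  rw [ae_all_iff]
  intro q
  by_cases hq : ∃ r : ℚ, q.1 = r • 1
  · exact Eventually.of_forall fun _ _ => hq
  have hn := form_null (q.1 0 1) (q.1 1 1 - q.1 0 0) (- q.1 1 0) (fun ⟨h1, h2, h3⟩ => hq ⟨q.1 0 0, by
    ext i j
    fin_cases i <;> fin_cases j
    · simp
    · simpa using h1
    · simpa using h3
    · simpa [sub_eq_zero] using h2⟩)
  have : ∀ᵐ x : XX 2 ∂(hp (XX 2)), ¬ ((q.1 0 1 : ℚ) : ℚ_[2]) * x 0 ^ 2 + ((q.1 1 1 - q.1 0 0 : ℚ) : ℚ_[2]) * (x 0 * x 1) + ((- q.1 1 0 : ℚ) : ℚ_[2]) * x 1 ^ 2 = 0 := by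
    rw [ae_iff]; simpa only [not_not] using hn
  filter_upwards [this] with x hx h
  exfalso; apply hx
  have e := dp_prop (fun i => (x i : ℚ_[2])) (fun i => ∑ j, (q.1 j i : ℚ_[2]) * x j) (fun v hv => by
    have h1 : q.1.mulVec v ∈ AA x := (h v).1 hv
    rw [mem_AA] at h1
    convert h1 using 2
    simp only [dp, Matrix.mulVec, dotProduct, Fin.sum_univ_two]
    push_cast; ring) 0 1
  simp only [Fin.sum_univ_two] at e
  push_cast
  linear_combination e

/-- points reached with cocycle value in `P` -/
def WW (P : Set (QV 2)) : Set (XX 2 × XX 2) :=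
  {p | ∃ k : (MM 2)ˣ, (∀ v, v ∈ AA p.1 ↔ k.1.mulVec v ∈ AA p.2) ∧ k.1 0 ∈ P}

lemma meas_WW (P : Set (QV 2)) : MeasurableSet (WW P) := by
  have : WW P = ⋃ k : (MM 2)ˣ, ⋃ _ : k.1 0 ∈ P, ⋂ v, {p : XX 2 × XX 2 | v ∈ AA p.1 ↔ k.1.mulVec v ∈ AA p.2} := by
    ext p; simp [WW, and_comm]
  rw [this]
  refine .iUnion fun k => .iUnion fun _ => .iInter fun v => ?_
  have h1 : MeasurableSet {p : XX 2 × XX 2 | v ∈ AA p.1} := measurable_fst (meas_AA v)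
  have h2 : MeasurableSet {p : XX 2 × XX 2 | k.1.mulVec v ∈ AA p.2} := measurable_snd (meas_AA _)
  have : {p : XX 2 × XX 2 | v ∈ AA p.1 ↔ k.1.mulVec v ∈ AA p.2} = ({p : XX 2 × XX 2 | v ∈ AA p.1} ∩ {p : XX 2 × XX 2 | k.1.mulVec v ∈ AA p.2}) ∪
    ({p : XX 2 × XX 2 | v ∈ AA p.1}ᶜ ∩ {p : XX 2 × XX 2 | k.1.mulVec v ∈ AA p.2}ᶜ) := by
    ext p; simp only [mem_ofPred_eq, mem_union, mem_inter_iff, mem_compl_iff]; tauto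
  rw [this]
  exact (h1.inter h2).union (h1.compl.inter h2.compl)

lemma WW_smul (P : Set (QV 2)) (g : SLm 2) (x y : XX 2) (h : (g • x, y) ∈ WW P) :
    (x, y) ∈ WW {w | (g.1.map (Int.castRingHom ℚ)).mulVec w ∈ P} := by
  obtain ⟨k, hk, hP⟩ := h
  refine ⟨k * (trU g)⁻¹, fun v => ?_, ?_⟩
  · have h1 := AA_smul g x ((trU g)⁻¹.1.mulVec v)
    have h2 : (g.1.map (Int.castRingHom ℚ)).transpose.mulVec ((trU g)⁻¹.1.mulVec v) = v := by
      change (trU g).1.mulVec _ = v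
      rw [Matrix.mulVec_mulVec, Units.mul_inv, Matrix.one_mulVec]
    rw [h2] at h1
    rw [← h1, hk, Matrix.mulVec_mulVec]; rfl
  · change (g.1.map (Int.castRingHom ℚ)).mulVec _ ∈ P
    have h3 : k.1 = (k * (trU g)⁻¹).1 * (g.1.map (Int.castRingHom ℚ)).transpose := by
      change k.1 = (k * (trU g)⁻¹).1 * (trU g).1
      rw [← Units.val_mul, inv_mul_cancel_right]
    have h4 : (g.1.map (Int.castRingHom ℚ)).mulVec ((k * (trU g)⁻¹).1 0) = k.1 0 := by
      conv_rhs => rw [h3]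
      ext j
      simp [Matrix.mulVec, dotProduct, Matrix.mul_apply, Matrix.transpose_apply, mul_comm]
    rw [h4]; exact hP

lemma WW_disj {x : XX 2} (hx : ∀ q : (MM 2)ˣ, (∀ v, v ∈ AA x ↔ q.1.mulVec v ∈ AA x) → ∃ r : ℚ, q.1 = r • 1)
    (P P' : Set (QV 2)) (hPP : ∀ w (r : ℚ), w ≠ 0 → r • w ≠ 0 → w ∈ P → r • w ∈ P' → False) (y : XX 2) (h : (x, y) ∈ WW P) (h' : (x, y) ∈ WW P') : False := by
  obtain ⟨k, hk, hP⟩ := h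
  obtain ⟨l, hl, hP'⟩ := h'
  obtain ⟨r, hr⟩ := hx (k⁻¹ * l) (fun v => by
    rw [hl v, hk, Matrix.mulVec_mulVec, ← Units.val_mul, mul_inv_cancel_left])
  have e : l.1 = r • k.1 := by
    have : l.1 = k.1 * (k⁻¹ * l).1 := by rw [← Units.val_mul, mul_inv_cancel_left]
    rw [this, hr, mul_smul_comm, mul_one]
  have hne : ∀ u : (MM 2)ˣ, u.1 0 ≠ 0 := fun u h0 => by
    have : (u.1 * u⁻¹.1) 0 0 = 1 := by simp
    rw [Matrix.mul_apply] at this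
    simp [h0] at this
  have e0 : l.1 0 = r • k.1 0 := by rw [e]; rfl
  refine hPP (k.1 0) r (hne k) (by rw [← e0]; exact hne l) hP (by rw [← e0]; exact hP')

lemma row_ne (u : (MM 2)ˣ) : u.1 0 ≠ 0 := fun h0 => by
  have : (u.1 * u⁻¹.1) 0 0 = 1 := by simp
  rw [Matrix.mul_apply] at this
  simp [h0] at this

end Thomas
end
end

section
open MeasureTheory Filter Topology Set
open scoped ENNReal NNReal

noncomputable section
namespace Thomas

/-- quadrant-type sets of vectors -/
def PP (i j : Fin 2) : Set (QV 2) := {w | |w i| ≤ |w j|}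

/-- image condition -/
def PPs (i j : Fin 2) (a : ℤ) : Set (QV 2) := {w | ((el i j a).1.map (Int.castRingHom ℚ)).mulVec w ∈ PP i j}

lemma el_mulVec {i j : Fin 2} (h : i ≠ j) (a : ℤ) (w : QV 2) :
    ((el i j a).1.map (Int.castRingHom ℚ)).mulVec w = w + Pi.single i ((a : ℚ) * w j) := by
  ext k
  rw [el_val h]
  fin_cases i <;> fin_cases j <;> first | exact absurd rfl h | skip
  all_goals fin_cases k <;> simp [Matrix.mulVec, dotProduct, Fin.sum_univ_two, Matrix.single_apply] <;> try ring

lemma mem_PPs {i j : Fin 2} (h : i ≠ j) (a : ℤ) (w : QV 2) : w ∈ PPs i j a ↔ |w i + a * w j| ≤ |w j| := by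
  simp only [PPs, mem_ofPred_eq, el_mulVec h, PP, Pi.add_apply, Pi.single_eq_same, Pi.single_eq_of_ne h.symm, add_zero]

lemma PPs_sub {i j : Fin 2} (h : i ≠ j) {a : ℤ} (ha : a = 3 ∨ a = -3) {w : QV 2} (hw : w ∈ PPs i j a) : w ∈ PP j i := by
  rw [mem_PPs h] at hw
  change |w j| ≤ |w i|
  rcases ha with rfl | rfl <;> push_cast at hw <;> rcases abs_cases (w i) with h1 | h1 <;> rcases abs_cases (w j) with h2 | h2 <;>
    rw [abs_le] at hw <;> rw [h1.1, h2.1] <;> rw [h2.1] at hw <;> linarith [hw.1, hw.2]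

lemma PPs_disj {i j : Fin 2} (h : i ≠ j) (w : QV 2) (r : ℚ) (hw : w ≠ 0) (hr : r • w ≠ 0) (h1 : w ∈ PPs i j 3)
    (h2 : r • w ∈ PPs i j (-3)) : False := by
  have hr0 : r ≠ 0 := by rintro rfl; simp at hr
  rw [mem_PPs h] at h1 h2
  push_cast at h1 h2
  simp only [Pi.smul_apply, smul_eq_mul] at h2
  rw [show r * w i + -3 * (r * w j) = r * (w i - 3 * w j) by ring, abs_mul, abs_mul] at h2
  have h3 := le_of_mul_le_mul_left h2 (abs_pos.2 hr0)
  have hj : w j = 0 := by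
    rw [← abs_eq_zero]
    rcases abs_cases (w j) with h4 | h4 <;> rw [abs_le] at h1 h3 <;> rw [h4.1] at h1 h3 ⊢ <;> linarith [h1.1, h1.2, h3.1, h3.2]
  have hi : w i = 0 := by rw [hj] at h1; simpa using h1
  apply hw
  ext k
  have : k = i ∨ k = j := by
    fin_cases i <;> fin_cases j <;> fin_cases k <;> simp at h ⊢
  rcases this with rfl | rfl
  · exact hi
  · exact hj

lemma QI_one_of {B C : SG 1} {k : (MM 1)ˣ} (h : QI k B C) : QI 1 B C := by
  have key : ∀ (B C : SG 1) (u : (MM 1)ˣ), u.1 ∈ QH B C → (1 : MM 1) ∈ QH B C := fun B C u hu => by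
    have e : u.1 = u.1 0 0 • 1 := by
      ext i j; fin_cases i; fin_cases j; simp
    have h0 : u.1 0 0 ≠ 0 := fun h0 => by
      have : (u.1 * u⁻¹.1) 0 0 = 1 := by rw [Units.mul_inv]; rfl
      rw [Matrix.mul_apply] at this
      simp [h0] at this
    rw [e] at hu
    exact (Submodule.smul_mem_iff _ h0).1 hu
  exact ⟨key _ _ k h.1, by simpa using key _ _ k⁻¹ h.2⟩

theorem noRed1 (F : XX 2 → SG 1) (hF : ∀ v, MeasurableSet {x | v ∈ F x})
    (hiso : ∀ x y, Nonempty (F x ≃+ F y) ↔ Nonempty (AA x ≃+ AA y)) : False := by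
  set μ := hp (XX 2) with hμ
  have hev : ∀ g : SLm 2, ∀ᶠ K in atTop, 7 / 8 < μ.real {x | hh K (F (g • x)) = hh K (F x)} := fun g => by
    refine eventual_meas μ _ univ (fun x _ => ?_) _ (by simp; norm_num)
    obtain ⟨k, hk⟩ := iso_QI ((hiso (g • x) x).2 (AA_smul_iso g x))
    exact hh_eq (QI_one_of hk)
  have hev2 : ∀ᶠ K in atTop, ∀ i j : Fin 2, 7 / 8 < μ.real {x | hh K (F (el i j 3 • x)) = hh K (F x)} ∧
      7 / 8 < μ.real {x | hh K (F (el i j (-3) • x)) = hh K (F x)} :=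
    eventually_all.2 fun i => eventually_all.2 fun j => (hev _).and (hev _)
  obtain ⟨K, hK⟩ := hev2.exists
  have hmh : ∀ v, MeasurableSet {x | v ∈ hh K (F x)} := meas_hh hF K
  let π : XX 2 → ratPowSubgroups 1 := fun x => code (hh K (F x))
  have hπ : Measurable π := measurable_code hmh
  have hts : ∀ x, toSub (π x) = hh K (F x) := fun x => toSub_code _
  let κ : ProbabilityTheory.Kernel (XX 2) (XX 2) := (ProbabilityTheory.condDistrib (id : XX 2 → XX 2) π μ).comap π hπ
  have hκ1 : ∀ x y, hh K (F x) = hh K (F y) → κ x = κ y := fun x y h => by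
    simp only [κ, ProbabilityTheory.Kernel.comap_apply, π, h]
  have hκ2 : ∀ᵐ x ∂μ, ∀ᵐ y ∂(κ x), hh K (F y) = hh K (F x) := by
    have h1 : MeasurableSet {p : ratPowSubgroups 1 × XX 2 | hh K (F p.2) = toSub p.1} :=
      meas_SG_eq (fun v => measurable_snd (hmh v)) (fun v => measurable_fst (meas_mem_toSub v))
    have h2 : ∀ᵐ p ∂((μ.map π).compProd (ProbabilityTheory.condDistrib (id : XX 2 → XX 2) π μ)), hh K (F p.2) = toSub p.1 := by
      rw [ProbabilityTheory.compProd_map_condDistrib aemeasurable_id]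
      rw [ae_map_iff (by fun_prop) h1]
      exact Eventually.of_forall fun x => (hts x).symm
    have h3 := Measure.ae_ae_of_ae_compProd h2
    have h4 := ae_of_ae_map hπ.aemeasurable h3
    filter_upwards [h4] with x hx
    simp only [hts] at hx
    exact hx
  let f : Set (QV 2) → XX 2 → ℝ≥0∞ := fun P x => κ x (Prod.mk x ⁻¹' WW P)
  have hfm : ∀ P, Measurable (f P) := fun P => ProbabilityTheory.Kernel.measurable_kernel_prodMk_left (meas_WW P)
  have hmW : ∀ P x, MeasurableSet (Prod.mk x ⁻¹' WW P) := fun P x => measurable_prodMk_left (meas_WW P)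
  have hf1 : ∀ P x, f P x ≤ 1 := fun P x => prob_le_one
  have shift : ∀ (g : SLm 2) (P), 7 / 8 < μ.real {x | hh K (F (g • x)) = hh K (F x)} →
      ∫⁻ x, f P x ∂μ ≤ ∫⁻ x, f {w | (g.1.map (Int.castRingHom ℚ)).mulVec w ∈ P} x ∂μ + ENNReal.ofReal (1 / 8) := by
    intro g P hg
    have hS : MeasurableSet {x | hh K (F (g • x)) = hh K (F x)} := meas_SG_eq (fun v => (smul_cont g).measurable (hmh v)) hmh
    have hSc : μ {x | hh K (F (g • x)) = hh K (F x)}ᶜ ≤ ENNReal.ofReal (1 / 8) := by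
      rw [← ENNReal.ofReal_toReal (measure_ne_top μ (_ᶜ))]
      apply ENNReal.ofReal_le_ofReal
      change μ.real _ ≤ _
      rw [probReal_compl_eq_one_sub hS]; linarith
    rw [← (smul_mp g).lintegral_comp (hfm P)]
    calc ∫⁻ x, f P (g • x) ∂μ ≤ ∫⁻ x, (f {w | (g.1.map (Int.castRingHom ℚ)).mulVec w ∈ P} x +
          ({x | hh K (F (g • x)) = hh K (F x)}ᶜ).indicator 1 x) ∂μ := by
          refine lintegral_mono fun x => ?_
          by_cases hx : hh K (F (g • x)) = hh K (F x)
          · refine le_trans ?_ le_self_add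
            simp only [f]
            rw [hκ1 _ _ hx]
            exact measure_mono fun y hy => WW_smul P g x y hy
          · refine le_trans (hf1 _ _) ?_
            rw [indicator_of_mem (show x ∈ {x | hh K (F (g • x)) = hh K (F x)}ᶜ from hx)]
            simp
      _ = _ := by
          rw [lintegral_add_left (hfm _), lintegral_indicator_one hS.compl]
      _ ≤ _ := by gcongr
  have hne : ∀ P, ∫⁻ x, f P x ∂μ ≠ ∞ := fun P => by
    refine ne_top_of_le_ne_top ENNReal.one_ne_top ((lintegral_mono (hf1 P)).trans ?_)
    simp
  have half : ∀ i j : Fin 2, i ≠ j → 2 * (∫⁻ x, f (PP i j) x ∂μ).toReal ≤ (∫⁻ x, f (PP j i) x ∂μ).toReal + 1 / 4 := by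
    intro i j hij
    have s1 := shift (el i j 3) (PP i j) (hK i j).1
    have s2 := shift (el i j (-3)) (PP i j) (hK i j).2
    have s3 : ∫⁻ x, f (PPs i j 3) x ∂μ + ∫⁻ x, f (PPs i j (-3)) x ∂μ ≤ ∫⁻ x, f (PP j i) x ∂μ := by
      rw [← lintegral_add_left (hfm _)]
      refine lintegral_mono_ae ?_
      filter_upwards [aut_null] with x hx
      simp only [f]
      have hd : Disjoint (Prod.mk x ⁻¹' WW (PPs i j 3)) (Prod.mk x ⁻¹' WW (PPs i j (-3))) :=
        disjoint_left.2 fun y hy hy' => WW_disj hx _ _ (PPs_disj hij) y hy hy'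
      rw [← measure_union hd (hmW _ _)]
      refine measure_mono (union_subset ?_ ?_)
      · rintro y ⟨k, hk, hP⟩
        exact ⟨k, hk, PPs_sub hij (Or.inl rfl) hP⟩
      · rintro y ⟨k, hk, hP⟩
        exact ⟨k, hk, PPs_sub hij (Or.inr rfl) hP⟩
    change _ ≤ ∫⁻ x, f (PPs i j 3) x ∂μ + _ at s1
    change _ ≤ ∫⁻ x, f (PPs i j (-3)) x ∂μ + _ at s2
    have t1 := ENNReal.toReal_mono (ENNReal.add_ne_top.2 ⟨hne _, ENNReal.ofReal_ne_top⟩) s1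
    have t2 := ENNReal.toReal_mono (ENNReal.add_ne_top.2 ⟨hne _, ENNReal.ofReal_ne_top⟩) s2
    have t3 := ENNReal.toReal_mono (hne _) s3
    rw [ENNReal.toReal_add (hne _) ENNReal.ofReal_ne_top, ENNReal.toReal_ofReal (by norm_num)] at t1 t2
    rw [ENNReal.toReal_add (hne _) (hne _)] at t3
    linarith
  have tot : 1 ≤ (∫⁻ x, f (PP 0 1) x ∂μ).toReal + (∫⁻ x, f (PP 1 0) x ∂μ).toReal := by
    rw [← ENNReal.toReal_add (hne _) (hne _), ← ENNReal.toReal_one]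
    refine ENNReal.toReal_mono (ENNReal.add_ne_top.2 ⟨hne _, hne _⟩) ?_
    rw [← lintegral_add_left (hfm _)]
    calc (1 : ℝ≥0∞) = ∫⁻ _, 1 ∂μ := by simp
      _ ≤ _ := by
        refine lintegral_mono_ae ?_
        filter_upwards [hκ2] with x hx
        have : κ x (Prod.mk x ⁻¹' WW (PP 0 1) ∪ Prod.mk x ⁻¹' WW (PP 1 0)) = 1 := by
          rw [← mem_ae_iff_prob_eq_one ((hmW _ _).union (hmW _ _))]
          filter_upwards [hx] with y hy
          obtain ⟨e⟩ := (hiso x y).1 (hh_one_iso hy.symm)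
          obtain ⟨k, hk⟩ := iso_matrix e
          rcases le_total |k.1 0 0| |k.1 0 1| with h | h
          · exact Or.inl ⟨k, hk, h⟩
          · exact Or.inr ⟨k, hk, h⟩
        rw [← this]
        exact measure_union_le _ _
  have a1 := half 0 1 (by simp)
  have a2 := half 1 0 (by simp)
  linarith

end Thomas
end
end

/-- Thomas: for each `n ≥ 1`, the isomorphism relation on additive subgroups of
`ℚ^n` is strictly below that on subgroups of `ℚ^(n+1)` in Borel cardinality. -/
theorem thomas_strict_hierarchy (n : ℕ) (hn : 1 ≤ n) :
    MeasurableSet (ratPowSubgroups n) ∧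
    MeasurableSet (ratPowSubgroups (n + 1)) ∧
    (∃ f : ratPowSubgroups n → ratPowSubgroups (n + 1), Measurable f ∧
      ∀ A B : ratPowSubgroups n, ratPowIso n A.1 B.1 ↔ ratPowIso (n + 1) (f A).1 (f B).1) ∧
    ¬ (∃ g : ratPowSubgroups (n + 1) → ratPowSubgroups n, Measurable g ∧
      ∀ A B : ratPowSubgroups (n + 1), ratPowIso (n + 1) A.1 B.1 ↔ ratPowIso n (g A).1 (g B).1) := by
  refine ⟨Thomas.meas_sub n, Thomas.meas_sub (n + 1), Thomas.embed n, ?_⟩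
  rintro ⟨g, hg, hgi⟩
  have hF : ∀ v, MeasurableSet {x : Thomas.XX (n + 1) | v ∈ Thomas.toSub (g (Thomas.code (Thomas.AA x)))} := fun v =>
    (hg.comp (Thomas.measurable_code Thomas.meas_AA)) (Thomas.meas_mem_toSub v)
  have hiso : ∀ x y : Thomas.XX (n + 1), Nonempty (Thomas.toSub (g (Thomas.code (Thomas.AA x))) ≃+
      Thomas.toSub (g (Thomas.code (Thomas.AA y)))) ↔ Nonempty (Thomas.AA x ≃+ Thomas.AA y) := fun x y => by
    rw [← Thomas.iso_iff, ← hgi, Thomas.iso_iff, Thomas.toSub_code, Thomas.toSub_code]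
  rcases Nat.lt_or_ge 1 n with h | h
  · exact Thomas.phase2 (Nat.lt_succ_self n) (by omega) _ hF hiso
  · obtain rfl : n = 1 := by omega
    exact Thomas.noRed1 _ hF hiso
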